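/- Let S ∈ sp(n,ℂ) with Re Q_S ≥ 0, assume S_i ≠ 0 (so ν > 0) and condition (R), and let α ∈ ℂ with |Re α| < ν. Then for every f ∈ 𝒮(ℍ_n) the integral ⟨K_α, f⟩ := −∫_ℝ ∫_0^∞ e^{−2παt·sgn(μ)} ⟨Γ^μ_{t,S}, f^{−μ}⟩ dt dμ/|μ| converges absolutely and defines a tempered distribution K_α ∈ 𝒮'(ℍ_n); moreover K_α is a fundamental solution of L_{S,α} = L_S + iαU, i.e. L_{S,α} K_α = δ₀. -/

import Mathlib

open MeasureTheory Complex Matrix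

noncomputable section

/-- Index type for `2n`-dimensional (symplectic) vectors: `X`-coordinates `inl j`,
`Y`-coordinates `inr j`. -/
abbrev Idx (n : ℕ) := Fin n ⊕ Fin n

/-- The standard symplectic matrix `J = [[0, I],[-I, 0]]` over `ℂ`. -/
def Jmat (n : ℕ) : Matrix (Idx n) (Idx n) ℂ := Matrix.fromBlocks 0 1 (-1) 0

/-- The standard symplectic matrix `J = [[0, I],[-I, 0]]` over `ℝ`. -/
def JmatR (n : ℕ) : Matrix (Idx n) (Idx n) ℝ := Matrix.fromBlocks 0 1 (-1) 0

/-- The standard symplectic form `σ(z,w) = ᵗz J w` on `ℂ^{2n}`. -/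
def sigmaC (n : ℕ) (z w : Idx n → ℂ) : ℂ := z ⬝ᵥ (Jmat n).mulVec w

/-- The standard symplectic form on `ℝ^{2n}`. -/
def sigmaR (n : ℕ) (v w : Idx n → ℝ) : ℝ := v ⬝ᵥ (JmatR n).mulVec w

/-- Inclusion of real vectors into `ℂ^{2n}`. -/
def realVec (n : ℕ) (v : Idx n → ℝ) : Idx n → ℂ := fun i => (v i : ℂ)

/-- Complex conjugation on `ℂ^{2n}` relative to the real form `ℝ^{2n}`. -/
def conjVec (n : ℕ) (z : Idx n → ℂ) : Idx n → ℂ := fun i => (starRingEnd ℂ) (z i)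

/-- `S ∈ sp(n, ℂ)`, i.e. `σ(Sz, w) + σ(z, Sw) = 0` for all `z, w`. -/
def InSp (n : ℕ) (S : Matrix (Idx n) (Idx n) ℂ) : Prop := Sᵀ * Jmat n + Jmat n * S = 0

/-- `Re Q_S ≥ 0`: the real part of the quadratic form `Q_S(v) = σ(v, Sv)` is
positive semi-definite on `ℝ^{2n}`. -/
def RePosQ (n : ℕ) (S : Matrix (Idx n) (Idx n) ℂ) : Prop :=
  ∀ v : Idx n → ℝ, 0 ≤ (sigmaC n (realVec n v) (S.mulVec (realVec n v))).re

/-- The generalized eigenspace `V_μ` of the matrix `S` for the eigenvalue `μ`. -/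
def genEig (n : ℕ) (S : Matrix (Idx n) (Idx n) ℂ) (μ : ℂ) : Submodule ℂ (Idx n → ℂ) :=
  Module.End.maxGenEigenspace (Matrix.mulVecLin S) μ

/-- `V_r`: the sum of the generalized eigenspaces of `S` for real eigenvalues. -/
def Vreal (n : ℕ) (S : Matrix (Idx n) (Idx n) ℂ) : Submodule ℂ (Idx n → ℂ) :=
  ⨆ lam : ℝ, genEig n S (lam : ℂ)

/-- `V_i`: the sum of the generalized eigenspaces of `S` for non-real eigenvalues. -/
def Vimag (n : ℕ) (S : Matrix (Idx n) (Idx n) ℂ) : Submodule ℂ (Idx n → ℂ) :=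
  ⨆ μ : {z : ℂ // z.im ≠ 0}, genEig n S (μ : ℂ)

/-- `Sr` is the "real part" `S_r` of `S`: it agrees with `S` on `V_r` and vanishes on `V_i`. -/
def IsRealPart (n : ℕ) (S Sr : Matrix (Idx n) (Idx n) ℂ) : Prop :=
  (∀ v ∈ Vreal n S, Sr.mulVec v = S.mulVec v) ∧ ∀ v ∈ Vimag n S, Sr.mulVec v = 0

/-- `Si` is the "imaginary part" `S_i` of `S`: it vanishes on `V_r` and agrees with `S`
on `V_i`. -/
def IsImagPart (n : ℕ) (S Si : Matrix (Idx n) (Idx n) ℂ) : Prop :=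
  (∀ v ∈ Vreal n S, Si.mulVec v = 0) ∧ ∀ v ∈ Vimag n S, Si.mulVec v = S.mulVec v

/-- Condition (R): `V_λ ⊕ V_{−λ}` is invariant under complex conjugation for every
real `λ ≠ 0`. -/
def CondR (n : ℕ) (S : Matrix (Idx n) (Idx n) ℂ) : Prop :=
  ∀ lam : ℝ, lam ≠ 0 →
    ∀ z ∈ genEig n S (lam : ℂ) ⊔ genEig n S (-(lam : ℂ)),
      conjVec n z ∈ genEig n S (lam : ℂ) ⊔ genEig n S (-(lam : ℂ))

/-- `ν = Σ_j ν_j`: the sum of the imaginary parts of the eigenvalues of `S` lying in the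
upper half plane, counted with multiplicity. -/
def nuTotal (n : ℕ) (S : Matrix (Idx n) (Idx n) ℂ) : ℝ :=
  (S.charpoly.roots.map (fun z => max z.im 0)).sum

/-- `S_i ≠ 0`, i.e. `S` has at least one non-real eigenvalue. -/
def HasNonrealEig (n : ℕ) (S : Matrix (Idx n) (Idx n) ℂ) : Prop :=
  ∃ z ∈ S.charpoly.roots, z.im ≠ 0

/-- Semisimple (= diagonalizable over `ℂ`) matrix. -/
def IsSemisimpleMat (n : ℕ) (D : Matrix (Idx n) (Idx n) ℂ) : Prop :=
  ∃ (P : Matrix (Idx n) (Idx n) ℂ) (d : Idx n → ℂ), IsUnit P ∧ D = P * Matrix.diagonal d * P⁻¹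

/-- `S = D + N` is the Jordan decomposition of `S`: `D` semisimple, `N` nilpotent,
`DN = ND`. -/
def IsJordanDecomp (n : ℕ) (S D N : Matrix (Idx n) (Idx n) ℂ) : Prop :=
  S = D + N ∧ IsSemisimpleMat n D ∧ IsNilpotent N ∧ D * N = N * D

/-- The Heisenberg group `ℍ_n = ℝ^n × ℝ^n × ℝ`, with coordinates `(x, y, u)`. -/
abbrev Hgrp (n : ℕ) := (Fin n → ℝ) × (Fin n → ℝ) × ℝ

/-- The left-invariant vector field `X_j = ∂_{x_j} - (1/2) y_j ∂_u` on `ℍ_n`. -/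
def Xop (n : ℕ) (j : Fin n) (f : Hgrp n → ℂ) : Hgrp n → ℂ :=
  fun p => fderiv ℝ f p (Pi.single j 1, 0, 0) - ((p.2.1 j : ℂ) / 2) * fderiv ℝ f p (0, 0, 1)

/-- The left-invariant vector field `Y_j = ∂_{y_j} + (1/2) x_j ∂_u` on `ℍ_n`. -/
def Yop (n : ℕ) (j : Fin n) (f : Hgrp n → ℂ) : Hgrp n → ℂ :=
  fun p => fderiv ℝ f p (0, Pi.single j 1, 0) + ((p.1 j : ℂ) / 2) * fderiv ℝ f p (0, 0, 1)

/-- The central left-invariant vector field `U = ∂_u` on `ℍ_n`. -/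
def Uop (n : ℕ) (f : Hgrp n → ℂ) : Hgrp n → ℂ := fun p => fderiv ℝ f p (0, 0, 1)

/-- `(V_1, …, V_{2n}) = (X_1, …, X_n, Y_1, …, Y_n)`. -/
def Vop (n : ℕ) : Idx n → (Hgrp n → ℂ) → Hgrp n → ℂ
  | Sum.inl j => Xop n j
  | Sum.inr j => Yop n j

/-- The operator `L_{A,α} = Σ_{j,k} a_{jk} V_j V_k + iα U` on `ℍ_n`. -/
def Lop (n : ℕ) (A : Matrix (Idx n) (Idx n) ℂ) (α : ℂ) (f : Hgrp n → ℂ) : Hgrp n → ℂ :=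
  fun p => (∑ j, ∑ k, A j k * Vop n j (Vop n k f) p) + Complex.I * α * Uop n f p

/-- `φ ∈ C_c^∞(Ω)`. -/
def IsTestOn (n : ℕ) (Ω : Set (Hgrp n)) (φ : Hgrp n → ℂ) : Prop :=
  ContDiff ℝ (⊤ : ℕ∞) φ ∧ HasCompactSupport φ ∧ tsupport φ ⊆ Ω

/-- Local solvability of an operator `L` whose formal transpose (with respect to the
bilinear pairing `(f, φ) ↦ ∫ f φ` and Haar = Lebesgue measure) is `Lt`: every point has an
open neighborhood `Ω` such that for every `f ∈ C_c^∞(Ω)` there is a distribution `u` on `Ω`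
(a linear functional acting on test functions) with `Lu = f` on `Ω`, i.e.
`u(Lt φ) = ∫ f φ` for all `φ ∈ C_c^∞(Ω)`. -/
def LocSolvVia (n : ℕ) (Lt : (Hgrp n → ℂ) → Hgrp n → ℂ) : Prop :=
  ∀ p : Hgrp n, ∃ Ω : Set (Hgrp n), IsOpen Ω ∧ p ∈ Ω ∧
    ∀ f : Hgrp n → ℂ, IsTestOn n Ω f →
      ∃ u : (Hgrp n → ℂ) →ₗ[ℂ] ℂ,
        ∀ φ : Hgrp n → ℂ, IsTestOn n Ω φ → u (Lt φ) = ∫ x, f x * φ x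

/-- Local solvability of `L_{A,α} = Σ a_{jk} V_j V_k + iαU` (for symmetric `A`); its
formal transpose is `L_{A,-α}` since the `V_j` are formally skew-adjoint and the second
order part is formally self-transposed. -/
def LocSolv (n : ℕ) (A : Matrix (Idx n) (Idx n) ℂ) (α : ℂ) : Prop :=
  LocSolvVia n (Lop n A (-α))

/-- The matrix exponential `exp M = Σ M^k / k!`. -/
def matExp {ι : Type} [Fintype ι] [DecidableEq ι] (M : Matrix ι ι ℂ) : Matrix ι ι ℂ :=
  ∑' k : ℕ, ((k.factorial : ℂ)⁻¹) • M ^ k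

/-- The matrix cosine `cos M = (exp(iM) + exp(-iM))/2`. -/
def matCos {ι : Type} [Fintype ι] [DecidableEq ι] (M : Matrix ι ι ℂ) : Matrix ι ι ℂ :=
  (2 : ℂ)⁻¹ • (matExp (Complex.I • M) + matExp (-(Complex.I • M)))

/-- The matrix sine `sin M = (exp(iM) - exp(-iM))/(2i)`. -/
def matSin {ι : Type} [Fintype ι] [DecidableEq ι] (M : Matrix ι ι ℂ) : Matrix ι ι ℂ :=
  (2 * Complex.I)⁻¹ • (matExp (Complex.I • M) - matExp (-(Complex.I • M)))

/-- The matrix tangent `tan M = (sin M)(cos M)⁻¹` (junk value if `cos M` is singular). -/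
def matTan {ι : Type} [Fintype ι] [DecidableEq ι] (M : Matrix ι ι ℂ) : Matrix ι ι ℂ :=
  matSin M * (matCos M)⁻¹

/-- `l = [λ_1, …, λ_m]` lists, with multiplicity, one representative of each pair
`±λ_j` of non-zero eigenvalues of `T`: the eigenvalues of `T` (the roots of its
characteristic polynomial) are exactly `λ_1, -λ_1, …, λ_m, -λ_m` together with
`2n - 2m` zeros. -/
def IsPairingList (n : ℕ) (T : Matrix (Idx n) (Idx n) ℂ) (l : List ℂ) : Prop :=
  (∀ z ∈ l, z ≠ 0) ∧
    T.charpoly.roots = (l : Multiset ℂ) + ((l.map Neg.neg : List ℂ) : Multiset ℂ) +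
      Multiset.replicate (2 * n - 2 * l.length) 0

/-- `√(det cos(2πtT)) := Π_j cos(2πtλ_j)`, where `±λ_1, …, ±λ_m` are the non-zero
eigenvalues of `T`, listed with multiplicity by the pairing list `l`. -/
def sqrtDetCos (t : ℂ) (l : List ℂ) : ℂ :=
  ∏ i : Fin l.length, Complex.cos (2 * (Real.pi : ℂ) * t * l.get i)

/-- The Fourier transform `Γ̂^μ_{t,T}(w) = det(cos 2πtT)^{-1/2}
exp(-(2π/|μ|) σ(w, tan(2πtT) w))` of the heat kernel for `|U|⁻¹ L_T` at time `t`. -/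
def GammaHat (n : ℕ) (μ : ℝ) (t : ℂ) (T : Matrix (Idx n) (Idx n) ℂ) (l : List ℂ)
    (w : Idx n → ℂ) : ℂ :=
  (sqrtDetCos t l)⁻¹ *
    Complex.exp (-(2 * (Real.pi : ℂ) / ((|μ| : ℝ) : ℂ)) *
      sigmaC n w ((matTan ((2 * (Real.pi : ℂ) * t) • T)).mulVec w))

/-- The underlying space `ℝ^{2n} = ℝ^n × ℝ^n` of the twisted (partial Fourier
transformed) picture. -/
abbrev Pl (n : ℕ) := (Fin n → ℝ) × (Fin n → ℝ)

/-- The `μ`-twisted vector fields `Ṽ_j^μ`: `X̃_j^μ = ∂_{x_j} - πiμ y_j` and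
`Ỹ_j^μ = ∂_{y_j} + πiμ x_j`. -/
def tVop (n : ℕ) (μ : ℝ) : Idx n → (Pl n → ℂ) → Pl n → ℂ
  | Sum.inl j => fun f p =>
      fderiv ℝ f p (Pi.single j 1, 0) -
        (Real.pi : ℂ) * Complex.I * (μ : ℂ) * (p.2 j : ℂ) * f p
  | Sum.inr j => fun f p =>
      fderiv ℝ f p (0, Pi.single j 1) +
        (Real.pi : ℂ) * Complex.I * (μ : ℂ) * (p.1 j : ℂ) * f p

/-- The `μ`-twisted operator `L̃^μ_A = Σ_{j,k} a_{jk} Ṽ_j^μ Ṽ_k^μ`. -/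
def tLop (n : ℕ) (A : Matrix (Idx n) (Idx n) ℂ) (μ : ℝ) (f : Pl n → ℂ) : Pl n → ℂ :=
  fun p => ∑ j, ∑ k, A j k * tVop n μ j (tVop n μ k f) p

/-- `g = L̃^μ_A f` in the sense of distributions: for every test function `φ`,
`∫ f ⋅ (L̃^μ_A)ᵗ φ = ∫ g φ`, where the formal transpose of `L̃^μ_A` (for symmetric `A`)
is `L̃^{-μ}_A`.  Thus `f` belongs to the maximal domain of `L̃^μ_A` on `L²` precisely
when such a `g ∈ L²` exists. -/
def WeakTL (n : ℕ) (A : Matrix (Idx n) (Idx n) ℂ) (μ : ℝ) (f g : Pl n → ℂ) : Prop :=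
  ∀ φ : Pl n → ℂ, ContDiff ℝ (⊤ : ℕ∞) φ → HasCompactSupport φ →
    ∫ x, f x * tLop n A (-μ) φ x = ∫ x, g x * φ x

/-- Identification of `Pl n = ℝ^n × ℝ^n` with symplectic vectors `Idx n → ℝ`. -/
def plVec (n : ℕ) (w : Pl n) : Idx n → ℝ := Sum.elim w.1 w.2

set_option linter.all false

section part1
open scoped Matrix.Norms.Operator in
theorem matExp_eq {ι : Type} [Fintype ι] [DecidableEq ι] (M : Matrix ι ι ℂ) :
    matExp M = NormedSpace.exp M := by
  rw [matExp, NormedSpace.exp_eq_tsum ℂ]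

theorem det_sub_smul_one {ι : Type} [Fintype ι] [DecidableEq ι] (S : Matrix ι ι ℂ) (r : ℂ) :
    (S - algebraMap ℂ (Matrix ι ι ℂ) r).det = (S.charpoly.roots.map (fun z => z - r)).prod := by
  have h1 : S.charpoly.eval r = (S.charpoly.roots.map (fun z => r - z)).prod := by
    conv_lhs => rw [(IsAlgClosed.splits S.charpoly).eq_prod_roots_of_monic S.charpoly_monic]
    rw [Polynomial.eval_multiset_prod, Multiset.map_map]
    congr 1
    apply Multiset.map_congr rfl
    intro x _; simp
  rw [Matrix.eval_charpoly] at h1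
  have h2 : S - algebraMap ℂ (Matrix ι ι ℂ) r = -(Matrix.scalar ι r - S) := by
    rw [neg_sub]; rfl
  rw [h2, Matrix.det_neg, h1]
  have hc : Multiset.card S.charpoly.roots = Fintype.card ι := by
    rw [← (IsAlgClosed.splits S.charpoly).natDegree_eq_card_roots, Matrix.charpoly_natDegree_eq_dim]
  rw [← hc]
  generalize S.charpoly.roots = m
  induction m using Multiset.induction_on with
  | empty => simp
  | cons a s ih =>
    simp only [Multiset.card_cons, Multiset.map_cons, Multiset.prod_cons, ← ih]
    ring

theorem det_aeval_eq {ι : Type} [Fintype ι] [DecidableEq ι] (S : Matrix ι ι ℂ) (p : Polynomial ℂ) :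
    (Polynomial.aeval S p).det = (S.charpoly.roots.map (fun z => p.eval z)).prod := by
  have hc : Multiset.card S.charpoly.roots = Fintype.card ι := by
    rw [← (IsAlgClosed.splits S.charpoly).natDegree_eq_card_roots, Matrix.charpoly_natDegree_eq_dim]
  have hp := (IsAlgClosed.splits p).eq_prod_roots
  have key : ∀ s : Multiset ℂ, (Polynomial.aeval S (s.map (fun a => Polynomial.X - Polynomial.C a)).prod).det
      = (S.charpoly.roots.map (fun z => (s.map (fun a => Polynomial.X - Polynomial.C a)).prod.eval z)).prod := by
    intro s
    induction s using Multiset.induction_on with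
    | empty => simp
    | cons a s ih =>
      simp only [Multiset.map_cons, Multiset.prod_cons, map_mul, Matrix.det_mul, ih,
        Polynomial.eval_mul, Multiset.prod_map_mul]
      congr 1
      simp only [map_sub, Polynomial.aeval_X, Polynomial.aeval_C, Polynomial.eval_sub,
        Polynomial.eval_X, Polynomial.eval_C]
      exact det_sub_smul_one S a
  rw [hp]
  simp only [map_mul, Matrix.det_mul, Polynomial.eval_mul, Multiset.prod_map_mul, key,
    Polynomial.aeval_C, Polynomial.eval_C]
  congr 1
  simp [Algebra.algebraMap_eq_smul_one, Matrix.det_smul, hc]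

theorem roots_charpoly_aeval {ι : Type} [Fintype ι] [DecidableEq ι] (S : Matrix ι ι ℂ)
    (p : Polynomial ℂ) :
    (Polynomial.aeval S p).charpoly.roots = S.charpoly.roots.map (fun z => p.eval z) := by
  have : (Polynomial.aeval S p).charpoly =
      ((S.charpoly.roots.map (fun z => p.eval z)).map (fun a => Polynomial.X - Polynomial.C a)).prod := by
    apply Polynomial.funext
    intro x
    rw [Matrix.eval_charpoly, Polynomial.eval_multiset_prod]
    have h := det_aeval_eq S (Polynomial.C x - p)
    have h2 : Polynomial.aeval S (Polynomial.C x - p) = Matrix.scalar ι x - Polynomial.aeval S p := by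
      rw [map_sub, Polynomial.aeval_C]; rfl
    rw [← h2, h, Multiset.map_map, Multiset.map_map]
    congr 1
    apply Multiset.map_congr rfl
    intro z _; simp
  rw [this, Polynomial.roots_multiset_prod_X_sub_C]

theorem aeval_mulVec_eig {ι : Type} [Fintype ι] [DecidableEq ι] (S : Matrix ι ι ℂ)
    (p : Polynomial ℂ) (v : ι → ℂ) (z : ℂ) (h : S *ᵥ v = z • v) :
    (Polynomial.aeval S p) *ᵥ v = p.eval z • v := by
  induction p using Polynomial.induction_on' with
  | add p q hp hq => rw [map_add, Matrix.add_mulVec, hp, hq, Polynomial.eval_add, add_smul]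
  | monomial k a =>
    rw [Polynomial.aeval_monomial, Polynomial.eval_monomial]
    have : ∀ k : ℕ, (S ^ k) *ᵥ v = z ^ k • v := by
      intro k
      induction k with
      | zero => simp
      | succ k ih => rw [pow_succ, ← Matrix.mulVec_mulVec, h, Matrix.mulVec_smul, ih, smul_smul, pow_succ, mul_comm]
    rw [← Matrix.mulVec_mulVec, this, Algebra.algebraMap_eq_smul_one, Matrix.smul_mulVec, Matrix.one_mulVec, smul_smul]

theorem exists_eigvec {ι : Type} [Fintype ι] [DecidableEq ι] (S : Matrix ι ι ℂ) (z : ℂ)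
    (hz : z ∈ S.charpoly.roots) : ∃ v : ι → ℂ, v ≠ 0 ∧ S *ᵥ v = z • v := by
  have h0 : S.charpoly.eval z = 0 := (Polynomial.mem_roots'.1 hz).2
  rw [Matrix.eval_charpoly] at h0
  obtain ⟨v, hv, h⟩ := Matrix.exists_mulVec_eq_zero_iff.2 h0
  refine ⟨v, hv, ?_⟩
  rw [Matrix.sub_mulVec, sub_eq_zero] at h
  rw [← h]
  ext i
  simp [Matrix.scalar, Matrix.mulVec_diagonal]

theorem roots_of_mem_adjoin {ι : Type} [Fintype ι] [DecidableEq ι] (S X : Matrix ι ι ℂ)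
    (hX : X ∈ Algebra.adjoin ℂ {S}) (χ : ℂ → ℂ)
    (hχ : ∀ v : ι → ℂ, ∀ z, v ≠ 0 → S *ᵥ v = z • v → X *ᵥ v = χ z • v) :
    X.charpoly.roots = S.charpoly.roots.map χ := by
  rw [Algebra.adjoin_singleton_eq_range_aeval] at hX
  obtain ⟨p, rfl⟩ := hX
  have : (Polynomial.aeval S).toRingHom p = Polynomial.aeval S p := rfl
  change (Polynomial.aeval S p).charpoly.roots = _
  rw [roots_charpoly_aeval]
  apply Multiset.map_congr rfl
  intro z hz
  obtain ⟨v, hv, h⟩ := exists_eigvec S z hz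
  have h1 := hχ v z hv h
  have h2 := aeval_mulVec_eig S p v z h
  change (Polynomial.aeval S p) *ᵥ v = _ at h1
  rw [h2] at h1
  exact smul_left_injective ℂ hv h1

theorem det_of_mem_adjoin {ι : Type} [Fintype ι] [DecidableEq ι] (S X : Matrix ι ι ℂ)
    (hX : X ∈ Algebra.adjoin ℂ {S}) (χ : ℂ → ℂ)
    (hχ : ∀ v : ι → ℂ, ∀ z, v ≠ 0 → S *ᵥ v = z • v → X *ᵥ v = χ z • v) :
    X.det = (S.charpoly.roots.map χ).prod := by
  rw [Matrix.det_eq_prod_roots_charpoly, roots_of_mem_adjoin S X hX χ hχ]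

theorem trace_of_mem_adjoin {ι : Type} [Fintype ι] [DecidableEq ι] (S X : Matrix ι ι ℂ)
    (hX : X ∈ Algebra.adjoin ℂ {S}) (χ : ℂ → ℂ)
    (hχ : ∀ v : ι → ℂ, ∀ z, v ≠ 0 → S *ᵥ v = z • v → X *ᵥ v = χ z • v) :
    X.trace = (S.charpoly.roots.map χ).sum := by
  rw [Matrix.trace_eq_sum_roots_charpoly, roots_of_mem_adjoin S X hX χ hχ]

/-- The one-parameter group `exp(zS)`. -/
def eS {ι : Type} [Fintype ι] [DecidableEq ι] (S : Matrix ι ι ℂ) (z : ℂ) : Matrix ι ι ℂ :=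
  NormedSpace.exp (z • S)

open scoped Matrix.Norms.Operator in
theorem eS_hasDerivAt {ι : Type} [Fintype ι] [DecidableEq ι] (S : Matrix ι ι ℂ) (z : ℂ) :
    HasDerivAt (eS S) (S * eS S z) z := by
  exact hasDerivAt_exp_smul_const' S z

open scoped Matrix.Norms.Operator in
theorem eS_add {ι : Type} [Fintype ι] [DecidableEq ι] (S : Matrix ι ι ℂ) (z w : ℂ) :
    eS S (z + w) = eS S z * eS S w := by
  unfold eS
  rw [add_smul]
  apply NormedSpace.exp_add_of_commute
  exact ((Commute.refl S).smul_left z).smul_right w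

theorem eS_zero {ι : Type} [Fintype ι] [DecidableEq ι] (S : Matrix ι ι ℂ) : eS S 0 = 1 := by
  unfold eS; rw [zero_smul, NormedSpace.exp_zero]

theorem eS_commute {ι : Type} [Fintype ι] [DecidableEq ι] (S : Matrix ι ι ℂ) (z : ℂ) :
    Commute S (eS S z) := by
  unfold eS
  exact Commute.exp_right ((Commute.refl S).smul_right z)

open scoped Matrix.Norms.Operator in
theorem eS_hasSum {ι : Type} [Fintype ι] [DecidableEq ι] (S : Matrix ι ι ℂ) (z : ℂ) :
    HasSum (fun k : ℕ => ((k.factorial : ℂ)⁻¹) • (z • S) ^ k) (eS S z) :=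
  NormedSpace.exp_series_hasSum_exp' (z • S)

open scoped Matrix.Norms.Operator in
theorem eS_mem {ι : Type} [Fintype ι] [DecidableEq ι] (S : Matrix ι ι ℂ) (z : ℂ) :
    eS S z ∈ Algebra.adjoin ℂ {S} := by
  have hcl : IsClosed ((Subalgebra.toSubmodule (Algebra.adjoin ℂ {S}) : Submodule ℂ (Matrix ι ι ℂ)) : Set (Matrix ι ι ℂ)) :=
    Submodule.closed_of_finiteDimensional _
  have := hcl.mem_of_tendsto (eS_hasSum S z) (Filter.Eventually.of_forall (fun s => ?_))
  · exact this
  · apply Submodule.sum_mem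
    intro k _
    apply Submodule.smul_mem
    rw [Subalgebra.mem_toSubmodule]
    apply Subalgebra.pow_mem
    apply Subalgebra.smul_mem
    exact Algebra.self_mem_adjoin_singleton ℂ S

theorem eS_eig {ι : Type} [Fintype ι] [DecidableEq ι] (S : Matrix ι ι ℂ) (z : ℂ)
    (v : ι → ℂ) (l : ℂ) (h : S *ᵥ v = l • v) : eS S z *ᵥ v = Complex.exp (z * l) • v := by
  have h1 := eS_hasSum S z
  have h2 : HasSum (fun k : ℕ => (((k.factorial : ℂ)⁻¹) • (z • S) ^ k) *ᵥ v) (eS S z *ᵥ v) := by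
    have hc : Continuous (fun M : Matrix ι ι ℂ => M *ᵥ v) := by fun_prop
    exact h1.map (⟨⟨fun M : Matrix ι ι ℂ => M *ᵥ v, by simp⟩, by intro a b; simp [Matrix.add_mulVec]⟩ : Matrix ι ι ℂ →+ (ι → ℂ)) hc
  have h3 : HasSum (fun k : ℕ => (((k.factorial : ℂ)⁻¹) • (z * l) ^ k) • v) (Complex.exp (z * l) • v) := by
    have := NormedSpace.exp_series_hasSum_exp' (𝕂 := ℂ) (z * l)
    rw [← Complex.exp_eq_exp_ℂ] at this
    exact this.smul_const v
  refine h2.unique ?_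
  convert h3 using 2 with k
  rw [Matrix.smul_mulVec, smul_assoc]
  congr 1
  have : (z • S) *ᵥ v = (z * l) • v := by rw [Matrix.smul_mulVec, h, smul_smul]
  have := aeval_mulVec_eig (z • S) (Polynomial.X ^ k) v (z * l) this
  simpa using this

theorem eS_neg_mul {ι : Type} [Fintype ι] [DecidableEq ι] (S : Matrix ι ι ℂ) (z : ℂ) :
    eS S (-z) * eS S z = 1 := by
  rw [← eS_add]; simp [eS_zero]

theorem eS_det {ι : Type} [Fintype ι] [DecidableEq ι] (S : Matrix ι ι ℂ) (z : ℂ) :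
    (eS S z).det = Complex.exp (z * S.trace) := by
  rw [det_of_mem_adjoin S _ (eS_mem S z) (fun l => Complex.exp (z * l))
    (fun v l _ h => eS_eig S z v l h), Matrix.trace_eq_sum_roots_charpoly]
  generalize S.charpoly.roots = m
  induction m using Multiset.induction_on with
  | empty => simp
  | cons a s ih => simp [ih, mul_add, Complex.exp_add]
end part1

section part2
/-- The squared Euclidean norm. -/
def nsq {ι : Type} [Fintype ι] (x : ι → ℂ) : ℝ := (star x ⬝ᵥ x).re

theorem nsq_eq {ι : Type} [Fintype ι] (x : ι → ℂ) : nsq x = ∑ i, ‖x i‖ ^ 2 := by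
  simp only [nsq, dotProduct, Pi.star_apply, Complex.re_sum]
  refine Finset.sum_congr rfl fun i _ => ?_
  rw [← Complex.normSq_eq_norm_sq, Complex.normSq_apply]
  simp

theorem nsq_nonneg {ι : Type} [Fintype ι] (x : ι → ℂ) : 0 ≤ nsq x := by
  rw [nsq_eq]; positivity

theorem nsq_eq_zero {ι : Type} [Fintype ι] (x : ι → ℂ) (h : nsq x ≤ 0) : x = 0 := by
  rw [nsq_eq] at h
  have h0 := le_antisymm h (by positivity)
  rw [Finset.sum_eq_zero_iff_of_nonneg (by intros; positivity)] at h0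
  funext i
  have := h0 i (Finset.mem_univ _)
  simpa using this

theorem star_dot_mulVec {ι : Type} [Fintype ι] (M : Matrix ι ι ℂ) (x y : ι → ℂ) :
    star x ⬝ᵥ (M *ᵥ y) = star (Mᴴ *ᵥ x) ⬝ᵥ y := by
  rw [Matrix.star_mulVec, Matrix.conjTranspose_conjTranspose, Matrix.dotProduct_mulVec]

/-- the hermitian form `H(x) = i σ(x̄, x)` -/
def Hf (n : ℕ) (x : Idx n → ℂ) : ℝ := (Complex.I * (star x ⬝ᵥ (Jmat n *ᵥ x))).re

theorem Jmat_transpose (n : ℕ) : (Jmat n)ᵀ = - Jmat n := by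
  simp [Jmat, Matrix.fromBlocks_transpose, Matrix.fromBlocks_neg]

theorem Jmat_conjTranspose (n : ℕ) : (Jmat n)ᴴ = - Jmat n := by
  simp [Jmat, Matrix.fromBlocks_conjTranspose, Matrix.fromBlocks_neg]

theorem Jmat_sq (n : ℕ) : Jmat n * Jmat n = -1 := by
  rw [Jmat, Matrix.fromBlocks_multiply, ← Matrix.fromBlocks_one, Matrix.fromBlocks_neg]; simp

theorem Jmat_star (n : ℕ) : (Jmat n).map star = Jmat n := by
  have h1 := Jmat_conjTranspose n
  have h2 := Jmat_transpose n
  have : (Jmat n)ᴴ = ((Jmat n).map star)ᵀ := by ext i j; simp [Matrix.conjTranspose_apply]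
  rw [this] at h1
  have h3 := congrArg Matrix.transpose h1
  rw [Matrix.transpose_transpose, Matrix.transpose_neg, h2, neg_neg] at h3
  exact h3

theorem Hf_hasDerivAt (n : ℕ) (y : ℝ → Idx n → ℂ) (y' : Idx n → ℂ) (t : ℝ)
    (h : HasDerivAt y y' t) :
    HasDerivAt (fun t => Hf n (y t)) (2 * (Complex.I * (star (y t) ⬝ᵥ (Jmat n *ᵥ y'))).re) t := by
  have hi : ∀ i, HasDerivAt (fun t => y t i) (y' i) t := hasDerivAt_pi.1 h
  have hJ : ∀ i, HasDerivAt (fun t => (Jmat n *ᵥ y t) i) ((Jmat n *ᵥ y') i) t := by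
    intro i
    simp only [Matrix.mulVec, dotProduct]
    exact HasDerivAt.fun_sum fun j _ => (hi j).const_mul _
  have h1 : HasDerivAt (fun t => Complex.I * (star (y t) ⬝ᵥ (Jmat n *ᵥ y t)))
      (Complex.I * (star y' ⬝ᵥ (Jmat n *ᵥ y t) + star (y t) ⬝ᵥ (Jmat n *ᵥ y'))) t := by
    apply HasDerivAt.const_mul
    simp only [dotProduct, ← Finset.sum_add_distrib]
    exact HasDerivAt.fun_sum fun j _ => ((hi j).star).mul (hJ j)
  have h2 := (Complex.reCLM.hasFDerivAt.comp_hasDerivAt t h1)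
  have h3 : star y' ⬝ᵥ (Jmat n *ᵥ y t) = - star (star (y t) ⬝ᵥ (Jmat n *ᵥ y')) := by
    rw [star_dot_mulVec, Jmat_conjTranspose, ← Matrix.star_dotProduct_star]
    simp [Matrix.neg_mulVec, dotProduct_comm]
  have h4 : (2 * (Complex.I * (star (y t) ⬝ᵥ (Jmat n *ᵥ y'))).re) =
      Complex.reCLM (Complex.I * (star y' ⬝ᵥ (Jmat n *ᵥ y t) + star (y t) ⬝ᵥ (Jmat n *ᵥ y'))) := by
    rw [h3]
    simp only [Complex.reCLM_apply, Complex.mul_re, Complex.add_re, Complex.add_im, Complex.I_re, Complex.I_im,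
      Complex.neg_re, Complex.neg_im, Complex.star_def, Complex.conj_re, Complex.conj_im]
    ring
  rw [h4]
  exact h2

open scoped Matrix.Norms.Operator in
theorem eS_path (n : ℕ) (X : Matrix (Idx n) (Idx n) ℂ) (z : Idx n → ℂ) (t : ℝ) :
    HasDerivAt (fun t : ℝ => eS X (t : ℂ) *ᵥ z) (X *ᵥ (eS X (t : ℂ) *ᵥ z)) t := by
  have h1 : HasDerivAt (fun t : ℝ => eS X (t : ℂ)) (X * eS X (t : ℂ)) t :=
    by
    have := (eS_hasDerivAt X (t : ℂ)).scomp t (Complex.ofRealCLM.hasDerivAt (x := t))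
    rw [show Complex.ofRealCLM 1 = (1 : ℂ) by simp, one_smul] at this
    exact this
  let Lm : Matrix (Idx n) (Idx n) ℂ →ₗ[ℝ] (Idx n → ℂ) :=
    { toFun := fun M => M *ᵥ z
      map_add' := fun a b => Matrix.add_mulVec a b z
      map_smul' := fun a b => Matrix.smul_mulVec a b z }
  have h2 := (LinearMap.toContinuousLinearMap Lm).hasFDerivAt.comp_hasDerivAt t h1
  rw [Matrix.mulVec_mulVec]
  exact h2

theorem Hf_antitone (n : ℕ) (X : Matrix (Idx n) (Idx n) ℂ) (z : Idx n → ℂ)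
    (hX : ∀ y : Idx n → ℂ, (Complex.I * (star y ⬝ᵥ (Jmat n *ᵥ (X *ᵥ y)))).re ≤ 0) :
    Antitone (fun t : ℝ => Hf n (eS X (t : ℂ) *ᵥ z)) := by
  apply antitone_of_hasDerivAt_nonpos
    (f' := fun t : ℝ => 2 * (Complex.I * (star (eS X (t : ℂ) *ᵥ z) ⬝ᵥ (Jmat n *ᵥ (X *ᵥ (eS X (t : ℂ) *ᵥ z))))).re)
  · intro t
    exact Hf_hasDerivAt n _ _ t (eS_path n X z t)
  · intro t
    have := hX (eS X (t : ℂ) *ᵥ z)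
    simp only [Pi.zero_apply]
    linarith

theorem re_star_form {ι : Type} [Fintype ι] (C : Matrix ι ι ℂ) (hC : Cᵀ = C)
    (h : ∀ v : ι → ℝ, 0 ≤ ((fun i => (v i : ℂ)) ⬝ᵥ (C *ᵥ (fun i => (v i : ℂ)))).re) (y : ι → ℂ) :
    0 ≤ (star y ⬝ᵥ (C *ᵥ y)).re := by
  set a : ι → ℂ := fun i => ((y i).re : ℂ) with ha
  set b : ι → ℂ := fun i => ((y i).im : ℂ) with hb
  have hy : y = a + Complex.I • b := by
    funext i; simp [ha, hb, mul_comm Complex.I, Complex.re_add_im]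
  have hys : star y = a - Complex.I • b := by
    funext i
    simp only [ha, hb, Pi.star_apply, Pi.sub_apply, Pi.smul_apply, smul_eq_mul]
    apply Complex.ext <;> simp
  have hsym : b ⬝ᵥ (C *ᵥ a) = a ⬝ᵥ (C *ᵥ b) := by
    rw [Matrix.dotProduct_mulVec, ← Matrix.mulVec_transpose, hC, dotProduct_comm]
  have : star y ⬝ᵥ (C *ᵥ y) = a ⬝ᵥ (C *ᵥ a) + b ⬝ᵥ (C *ᵥ b) := by
    rw [hys]
    conv_lhs => rw [hy]
    simp only [Matrix.mulVec_add, Matrix.mulVec_smul, sub_dotProduct, dotProduct_add,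
      smul_dotProduct, dotProduct_smul, smul_eq_mul, hsym]
    linear_combination (-(b ⬝ᵥ (C *ᵥ b))) * Complex.I_mul_I
  rw [this, Complex.add_re]
  exact add_nonneg (h fun i => (y i).re) (h fun i => (y i).im)

section sp
variable {n : ℕ} {A S : Matrix (Idx n) (Idx n) ℂ}

theorem JS_eq (hS : S = -(A * Jmat n)) : Jmat n * S = - (Jmat n * A * Jmat n) := by
  rw [hS]; simp [Matrix.mul_assoc]

theorem JS_symm (hA : Aᵀ = A) (hS : S = -(A * Jmat n)) : (Jmat n * S)ᵀ = Jmat n * S := by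
  rw [JS_eq hS]
  simp [Matrix.transpose_mul, hA, Jmat_transpose, Matrix.mul_assoc]

theorem ST_eq (hA : Aᵀ = A) (hS : S = -(A * Jmat n)) : Sᵀ = Jmat n * A := by
  rw [hS]; simp [Matrix.transpose_mul, hA, Jmat_transpose]

theorem form_pos (hA : Aᵀ = A) (hS : S = -(A * Jmat n)) (hpos : RePosQ n S) (y : Idx n → ℂ) :
    0 ≤ (star y ⬝ᵥ ((Jmat n * S) *ᵥ y)).re := by
  apply re_star_form _ (JS_symm hA hS)
  intro v
  have := hpos v
  rw [sigmaC, Matrix.mulVec_mulVec] at this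
  exact this

theorem A_pos (hA : Aᵀ = A) (hS : S = -(A * Jmat n)) (hpos : RePosQ n S) (y : Idx n → ℂ) :
    0 ≤ (star y ⬝ᵥ (A *ᵥ y)).re := by
  have h := form_pos hA hS hpos (Jmat n *ᵥ y)
  have h1 : star (Jmat n *ᵥ y) ⬝ᵥ ((Jmat n * S) *ᵥ (Jmat n *ᵥ y)) = star y ⬝ᵥ (A *ᵥ y) := by
    rw [← Matrix.conjTranspose_conjTranspose (Jmat n), ← star_dot_mulVec,
      Matrix.conjTranspose_conjTranspose, Jmat_conjTranspose]
    simp only [Matrix.mulVec_mulVec]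
    congr 2
    rw [JS_eq hS]
    have h2 := Jmat_sq n
    calc -Jmat n * (-(Jmat n * A * Jmat n) * Jmat n) = (Jmat n * Jmat n) * A * (Jmat n * Jmat n) := by
          noncomm_ring
      _ = A := by rw [h2]; simp
  rw [h1] at h
  exact h

theorem Aconj_pos (hA : Aᵀ = A) (hS : S = -(A * Jmat n)) (hpos : RePosQ n S) (y : Idx n → ℂ) :
    0 ≤ (star y ⬝ᵥ (Aᴴ *ᵥ y)).re := by
  have h := A_pos hA hS hpos y
  rw [star_dot_mulVec, Matrix.conjTranspose_conjTranspose]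
  have : star (A *ᵥ y) ⬝ᵥ y = star (star y ⬝ᵥ (A *ᵥ y)) := by
    rw [← Matrix.star_dotProduct_star]; simp [dotProduct_comm]
  rw [this]; simpa using h

theorem flow_antitone (hA : Aᵀ = A) (hS : S = -(A * Jmat n)) (hpos : RePosQ n S) (z : Idx n → ℂ) :
    Antitone (fun t : ℝ => Hf n (eS S (Complex.I * t) *ᵥ z)) := by
  have h := Hf_antitone n (Complex.I • S) z (by
    intro y
    have := form_pos hA hS hpos y
    rw [Matrix.smul_mulVec, Matrix.mulVec_smul, dotProduct_smul, smul_eq_mul, ← mul_assoc,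
      Complex.I_mul_I, Matrix.mulVec_mulVec]
    simpa using this)
  have e : ∀ t : ℝ, eS (Complex.I • S) (t : ℂ) = eS S (Complex.I * t) := by
    intro t; rw [eS, eS, smul_smul, mul_comm]
  simpa only [e] using h

theorem SH_eq (hA : Aᵀ = A) (hS : S = -(A * Jmat n)) : Jmat n * Sᴴ = - Aᴴ := by
  rw [hS, Matrix.conjTranspose_neg, Matrix.conjTranspose_mul, Jmat_conjTranspose]
  simp only [neg_mul, neg_neg, ← mul_assoc, Jmat_sq]
  simp

theorem flow_adj (hA : Aᵀ = A) (hS : S = -(A * Jmat n)) (hpos : RePosQ n S) (z : Idx n → ℂ)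
    (t : ℝ) (ht : 0 ≤ t) : Hf n z ≤ Hf n ((eS S (-(Complex.I * t)))ᴴ *ᵥ z) := by
  have h := Hf_antitone n (-Complex.I • Sᴴ) z (by
    intro y
    have := Aconj_pos hA hS hpos y
    rw [Matrix.smul_mulVec, Matrix.mulVec_smul, dotProduct_smul, smul_eq_mul, ← mul_assoc,
      Matrix.mulVec_mulVec, SH_eq hA hS]
    simpa [Matrix.neg_mulVec, dotProduct_neg] using this)
  have h2 := h (show -t ≤ 0 by linarith)
  simp only [Complex.ofReal_zero, eS_zero, Matrix.one_mulVec] at h2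
  have e : eS (-Complex.I • Sᴴ) ((-t : ℝ) : ℂ) = (eS S (-(Complex.I * t)))ᴴ := by
    rw [eS, eS, ← Matrix.exp_conjTranspose, smul_smul, Matrix.conjTranspose_smul]
    congr 2
    simp; ring
  rwa [e] at h2

theorem eS_transpose (hA : Aᵀ = A) (hS : S = -(A * Jmat n)) (z : ℂ) :
    (eS S z)ᵀ * Jmat n = Jmat n * eS S (-z) := by
  have hJ2 := Jmat_sq n
  have hinv : (Jmat n)⁻¹ = - Jmat n := Matrix.inv_eq_right_inv (by rw [mul_neg, hJ2, neg_neg])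
  have hu : IsUnit (Jmat n) := by
    rw [Matrix.isUnit_iff_isUnit_det]
    apply Matrix.isUnit_det_of_right_inverse (B := - Jmat n)
    rw [mul_neg, hJ2, neg_neg]
  have h1 : (z • S)ᵀ = Jmat n * ((-z) • S) * (Jmat n)⁻¹ := by
    rw [hinv, Matrix.transpose_smul, ST_eq hA hS]
    conv_rhs => rw [hS]
    have : Jmat n * (-z • -(A * Jmat n)) * -Jmat n = -z • (Jmat n * A * (Jmat n * Jmat n)) := by
      simp [Matrix.mul_assoc]
    rw [this, hJ2]; simp
  rw [eS, ← Matrix.exp_transpose, h1, Matrix.exp_conj _ _ hu, hinv, eS]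
  simp [mul_assoc, hJ2]

end sp
end part2

section part3
section trig
variable {ι : Type} [Fintype ι] [DecidableEq ι]

theorem matCos_eq (S : Matrix ι ι ℂ) (z : ℂ) :
    matCos (z • S) = (2 : ℂ)⁻¹ • (eS S (Complex.I * z) + eS S (-(Complex.I * z))) := by
  simp only [matCos, matExp_eq, eS, smul_smul, neg_smul]

theorem matSin_eq (S : Matrix ι ι ℂ) (z : ℂ) :
    matSin (z • S) = (2 * Complex.I)⁻¹ • (eS S (Complex.I * z) - eS S (-(Complex.I * z))) := by
  simp only [matSin, matExp_eq, eS, smul_smul, neg_smul]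

theorem matCos_mem (S : Matrix ι ι ℂ) (z : ℂ) : matCos (z • S) ∈ Algebra.adjoin ℂ {S} := by
  rw [matCos_eq]
  exact Subalgebra.smul_mem _ (Subalgebra.add_mem _ (eS_mem _ _) (eS_mem _ _)) _

theorem matSin_mem (S : Matrix ι ι ℂ) (z : ℂ) : matSin (z • S) ∈ Algebra.adjoin ℂ {S} := by
  rw [matSin_eq]
  exact Subalgebra.smul_mem _ (Subalgebra.sub_mem _ (eS_mem _ _) (eS_mem _ _)) _

theorem matCos_eig (S : Matrix ι ι ℂ) (z : ℂ) (v : ι → ℂ) (l : ℂ) (h : S *ᵥ v = l • v) :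
    matCos (z • S) *ᵥ v = Complex.cos (z * l) • v := by
  rw [matCos_eq, Matrix.smul_mulVec, Matrix.add_mulVec, eS_eig _ _ _ _ h, eS_eig _ _ _ _ h,
    ← add_smul, smul_smul]
  congr 1
  rw [Complex.cos]
  ring_nf

theorem matSin_eig (S : Matrix ι ι ℂ) (z : ℂ) (v : ι → ℂ) (l : ℂ) (h : S *ᵥ v = l • v) :
    matSin (z • S) *ᵥ v = Complex.sin (z * l) • v := by
  rw [matSin_eq, Matrix.smul_mulVec, Matrix.sub_mulVec, eS_eig _ _ _ _ h, eS_eig _ _ _ _ h,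
    ← sub_smul, smul_smul]
  congr 1
  rw [Complex.sin, mul_inv, Complex.inv_I]
  ring_nf

theorem matCos_det (S : Matrix ι ι ℂ) (z : ℂ) :
    (matCos (z • S)).det = (S.charpoly.roots.map (fun l => Complex.cos (z * l))).prod :=
  det_of_mem_adjoin S _ (matCos_mem S z) _ (fun v l _ h => matCos_eig S z v l h)

theorem adjoin_comm (S X Y : Matrix ι ι ℂ) (hX : X ∈ Algebra.adjoin ℂ {S})
    (hY : Y ∈ Algebra.adjoin ℂ {S}) : X * Y = Y * X := by
  rw [Algebra.adjoin_singleton_eq_range_aeval] at hX hY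
  obtain ⟨p, rfl⟩ := hX
  obtain ⟨q, rfl⟩ := hY
  change Polynomial.aeval S p * Polynomial.aeval S q = Polynomial.aeval S q * Polynomial.aeval S p
  rw [← map_mul, ← map_mul, mul_comm]

theorem inv_mem_adjoin (S X : Matrix ι ι ℂ) (hX : X ∈ Algebra.adjoin ℂ {S}) (hd : X.det ≠ 0) :
    X⁻¹ ∈ Algebra.adjoin ℂ {S} := by
  have hu : IsUnit X.det := isUnit_iff_ne_zero.2 hd
  let f : Algebra.adjoin ℂ {S} →ₗ[ℂ] Algebra.adjoin ℂ {S} := LinearMap.mulLeft ℂ ⟨X, hX⟩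
  have hinj : Function.Injective f := by
    intro a b hab
    have h1 : X * (a : Matrix ι ι ℂ) = X * b := congrArg Subtype.val hab
    have h2 := congrArg (fun M => X⁻¹ * M) h1
    simp only [← mul_assoc, Matrix.nonsing_inv_mul X hu, one_mul] at h2
    exact Subtype.ext h2
  obtain ⟨Y, hY⟩ := (LinearMap.injective_iff_surjective.1 hinj) 1
  have h1 : X * (Y : Matrix ι ι ℂ) = 1 := congrArg Subtype.val hY
  rw [Matrix.inv_eq_right_inv h1]
  exact Y.2

theorem matTan_mem (S : Matrix ι ι ℂ) (z : ℂ) (hd : (matCos (z • S)).det ≠ 0) :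
    matTan (z • S) ∈ Algebra.adjoin ℂ {S} :=
  Subalgebra.mul_mem _ (matSin_mem S z) (inv_mem_adjoin S _ (matCos_mem S z) hd)

theorem inv_eig (X : Matrix ι ι ℂ) (hd : X.det ≠ 0) (v : ι → ℂ) (l : ℂ) (hv : v ≠ 0)
    (h : X *ᵥ v = l • v) : X⁻¹ *ᵥ v = l⁻¹ • v := by
  have hu : IsUnit X.det := isUnit_iff_ne_zero.2 hd
  have h1 := congrArg (fun w => X⁻¹ *ᵥ w) h
  simp only [Matrix.mulVec_mulVec, Matrix.nonsing_inv_mul X hu, Matrix.one_mulVec, Matrix.mulVec_smul] at h1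
  have hl : l ≠ 0 := by
    rintro rfl
    rw [zero_smul] at h1
    exact hv h1
  conv_rhs => rw [h1]
  rw [smul_smul, inv_mul_cancel₀ hl, one_smul]

theorem matTan_eig (S : Matrix ι ι ℂ) (z : ℂ) (hd : (matCos (z • S)).det ≠ 0)
    (v : ι → ℂ) (l : ℂ) (hv : v ≠ 0) (h : S *ᵥ v = l • v) :
    matTan (z • S) *ᵥ v = Complex.tan (z * l) • v := by
  rw [matTan, ← Matrix.mulVec_mulVec, inv_eig _ hd v _ hv (matCos_eig S z v l h),
    Matrix.mulVec_smul, matSin_eig S z v l h, smul_smul, Complex.tan_eq_sin_div_cos, mul_comm,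
    div_eq_mul_inv]

theorem trace_S_tan (S : Matrix ι ι ℂ) (z : ℂ) (hd : (matCos (z • S)).det ≠ 0) :
    (S * matTan (z • S)).trace = (S.charpoly.roots.map (fun l => l * Complex.tan (z * l))).sum := by
  apply trace_of_mem_adjoin S _ (Subalgebra.mul_mem _ (Algebra.self_mem_adjoin_singleton ℂ S) (matTan_mem S z hd))
  intro v l hv h
  rw [← Matrix.mulVec_mulVec, matTan_eig S z hd v l hv h, Matrix.mulVec_smul, h, smul_smul, mul_comm]

theorem eS_mul_neg (S : Matrix ι ι ℂ) (z : ℂ) : eS S z * eS S (-z) = 1 := by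
  have := eS_neg_mul S (-z); rwa [neg_neg] at this

theorem cos_add_sin (S : Matrix ι ι ℂ) (z : ℂ) :
    matCos (z • S) + Complex.I • matSin (z • S) = eS S (Complex.I * z) := by
  rw [matCos_eq, matSin_eq, smul_smul]
  have : Complex.I * (2 * Complex.I)⁻¹ = 2⁻¹ := by
    rw [mul_inv, Complex.inv_I]; linear_combination (-2⁻¹) * Complex.I_mul_I
  rw [this]
  module

theorem cos_sub_sin (S : Matrix ι ι ℂ) (z : ℂ) :
    matCos (z • S) - Complex.I • matSin (z • S) = eS S (-(Complex.I * z)) := by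
  rw [matCos_eq, matSin_eq, smul_smul]
  have : Complex.I * (2 * Complex.I)⁻¹ = 2⁻¹ := by
    rw [mul_inv, Complex.inv_I]; linear_combination (-2⁻¹) * Complex.I_mul_I
  rw [this]
  module

theorem cos_sq_add_sin_sq (S : Matrix ι ι ℂ) (z : ℂ) :
    matCos (z • S) * matCos (z • S) + matSin (z • S) * matSin (z • S) = 1 := by
  have h := eS_mul_neg S (Complex.I * z)
  rw [← cos_add_sin, ← cos_sub_sin] at h
  have hc := adjoin_comm S _ _ (matCos_mem S z) (matSin_mem S z)
  rw [← h]
  simp only [add_mul, mul_sub, smul_mul_assoc, mul_smul_comm, hc]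
  rw [smul_add, smul_smul Complex.I Complex.I, Complex.I_mul_I]
  module

open scoped Matrix.Norms.Operator in
theorem matCos_hasDerivAt (S : Matrix ι ι ℂ) (z : ℂ) :
    HasDerivAt (fun z => matCos (z • S)) (-(S * matSin (z • S))) z := by
  simp only [matCos_eq, matSin_eq]
  have h1 : HasDerivAt (fun z : ℂ => eS S (Complex.I * z)) (Complex.I • (S * eS S (Complex.I * z))) z := by
    have := (eS_hasDerivAt S (Complex.I * z)).scomp z ((hasDerivAt_id z).const_mul Complex.I)
    rw [mul_one] at this
    exact this
  have h2 : HasDerivAt (fun z : ℂ => eS S (-(Complex.I * z))) (-Complex.I • (S * eS S (-(Complex.I * z)))) z := by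
    have := (eS_hasDerivAt S (-(Complex.I * z))).scomp z ((hasDerivAt_id z).const_mul Complex.I).neg
    rw [mul_one] at this
    exact this
  have h3 := (h1.add h2).const_smul (2 : ℂ)⁻¹
  have e : -(S * (2 * Complex.I)⁻¹ • (eS S (Complex.I * z) - eS S (-(Complex.I * z)))) =
    (2:ℂ)⁻¹ • (Complex.I • (S * eS S (Complex.I * z)) + -Complex.I • (S * eS S (-(Complex.I * z)))) := by
    rw [mul_inv, Complex.inv_I, mul_smul_comm, mul_sub]
    module
  rw [e]
  exact h3

open scoped Matrix.Norms.Operator in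
theorem matSin_hasDerivAt (S : Matrix ι ι ℂ) (z : ℂ) :
    HasDerivAt (fun z => matSin (z • S)) (S * matCos (z • S)) z := by
  simp only [matCos_eq, matSin_eq]
  have h1 : HasDerivAt (fun z : ℂ => eS S (Complex.I * z)) (Complex.I • (S * eS S (Complex.I * z))) z := by
    have := (eS_hasDerivAt S (Complex.I * z)).scomp z ((hasDerivAt_id z).const_mul Complex.I)
    rw [mul_one] at this
    exact this
  have h2 : HasDerivAt (fun z : ℂ => eS S (-(Complex.I * z))) (-Complex.I • (S * eS S (-(Complex.I * z)))) z := by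
    have := (eS_hasDerivAt S (-(Complex.I * z))).scomp z ((hasDerivAt_id z).const_mul Complex.I).neg
    rw [mul_one] at this
    exact this
  have h3 := (h1.sub h2).const_smul (2 * Complex.I)⁻¹
  have e : S * (2:ℂ)⁻¹ • (eS S (Complex.I * z) + eS S (-(Complex.I * z))) =
    (2 * Complex.I)⁻¹ • (Complex.I • (S * eS S (Complex.I * z)) - -Complex.I • (S * eS S (-(Complex.I * z)))) := by
    rw [mul_smul_comm, mul_add, neg_smul, sub_neg_eq_add, ← smul_add, smul_smul]
    congr 1
    rw [mul_inv, Complex.inv_I]; linear_combination (2⁻¹) * Complex.I_mul_I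
  rw [e]
  exact h3

open scoped Matrix.Norms.Operator in
theorem matTan_hasDerivAt (S : Matrix ι ι ℂ) (z : ℂ) (hd : (matCos (z • S)).det ≠ 0) :
    HasDerivAt (fun z => matTan (z • S)) (S * (1 + matTan (z • S) * matTan (z • S))) z := by
  have hu : IsUnit (matCos (z • S)).det := isUnit_iff_ne_zero.2 hd
  have hC := matCos_mem S z
  have hSn := matSin_mem S z
  have hI := inv_mem_adjoin S _ hC hd
  have hSm := Algebra.self_mem_adjoin_singleton ℂ S
  have h1 : HasDerivAt (fun z => (matCos (z • S))⁻¹)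
      ((matCos (z • S))⁻¹ * (S * matSin (z • S)) * (matCos (z • S))⁻¹) z := by
    have hh : HasFDerivAt (fun x : Matrix ι ι ℂ => Ring.inverse x) _ _ :=
      hasFDerivAt_ringInverse (𝕜 := ℂ) ((Matrix.isUnit_iff_isUnit_det _).2 hu).unit
    have := hh.comp_hasDerivAt z (matCos_hasDerivAt S z)
    simp only [Function.comp_def, ← Matrix.nonsing_inv_eq_ringInverse] at this
    simp [ContinuousLinearMap.mulLeftRight_apply] at this
    exact this
  have h2 := (matSin_hasDerivAt S z).mul h1
  have e : S * (1 + matTan (z • S) * matTan (z • S)) = S * matCos (z • S) * (matCos (z • S))⁻¹ +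
     matSin (z • S) * ((matCos (z • S))⁻¹ * (S * matSin (z • S)) * (matCos (z • S))⁻¹) := by
    rw [mul_assoc S, Matrix.mul_nonsing_inv _ hu, mul_add]
    congr 1
    unfold matTan
    rw [← mul_assoc, ← mul_assoc, ← mul_assoc, ← mul_assoc, ← mul_assoc]
    rw [← mul_assoc, adjoin_comm S _ _ (Subalgebra.mul_mem _ hSn hI) hSm, ← mul_assoc]
  rw [e]
  exact h2

end trig

section sp
variable {n : ℕ} {A S : Matrix (Idx n) (Idx n) ℂ}

theorem matCos_transpose (hA : Aᵀ = A) (hS : S = -(A * Jmat n)) (z : ℂ) :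
    (matCos (z • S))ᵀ * Jmat n = Jmat n * matCos (z • S) := by
  rw [matCos_eq, Matrix.transpose_smul, Matrix.transpose_add, smul_mul_assoc, add_mul,
    eS_transpose hA hS, eS_transpose hA hS, neg_neg, mul_smul_comm, mul_add, add_comm]

theorem matSin_transpose (hA : Aᵀ = A) (hS : S = -(A * Jmat n)) (z : ℂ) :
    (matSin (z • S))ᵀ * Jmat n = -(Jmat n * matSin (z • S)) := by
  rw [matSin_eq, Matrix.transpose_smul, Matrix.transpose_sub, smul_mul_assoc, sub_mul,
    eS_transpose hA hS, eS_transpose hA hS, neg_neg, mul_smul_comm, mul_sub, ← smul_neg, neg_sub]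

theorem B_symm (hA : Aᵀ = A) (hS : S = -(A * Jmat n)) (z : ℂ) (hd : (matCos (z • S)).det ≠ 0) :
    (Jmat n * matTan (z • S))ᵀ = Jmat n * matTan (z • S) := by
  have hu : IsUnit (matCos (z • S)).det := isUnit_iff_ne_zero.2 hd
  have hut : IsUnit (matCos (z • S))ᵀ.det := by rw [Matrix.det_transpose]; exact hu
  have h1 : ((matCos (z • S))ᵀ)⁻¹ * Jmat n = Jmat n * (matCos (z • S))⁻¹ := by
    have := congrArg (fun M => ((matCos (z • S))ᵀ)⁻¹ * M * (matCos (z • S))⁻¹) (matCos_transpose hA hS z)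
    simp only [← mul_assoc, Matrix.nonsing_inv_mul _ hut, one_mul] at this
    rw [this, mul_assoc _ (matCos (z • S)), Matrix.mul_nonsing_inv _ hu, mul_one]
  rw [Matrix.transpose_mul, Jmat_transpose, matTan, Matrix.transpose_mul, Matrix.transpose_nonsing_inv,
    mul_neg, mul_assoc, matSin_transpose hA hS, mul_neg, neg_neg, ← mul_assoc, h1, mul_assoc,
    adjoin_comm S _ _ (inv_mem_adjoin S _ (matCos_mem S z) hd) (matSin_mem S z)]

end sp

/-! pairing list -/
theorem matCos_det_pair {n : ℕ} {S : Matrix (Idx n) (Idx n) ℂ} {l : List ℂ} (hl : IsPairingList n S l) (t : ℂ) :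
    (matCos ((2 * (Real.pi : ℂ) * t) • S)).det = sqrtDetCos t l ^ 2 := by
  rw [matCos_det, hl.2]
  have : sqrtDetCos t l = ((l : Multiset ℂ).map (fun x => Complex.cos (2 * (Real.pi : ℂ) * t * x))).prod := by
    rw [sqrtDetCos, Multiset.map_coe, Multiset.prod_coe, ← List.prod_ofFn]
    congr 1
    conv_rhs => rw [← List.ofFn_get l, List.map_ofFn]
    rfl
  rw [this, Multiset.map_add, Multiset.map_add, Multiset.prod_add, Multiset.prod_add, sq,
    ← Multiset.map_coe, Multiset.map_map]
  simp

theorem sum_pair {n : ℕ} {S : Matrix (Idx n) (Idx n) ℂ} {l : List ℂ} (hl : IsPairingList n S l) (t : ℂ) :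
    (S.charpoly.roots.map (fun x => x * Complex.tan (t * x))).sum
     = 2 * ((l : Multiset ℂ).map (fun x => x * Complex.tan (t * x))).sum := by
  rw [hl.2, Multiset.map_add, Multiset.map_add, Multiset.sum_add, Multiset.sum_add,
    ← Multiset.map_coe, Multiset.map_map]
  simp [Complex.tan_neg]
  ring
end part3

section part4
section sp
variable {n : ℕ} {A S : Matrix (Idx n) (Idx n) ℂ}

theorem B_pos (hA : Aᵀ = A) (hS : S = -(A * Jmat n)) (hpos : RePosQ n S) (τ : ℝ) (hτ : 0 ≤ τ)
    (hd : (matCos ((τ : ℂ) • S)).det ≠ 0) (w : Idx n → ℂ) :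
    0 ≤ (star w ⬝ᵥ ((Jmat n * matTan ((τ : ℂ) • S)) *ᵥ w)).re := by
  have hu : IsUnit (matCos ((τ : ℂ) • S)).det := isUnit_iff_ne_zero.2 hd
  set z := (matCos ((τ : ℂ) • S))⁻¹ *ᵥ w with hz
  have hw : w = matCos ((τ : ℂ) • S) *ᵥ z := by
    rw [hz, Matrix.mulVec_mulVec, Matrix.mul_nonsing_inv _ hu, Matrix.one_mulVec]
  have hTw : (Jmat n * matTan ((τ : ℂ) • S)) *ᵥ w = Jmat n *ᵥ (matSin ((τ : ℂ) • S) *ᵥ z) := by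
    rw [hz, matTan, Matrix.mulVec_mulVec, Matrix.mulVec_mulVec, mul_assoc]
  rw [hTw]
  set p := eS S (Complex.I * τ) *ᵥ z with hp
  set m := eS S (-(Complex.I * τ)) *ᵥ z with hm
  have h1 : w = (2 : ℂ)⁻¹ • (p + m) := by
    rw [hw, matCos_eq, Matrix.smul_mulVec, Matrix.add_mulVec]
  have h2 : matSin ((τ : ℂ) • S) *ᵥ z = (2 * Complex.I)⁻¹ • (p - m) := by
    rw [matSin_eq, Matrix.smul_mulVec, Matrix.sub_mulVec]
  have h3 : Hf n p ≤ Hf n m := by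
    have := flow_antitone hA hS hpos z (show -τ ≤ τ by linarith)
    simpa using this
  have hcr : star p ⬝ᵥ (Jmat n *ᵥ m) = - star (star m ⬝ᵥ (Jmat n *ᵥ p)) := by
    rw [star_dot_mulVec, Jmat_conjTranspose, ← Matrix.star_dotProduct_star]
    simp [Matrix.neg_mulVec, dotProduct_comm]
  rw [h2, h1]
  have e : star ((2:ℂ)⁻¹ • (p + m)) ⬝ᵥ (Jmat n *ᵥ ((2 * Complex.I)⁻¹ • (p - m))) =
    (1/4 : ℂ) * (-Complex.I) * (star p ⬝ᵥ (Jmat n *ᵥ p) - star m ⬝ᵥ (Jmat n *ᵥ m) +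
      (star m ⬝ᵥ (Jmat n *ᵥ p) + star (star m ⬝ᵥ (Jmat n *ᵥ p)))) := by
    simp only [star_smul, star_add, smul_dotProduct, Matrix.mulVec_smul, dotProduct_smul,
      Matrix.mulVec_sub, dotProduct_sub, add_dotProduct, hcr, smul_eq_mul]
    rw [mul_inv, Complex.inv_I]
    simp
    ring
  rw [e]
  simp only [Hf, Complex.mul_re, Complex.I_re, Complex.I_im] at h3
  simp
  linarith

/-- the projection onto the negative part of the hermitian form -/
def Pm (n : ℕ) : Matrix (Idx n) (Idx n) ℂ := (2 : ℂ)⁻¹ • (1 - Complex.I • Jmat n)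

theorem Pm_sq (n : ℕ) : Pm n * Pm n = Pm n := by
  have h := Jmat_sq n
  simp only [Pm, smul_mul_assoc, mul_smul_comm, sub_mul, mul_sub, one_mul, mul_one, h]
  have hII : Complex.I • Complex.I • (-1 : Matrix (Idx n) (Idx n) ℂ) = 1 := by
    rw [smul_smul, Complex.I_mul_I]; simp
  have e : ∀ X Y : Matrix (Idx n) (Idx n) ℂ, (2:ℂ)⁻¹ • ((2:ℂ)⁻¹ • (1 - Complex.I • Y) - Complex.I • (2:ℂ)⁻¹ • (Y - Complex.I • X))
      = (2:ℂ)⁻¹ • ((2:ℂ)⁻¹ • (1 - Complex.I • Y) - (2:ℂ)⁻¹ • Complex.I • Y + (2:ℂ)⁻¹ • Complex.I • Complex.I • X) := by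
    intro X Y; module
  rw [e, hII]
  module

theorem Pm_herm (n : ℕ) : (Pm n)ᴴ = Pm n := by
  simp [Pm, Matrix.conjTranspose_smul, Matrix.conjTranspose_sub, Jmat_conjTranspose]

theorem nsq_Pm (n : ℕ) (x : Idx n → ℂ) : nsq (Pm n *ᵥ x) = (star x ⬝ᵥ (Pm n *ᵥ x)).re := by
  rw [nsq, star_dot_mulVec, Matrix.mulVec_mulVec, Pm_herm, Pm_sq, star_dot_mulVec, Pm_herm]

theorem Hf_eq (n : ℕ) (x : Idx n → ℂ) : Hf n x = nsq x - 2 * nsq (Pm n *ᵥ x) := by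
  rw [nsq_Pm, Hf, nsq, Pm, Matrix.smul_mulVec, dotProduct_smul, Matrix.sub_mulVec, dotProduct_sub,
    Matrix.smul_mulVec, dotProduct_smul, Matrix.one_mulVec]
  simp

theorem nsq_split (n : ℕ) (x : Idx n → ℂ) : nsq x = nsq (Pm n *ᵥ x) + nsq ((1 - Pm n) *ᵥ x) := by
  have h : nsq ((1 - Pm n) *ᵥ x) = (star x ⬝ᵥ ((1 - Pm n) *ᵥ x)).re := by
    have hh : (1 - Pm n)ᴴ = 1 - Pm n := by simp [Pm_herm]
    rw [nsq, star_dot_mulVec, Matrix.mulVec_mulVec, hh, star_dot_mulVec, hh]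
    congr 4
    rw [mul_sub, sub_mul, sub_mul, Pm_sq]; simp
  rw [h, nsq_Pm, ← Complex.add_re, ← dotProduct_add, ← Matrix.add_mulVec]
  simp [nsq]

theorem PQ (n : ℕ) : Pm n * (1 - Pm n) = 0 := by rw [mul_sub, Pm_sq]; simp
theorem QP (n : ℕ) : (1 - Pm n) * Pm n = 0 := by rw [sub_mul, Pm_sq]; simp
theorem QQ (n : ℕ) : (1 - Pm n) * (1 - Pm n) = 1 - Pm n := by rw [mul_sub, QP]; simp

theorem det_PTQ (T : Matrix (Idx n) (Idx n) ℂ) :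
    (Pm n * T + (1 - Pm n)).det = (Pm n * T * Pm n + (1 - Pm n)).det := by
  have e : Pm n * T + (1 - Pm n) = (1 + (Pm n * T) * (1 - Pm n)) * (Pm n * T * Pm n + (1 - Pm n)) := by
    have h1 := QP n
    have h2 := QQ n
    rw [add_mul, one_mul, mul_add, mul_assoc (Pm n * T) (1 - Pm n) (1 - Pm n), h2,
      mul_assoc (Pm n * T) (1 - Pm n), mul_assoc (Pm n) T (Pm n), ← mul_assoc (1 - Pm n) (Pm n), h1]
    simp only [zero_mul, mul_zero, zero_add, mul_sub, mul_one, mul_assoc]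
    abel
  rw [e, Matrix.det_mul, Matrix.det_one_add_mul_comm, ← mul_assoc, QP]
  simp

theorem cosJsin_mul (z : ℂ) :
    (matCos (z • S) + Jmat n * matSin (z • S)) * eS S (Complex.I * z) =
      Pm n * eS S (Complex.I * (2 * z)) + (1 - Pm n) := by
  have h2 : eS S (Complex.I * (2 * z)) = eS S (Complex.I * z) * eS S (Complex.I * z) := by
    rw [← eS_add]; ring_nf
  rw [h2, matCos_eq, matSin_eq, Pm]
  have h1 := eS_neg_mul S (Complex.I * z)
  set E := eS S (Complex.I * z)
  set E' := eS S (-(Complex.I * z))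
  have hI : (2 * Complex.I)⁻¹ = -(2⁻¹ * Complex.I) := by rw [mul_inv, Complex.inv_I]; ring
  rw [hI]
  simp only [add_mul, smul_mul_assoc, mul_smul_comm, mul_assoc, sub_mul, mul_sub, h1, one_mul, mul_one]
  module

theorem Mprime_bounds {T : Matrix (Idx n) (Idx n) ℂ} (hT : ∀ x, Hf n (T *ᵥ x) ≤ Hf n x) (x : Idx n → ℂ) :
    nsq x + nsq (((1 - Pm n) * T * Pm n) *ᵥ x) ≤ nsq ((Pm n * T * Pm n + (1 - Pm n)) *ᵥ x) := by
  have h := hT (Pm n *ᵥ x)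
  rw [Hf_eq, Hf_eq, nsq_split n (T *ᵥ (Pm n *ᵥ x))] at h
  simp only [Matrix.mulVec_mulVec, Pm_sq] at h
  rw [nsq_split n ((Pm n * T * Pm n + (1 - Pm n)) *ᵥ x), nsq_split n x]
  simp only [Matrix.mulVec_mulVec]
  have e1 : Pm n * (Pm n * T * Pm n + (1 - Pm n)) = Pm n * (T * Pm n) := by
    rw [mul_add, PQ, add_zero, ← mul_assoc, ← mul_assoc, Pm_sq, mul_assoc]
  have e2 : (1 - Pm n) * (Pm n * T * Pm n + (1 - Pm n)) = 1 - Pm n := by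
    rw [mul_add, QQ, ← mul_assoc, ← mul_assoc, QP]; simp
  rw [e1, e2]
  rw [mul_assoc]
  linarith

end sp

open scoped Matrix.Norms.Operator in
theorem pow_tendsto_zero {ι : Type} [Fintype ι] [DecidableEq ι] [Nonempty ι] (M : Matrix ι ι ℂ)
    (h : ∀ z ∈ M.charpoly.roots, ‖z‖ < 1) : Filter.Tendsto (fun k : ℕ => M ^ k) Filter.atTop (nhds 0) := by
  have hr : spectralRadius ℂ M < ((1 : NNReal) : ENNReal) := by
    apply spectrum.spectralRadius_lt_of_forall_lt
    intro z hz
    rw [Matrix.mem_spectrum_iff_isRoot_charpoly] at hz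
    have := h z (Polynomial.mem_roots'.2 ⟨M.charpoly_monic.ne_zero, hz⟩)
    exact_mod_cast this
  obtain ⟨r, hr1, hr2⟩ := ENNReal.lt_iff_exists_nnreal_btwn.1 hr
  have h1 := (spectrum.pow_nnnorm_pow_one_div_tendsto_nhds_spectralRadius M).eventually_lt_const hr1
  have hr3 : r < 1 := by exact_mod_cast hr2
  have h2 : ∀ᶠ k : ℕ in Filter.atTop, ‖M ^ k‖ ≤ (r : ℝ) ^ k := by
    filter_upwards [h1, Filter.eventually_gt_atTop 0] with k hk hk0
    have hk' : ((‖M ^ k‖₊ : ENNReal) ^ (1 / k : ℝ)) ^ (k : ℝ) ≤ (r : ENNReal) ^ (k : ℝ) :=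
      ENNReal.rpow_le_rpow hk.le (by positivity)
    rw [← ENNReal.rpow_mul, one_div, inv_mul_cancel₀ (by positivity), ENNReal.rpow_one,
      ENNReal.rpow_natCast] at hk'
    have : ‖M ^ k‖₊ ≤ r ^ k := by exact_mod_cast hk'
    exact_mod_cast this
  apply squeeze_zero_norm' h2
  exact tendsto_pow_atTop_nhds_zero_of_lt_one r.2 (by exact_mod_cast hr3)

theorem exists_proj {ι : Type} [Fintype ι] [DecidableEq ι] (S : Matrix ι ι ℂ) (p : ℂ → Prop) [DecidablePred p] :
    ∃ Q ∈ Algebra.adjoin ℂ {S}, Q * Q = Q ∧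
      ∀ v z, v ≠ 0 → S *ᵥ v = z • v → Q *ᵥ v = (if p z then (1 : ℂ) else 0) • v := by
  classical
  set qu := ((S.charpoly.roots.filter p).map (fun a => Polynomial.X - Polynomial.C a)).prod with hqu
  set qs := ((S.charpoly.roots.filter (fun z => ¬ p z)).map (fun a => Polynomial.X - Polynomial.C a)).prod with hqs
  have hprod : qu * qs = S.charpoly := by
    rw [hqu, hqs, ← Multiset.prod_add, ← Multiset.map_add, Multiset.filter_add_not]
    exact ((IsAlgClosed.splits S.charpoly).eq_prod_roots_of_monic S.charpoly_monic).symm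
  have hcop : IsCoprime qu qs := by
    rw [hqu, hqs]
    apply Multiset.prod_induction (p := fun q => IsCoprime q _)
    · intro a b ha hb; exact ha.mul_left hb
    · exact isCoprime_one_left
    · intro a ha
      apply Multiset.prod_induction (p := fun q => IsCoprime a q)
      · intro b c hb hc; exact hb.mul_right hc
      · exact isCoprime_one_right
      · intro b hb
        obtain ⟨x, hx, rfl⟩ := Multiset.mem_map.1 ha
        obtain ⟨y, hy, rfl⟩ := Multiset.mem_map.1 hb
        apply Polynomial.isCoprime_X_sub_C_of_isUnit_sub
        rw [isUnit_iff_ne_zero, sub_ne_zero]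
        rintro rfl
        exact (Multiset.mem_filter.1 hy).2 (Multiset.mem_filter.1 hx).2
  obtain ⟨a, b, hab⟩ := hcop
  have hCH : Polynomial.aeval S (qu * qs) = 0 := by
    rw [hprod]; exact Matrix.aeval_self_charpoly S
  refine ⟨Polynomial.aeval S (b * qs), ?_, ?_, ?_⟩
  · rw [Algebra.adjoin_singleton_eq_range_aeval]; exact ⟨_, rfl⟩
  · rw [← map_mul]
    have : b * qs * (b * qs) = b * qs - (a * b) * (qu * qs) := by
      linear_combination (b * qs) * hab
    rw [this, map_sub, map_mul _ (a * b), hCH, mul_zero, sub_zero]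
  · intro v z hv h
    rw [aeval_mulVec_eig S _ v z h]
    congr 1
    have hroot : S.charpoly.eval z = 0 := by
      have h0 := aeval_mulVec_eig S S.charpoly v z h
      rw [Matrix.aeval_self_charpoly, Matrix.zero_mulVec] at h0
      exact (smul_eq_zero.1 h0.symm).resolve_right hv
    have hmem : z ∈ S.charpoly.roots := Polynomial.mem_roots'.2 ⟨S.charpoly_monic.ne_zero, hroot⟩
    have hz := congrArg (Polynomial.eval z) hab
    simp only [Polynomial.eval_add, Polynomial.eval_mul, Polynomial.eval_one] at hz
    rw [Polynomial.eval_mul]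
    split_ifs with hp
    · have : qu.eval z = 0 := by
        rw [hqu, Polynomial.eval_multiset_prod, Multiset.prod_eq_zero]
        rw [Multiset.map_map, Multiset.mem_map]
        exact ⟨z, Multiset.mem_filter.2 ⟨hmem, hp⟩, by simp⟩
      rw [this] at hz
      simpa using hz
    · have : qs.eval z = 0 := by
        rw [hqs, Polynomial.eval_multiset_prod, Multiset.prod_eq_zero]
        rw [Multiset.map_map, Multiset.mem_map]
        exact ⟨z, Multiset.mem_filter.2 ⟨hmem, hp⟩, by simp⟩
      rw [this, mul_zero]
end part4

section part5
theorem roots_neg {n : ℕ} {S : Matrix (Idx n) (Idx n) ℂ} {l : List ℂ} (hl : IsPairingList n S l) :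
    S.charpoly.roots.map (fun z => -z) = S.charpoly.roots := by
  rw [hl.2, Multiset.map_add, Multiset.map_add, ← Multiset.map_coe, Multiset.map_map]
  simp only [Function.comp_def, neg_neg, Multiset.map_id', Multiset.map_replicate, neg_zero]
  rw [add_comm (Multiset.map Neg.neg (l : Multiset ℂ))]

theorem trace_zero {n : ℕ} {S : Matrix (Idx n) (Idx n) ℂ} {l : List ℂ} (hl : IsPairingList n S l) :
    S.trace = 0 := by
  have h : S.trace = - S.trace := by
    conv_lhs => rw [Matrix.trace_eq_sum_roots_charpoly, ← roots_neg hl]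
    rw [Multiset.sum_map_neg', Matrix.trace_eq_sum_roots_charpoly]
  exact self_eq_neg.1 h

theorem nsq_single {ι : Type} [Fintype ι] [DecidableEq ι] (j : ι) : nsq (Pi.single j (1:ℂ)) = 1 := by
  rw [nsq_eq, Finset.sum_eq_single j]
  · simp
  · intro b _ hb; simp [Pi.single_eq_of_ne hb]
  · simp

theorem entry_le {ι : Type} [Fintype ι] [DecidableEq ι] (K : Matrix ι ι ℂ) (h : ∀ x, nsq (K *ᵥ x) ≤ nsq x) (i j : ι) :
    ‖K i j‖ ≤ 1 := by
  have h1 := h (Pi.single j 1)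
  rw [nsq_single, nsq_eq] at h1
  have h2 : ‖(K *ᵥ Pi.single j 1) i‖ ^ 2 ≤ ∑ i, ‖(K *ᵥ Pi.single j 1) i‖ ^ 2 :=
    Finset.single_le_sum (f := fun i => ‖(K *ᵥ Pi.single j 1) i‖ ^ 2) (fun _ _ => by positivity) (Finset.mem_univ i)
  have h3 : (K *ᵥ Pi.single j 1) i = K i j := by simp
  rw [h3] at h2
  have : ‖K i j‖ ^ 2 ≤ 1 := h2.trans h1
  nlinarith [norm_nonneg (K i j)]

open scoped ComplexOrder in
theorem exists_compl {ι : Type} [Fintype ι] [DecidableEq ι] (Q P : Matrix ι ι ℂ) (hQ : Q * Q = Q)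
    (hP : Pᴴ = P) (h : ∀ x, Qᴴ *ᵥ x = x → P *ᵥ x = 0 → x = 0) :
    ∃ X', (Q * P + (1 - Q) * X').det ≠ 0 := by
  have hQH : Qᴴ * Qᴴ = Qᴴ := by rw [← Matrix.conjTranspose_mul, hQ]
  have hrank : (Q * P).rank = Q.rank := by
    rw [← Matrix.rank_conjTranspose (Q * P), ← Matrix.rank_conjTranspose Q, Matrix.conjTranspose_mul, hP]
    have hker : LinearMap.ker (P * Qᴴ).mulVecLin = LinearMap.ker (Qᴴ).mulVecLin := by
      ext x
      simp only [LinearMap.mem_ker, Matrix.mulVecLin_apply]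
      constructor
      · intro hx
        apply h
        · rw [Matrix.mulVec_mulVec, hQH]
        · rw [Matrix.mulVec_mulVec, hx]
      · intro hx
        rw [← Matrix.mulVec_mulVec, hx, Matrix.mulVec_zero]
    have h1 := LinearMap.finrank_range_add_finrank_ker (P * Qᴴ).mulVecLin
    have h2 := LinearMap.finrank_range_add_finrank_ker (Qᴴ).mulVecLin
    rw [hker] at h1
    rw [Matrix.rank, Matrix.rank]
    omega
  have hk : Module.finrank ℂ (LinearMap.ker (Q * P).mulVecLin) = Module.finrank ℂ (LinearMap.ker Q.mulVecLin) := by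
    have h1 := LinearMap.finrank_range_add_finrank_ker (Q * P).mulVecLin
    have h2 := LinearMap.finrank_range_add_finrank_ker Q.mulVecLin
    rw [Matrix.rank, Matrix.rank] at hrank
    omega
  let e := LinearEquiv.ofFinrankEq _ _ hk
  obtain ⟨f, hf⟩ := LinearMap.exists_extend ((LinearMap.ker Q.mulVecLin).subtype ∘ₗ e.toLinearMap)
  refine ⟨LinearMap.toMatrix' f, ?_⟩
  intro h0
  obtain ⟨v, hv, hv0⟩ := Matrix.exists_mulVec_eq_zero_iff.2 h0
  apply hv
  rw [Matrix.add_mulVec] at hv0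
  have ha : (Q * P) *ᵥ v = 0 := by
    have := congrArg (fun w => Q *ᵥ w) hv0
    simp only [Matrix.mulVec_add, Matrix.mulVec_mulVec, Matrix.mulVec_zero] at this
    rw [← mul_assoc, ← mul_assoc, hQ, mul_sub, hQ, mul_one, sub_self, zero_mul, Matrix.zero_mulVec, add_zero] at this
    exact this
  rw [ha, zero_add] at hv0
  have hmem : v ∈ LinearMap.ker (Q * P).mulVecLin := by simpa using ha
  have hfv : f v = e ⟨v, hmem⟩ := by
    have := congrArg (fun g => g ⟨v, hmem⟩) hf
    simpa using this
  have hQf : Q *ᵥ (f v) = 0 := by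
    rw [hfv]
    have := (e ⟨v, hmem⟩).2
    rwa [LinearMap.mem_ker, Matrix.mulVecLin_apply] at this
  rw [← Matrix.mulVec_mulVec, Matrix.sub_mulVec, Matrix.one_mulVec, ← Matrix.toLin'_apply, Matrix.toLin'_toMatrix',
    hQf, sub_zero, hfv] at hv0
  have h1 : e ⟨v, hmem⟩ = 0 := Subtype.ext hv0
  have h2 := e.map_eq_zero_iff.1 h1
  exact congrArg Subtype.val h2

theorem det_bound {ι : Type} [Fintype ι] [DecidableEq ι] (Q P X' : Matrix ι ι ℂ) :
    ∃ C > 0, ∀ K N : Matrix ι ι ℂ, (∀ i j, ‖K i j‖ ≤ 1) → (∀ i j, ‖N i j‖ ≤ 1) →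
      ‖(Q * (P + K) + (1 - Q) * X' * N).det‖ ≤ C := by
  let s : Set (Matrix ι ι ℂ) := Set.univ.pi fun _ => Set.univ.pi fun _ => Metric.closedBall 0 1
  have hs : IsCompact s := isCompact_univ_pi fun _ => isCompact_univ_pi fun _ => isCompact_closedBall 0 1
  have hc : Continuous (fun p : Matrix ι ι ℂ × Matrix ι ι ℂ => (Q * (P + p.1) + (1 - Q) * X' * p.2).det) := by
    apply Continuous.matrix_det
    fun_prop
  obtain ⟨C, hC⟩ := (hs.prod hs).exists_bound_of_continuousOn hc.continuousOn
  refine ⟨max C 1, by positivity, fun K N hK hN => (hC (K, N) ⟨?_, ?_⟩).trans (le_max_left _ _)⟩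
  · intro i _ j _; simpa using hK i j
  · intro i _ j _; simpa using hN i j

theorem det_growth {n : ℕ} {A S : Matrix (Idx n) (Idx n) ℂ} (hA : Aᵀ = A) (hS : S = -(A * Jmat n))
    (hpos : RePosQ n S) (hnr : HasNonrealEig n S) {l : List ℂ} (hl : IsPairingList n S l) :
    ∃ c > 0, ∀ τ : ℝ, 0 ≤ τ → c * Real.exp (2 * τ * nuTotal n S) ≤
      ‖(matCos ((τ : ℂ) • S) + Jmat n * matSin ((τ : ℂ) • S)).det‖ := by
  classical
  have hne : Nonempty (Idx n) := by
    obtain ⟨z, hz, -⟩ := hnr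
    obtain ⟨v, hv, -⟩ := exists_eigvec S z hz
    obtain ⟨i, -⟩ := Function.ne_iff.1 hv
    exact ⟨i⟩
  obtain ⟨Q, hQm, hQQ, hQe⟩ := exists_proj S (fun z => z.im < 0)
  -- injectivity of P on range of Qᴴ
  have hinj : ∀ x, Qᴴ *ᵥ x = x → Pm n *ᵥ x = 0 → x = 0 := by
    intro x hx hPx
    apply nsq_eq_zero
    have hH : Hf n x = nsq x := by rw [Hf_eq, hPx]; simp [nsq]
    set G := eS S (-Complex.I) * Q with hG
    have hGm : G ∈ Algebra.adjoin ℂ {S} := Subalgebra.mul_mem _ (eS_mem _ _) hQm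
    have hlim : Filter.Tendsto (fun k : ℕ => G ^ k) Filter.atTop (nhds 0) := by
      apply pow_tendsto_zero
      intro z hz
      rw [roots_of_mem_adjoin S G hGm (fun z => Complex.exp (-Complex.I * z) * (if z.im < 0 then 1 else 0))] at hz
      · obtain ⟨y, hy, rfl⟩ := Multiset.mem_map.1 hz
        split_ifs with hy0
        · rw [mul_one, Complex.norm_exp]
          simpa using hy0
        · simp
      · intro v z hv h
        rw [hG, ← Matrix.mulVec_mulVec, hQe v z hv h, Matrix.mulVec_smul, eS_eig _ _ _ _ h, smul_smul, mul_comm]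
    have hpow : ∀ k : ℕ, G ^ k * Q = eS S (-(Complex.I * (k : ℝ))) * Q := by
      intro k
      induction k with
      | zero => simp [eS_zero]
      | succ k ih =>
        have h1 : G * Q = Q * eS S (-Complex.I) := by
          rw [hG, mul_assoc, hQQ, adjoin_comm S _ _ (eS_mem _ _) hQm]
        rw [pow_succ, mul_assoc, h1, ← mul_assoc, ih, mul_assoc, adjoin_comm S _ _ hQm (eS_mem _ _),
          ← mul_assoc, ← eS_add]
        congr 2
        push_cast; ring
    have hk : ∀ k : ℕ, nsq x ≤ Hf n ((G ^ k * Q)ᴴ *ᵥ x) := by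
      intro k
      rw [hpow, Matrix.conjTranspose_mul]
      have h2 : Qᴴ * (eS S (-(Complex.I * (k : ℝ))))ᴴ = (eS S (-(Complex.I * (k : ℝ))))ᴴ * Qᴴ := by
        rw [← Matrix.conjTranspose_mul, ← Matrix.conjTranspose_mul, adjoin_comm S _ _ (eS_mem _ _) hQm]
      rw [h2, ← Matrix.mulVec_mulVec, hx, ← hH]
      exact flow_adj hA hS hpos x k (by positivity)
    have hHc : Continuous (fun M : Matrix (Idx n) (Idx n) ℂ => Hf n ((M * Q)ᴴ *ᵥ x)) := by
      unfold Hf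
      fun_prop
    have hl2 := (hHc.tendsto 0).comp hlim
    have h0 : Hf n ((0 * Q)ᴴ *ᵥ x) = 0 := by simp [Hf]
    rw [h0] at hl2
    exact ge_of_tendsto' hl2 hk
  obtain ⟨X', hX'⟩ := exists_compl Q (Pm n) hQQ (Pm_herm n) hinj
  obtain ⟨C, hC0, hC⟩ := det_bound Q (Pm n) X'
  refine ⟨‖(Q * Pm n + (1 - Q) * X').det‖ / C, div_pos (norm_pos_iff.2 hX') hC0, ?_⟩
  intro τ hτ
  set T := eS S (Complex.I * (2 * τ)) with hTdef
  have hT : ∀ x, Hf n (T *ᵥ x) ≤ Hf n x := by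
    intro x
    have := flow_antitone hA hS hpos x (show (0:ℝ) ≤ 2 * τ by linarith)
    simp only [Complex.ofReal_zero, mul_zero, eS_zero, Matrix.one_mulVec] at this
    simpa using this
  have hdet1 : ‖(matCos ((τ : ℂ) • S) + Jmat n * matSin ((τ : ℂ) • S)).det‖ =
      ‖(Pm n * T * Pm n + (1 - Pm n)).det‖ := by
    rw [← det_PTQ, hTdef, ← cosJsin_mul, Matrix.det_mul, eS_det, trace_zero hl]
    simp
  rw [hdet1]
  have hMb := Mprime_bounds hT
  set M := Pm n * T * Pm n + (1 - Pm n) with hM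
  have hMdet : M.det ≠ 0 := by
    intro h0
    obtain ⟨v, hv, hv0⟩ := Matrix.exists_mulVec_eq_zero_iff.2 h0
    have := hMb v
    rw [hv0] at this
    have h1 : nsq (0 : Idx n → ℂ) = 0 := by simp [nsq]
    rw [h1] at this
    exact hv (nsq_eq_zero v (by linarith [nsq_nonneg (((1 - Pm n) * T * Pm n) *ᵥ v)]))
  have hMu : IsUnit M.det := isUnit_iff_ne_zero.2 hMdet
  set K := (1 - Pm n) * T * Pm n * M⁻¹ with hK
  have hMi : ∀ x, nsq (M⁻¹ *ᵥ x) + nsq (K *ᵥ x) ≤ nsq x := by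
    intro x
    have := hMb (M⁻¹ *ᵥ x)
    rw [Matrix.mulVec_mulVec, Matrix.mulVec_mulVec, Matrix.mul_nonsing_inv _ hMu, Matrix.one_mulVec] at this
    exact this
  have hKe := entry_le K (fun x => by linarith [hMi x, nsq_nonneg (M⁻¹ *ᵥ x)])
  have hNe := entry_le M⁻¹ (fun x => by linarith [hMi x, nsq_nonneg (K *ᵥ x)])
  have hRb := hC K M⁻¹ hKe hNe
  set Tu := T * Q + (1 - Q) with hTu
  have hTm : T ∈ Algebra.adjoin ℂ {S} := eS_mem _ _
  have hTum : Tu ∈ Algebra.adjoin ℂ {S} :=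
    Subalgebra.add_mem _ (Subalgebra.mul_mem _ hTm hQm) (Subalgebra.sub_mem _ (Subalgebra.one_mem _) hQm)
  have hTP : (Pm n + K) * M = T * Pm n := by
    rw [add_mul, hK, mul_assoc _ M⁻¹, Matrix.nonsing_inv_mul _ hMu, mul_one, hM, mul_add, PQ, add_zero,
      ← mul_assoc, ← mul_assoc, Pm_sq, ← add_mul, ← add_mul]
    simp
  have hfac : (Q * (Pm n + K) + (1 - Q) * X' * M⁻¹) * M = Tu * (Q * Pm n + (1 - Q) * X') := by
    rw [add_mul, mul_assoc, hTP, mul_assoc _ M⁻¹, Matrix.nonsing_inv_mul _ hMu, mul_one, hTu]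
    have h1 : Q * (1 - Q) = 0 := by rw [mul_sub, hQQ]; simp
    have h2 : (1 - Q) * Q = 0 := by rw [sub_mul, hQQ]; simp
    have h3 : (1 - Q) * (1 - Q) = 1 - Q := by rw [mul_sub, h2]; simp
    rw [add_mul, mul_add, mul_add, ← mul_assoc (1 - Q) Q, h2, ← mul_assoc (1 - Q) (1 - Q), h3, mul_assoc T Q,
      ← mul_assoc Q Q, hQQ, mul_assoc T Q, ← mul_assoc Q (1 - Q), h1, ← mul_assoc, ← mul_assoc,
      adjoin_comm S _ _ hQm hTm]
    simp
  have hTudet : ‖Tu.det‖ = Real.exp (2 * τ * nuTotal n S) := by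
    rw [det_of_mem_adjoin S Tu hTum (fun z => if z.im < 0 then Complex.exp (Complex.I * (2 * τ) * z) else 1)]
    · rw [nuTotal]
      conv_rhs => rw [← roots_neg hl, Multiset.map_map]
      generalize S.charpoly.roots = m
      induction m using Multiset.induction_on with
      | empty => simp
      | cons a s ih =>
        rw [Multiset.map_cons, Multiset.prod_cons, norm_mul, ih, Multiset.map_cons, Multiset.sum_cons, mul_add,
          Real.exp_add]
        congr 1
        split_ifs with ha
        · rw [Complex.norm_exp]
          congr 1
          simp
          rw [max_eq_left (by linarith)]
          ring
        · have : 0 ≤ a.im := not_lt.1 ha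
          simp [this]
    · intro v z hv h
      rw [hTu, Matrix.add_mulVec, ← Matrix.mulVec_mulVec, Matrix.sub_mulVec, hQe v z hv h, Matrix.mulVec_smul,
        hTdef, eS_eig _ _ _ _ h, Matrix.one_mulVec]
      split_ifs <;> simp
  have := congrArg (fun M => ‖M.det‖) hfac
  simp only [Matrix.det_mul, norm_mul, hTudet] at this
  rw [div_mul_eq_mul_div, div_le_iff₀ hC0, mul_comm (‖_‖) (Real.exp _), ← this, mul_comm]
  exact mul_le_mul_of_nonneg_left hRb (norm_nonneg _)
end part5

section part6
theorem tan_lower (x y : ℝ) (hc : Complex.cos (x + y * Complex.I) ≠ 0) :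
    y ^ 2 / (1 + y ^ 2) ≤ ‖Complex.tan (x + y * Complex.I)‖ ^ 2 := by
  have hs : ‖Complex.sin (x + y * Complex.I)‖ ^ 2 = Real.sin x ^ 2 + Real.sinh y ^ 2 := by
    rw [Complex.sin_add_mul_I, ← Complex.normSq_eq_norm_sq, ← Complex.ofReal_sin, ← Complex.ofReal_cos,
      ← Complex.ofReal_sinh, ← Complex.ofReal_cosh, Complex.normSq_apply]
    simp only [Complex.mul_re, Complex.add_re, Complex.sub_re, Complex.mul_im, Complex.add_im, Complex.sub_im,
      Complex.ofReal_re, Complex.ofReal_im, Complex.I_re, Complex.I_im, mul_zero, mul_one, zero_mul, sub_zero, add_zero, zero_add, zero_sub]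
    have h1 := Real.cosh_sq y
    have h2 := Real.sin_sq_add_cos_sq x
    linear_combination (Real.sin x ^ 2) * h1 + (Real.sinh y ^ 2) * h2
  have hcc : ‖Complex.cos (x + y * Complex.I)‖ ^ 2 = Real.cos x ^ 2 + Real.sinh y ^ 2 := by
    rw [Complex.cos_add_mul_I, ← Complex.normSq_eq_norm_sq, ← Complex.ofReal_sin, ← Complex.ofReal_cos,
      ← Complex.ofReal_sinh, ← Complex.ofReal_cosh, Complex.normSq_apply]
    simp only [Complex.mul_re, Complex.add_re, Complex.sub_re, Complex.mul_im, Complex.add_im, Complex.sub_im,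
      Complex.ofReal_re, Complex.ofReal_im, Complex.I_re, Complex.I_im, mul_zero, mul_one, zero_mul, sub_zero, add_zero, zero_add, zero_sub]
    have h1 := Real.cosh_sq y
    have h2 := Real.sin_sq_add_cos_sq x
    linear_combination (Real.cos x ^ 2) * h1 + (Real.sinh y ^ 2) * h2
  have hp : 0 < ‖Complex.cos (x + y * Complex.I)‖ ^ 2 := by positivity
  rw [Complex.tan_eq_sin_div_cos, norm_div, div_pow, div_le_div_iff₀ (by positivity) hp, hs, hcc]
  have hh : y ^ 2 ≤ Real.sinh y ^ 2 := by
    rw [← sq_abs y, ← sq_abs (Real.sinh y), Real.abs_sinh]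
    have h0 := abs_nonneg y
    have := Real.self_le_sinh_iff.2 h0
    gcongr
  have h2 := Real.sin_sq_add_cos_sq x
  have h3 := sq_nonneg (Real.sin x)
  have h4 := sq_nonneg y
  have h5 : Real.cos x ^ 2 = 1 - Real.sin x ^ 2 := by linarith
  rw [h5]
  nlinarith [mul_nonneg h3 h4]

section gen
variable {ι : Type} [Fintype ι] [DecidableEq ι]

theorem root_re_nonneg (B : Matrix ι ι ℂ) (hp : ∀ w, 0 ≤ (star w ⬝ᵥ (B *ᵥ w)).re) (β : ℂ)
    (hβ : β ∈ B.charpoly.roots) : 0 ≤ β.re := by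
  obtain ⟨v, hv, h⟩ := exists_eigvec B β hβ
  have h1 := hp v
  rw [h, dotProduct_smul, smul_eq_mul] at h1
  have h2 : (star v ⬝ᵥ v).im = 0 := by
    simp only [dotProduct, Complex.im_sum]
    apply Finset.sum_eq_zero
    intro i _
    simp; ring
  rw [Complex.mul_re, h2, mul_zero, sub_zero] at h1
  have h3 : 0 < (star v ⬝ᵥ v).re := by
    by_contra hh
    exact hv (nsq_eq_zero v (not_lt.1 hh))
  exact nonneg_of_mul_nonneg_left h1 h3

theorem sum_le_card_mul (m : Multiset ℂ) (f : ℂ → ℝ) (r : ℝ) (h : ∀ z ∈ m, f z ≤ r) :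
    (m.map f).sum ≤ Multiset.card m * r := by
  have := Multiset.sum_le_card_nsmul (m.map f) r (by
    intro x hx; obtain ⟨z, hz, rfl⟩ := Multiset.mem_map.1 hx; exact h z hz)
  simpa using this

theorem re_multiset_sum (m : Multiset ℂ) : m.sum.re = (m.map Complex.re).sum := by
  induction m using Multiset.induction_on with
  | empty => simp
  | cons a s ih => simp [ih]

theorem card_roots (B : Matrix ι ι ℂ) : Multiset.card B.charpoly.roots = Fintype.card ι := by
  rw [← (IsAlgClosed.splits B.charpoly).natDegree_eq_card_roots, Matrix.charpoly_natDegree_eq_dim]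

theorem frob_bound (B : Matrix ι ι ℂ) (hB : Bᵀ = B) (hp : ∀ w, 0 ≤ (star w ⬝ᵥ (B *ᵥ w)).re)
    (ρ : ℝ) (hρ : ∀ β ∈ B.charpoly.roots, ‖β‖ ≤ ρ) :
    ∑ i, ∑ j, ‖B i j‖ ^ 2 ≤ 3 * (Fintype.card ι : ℝ) ^ 4 * ρ ^ 2 := by
  rcases isEmpty_or_nonempty ι with he | hne
  · simp
  set N : ℝ := ((Fintype.card ι : ℕ) : ℝ) with hN
  have hN1 : 1 ≤ N := by
    rw [hN]; exact_mod_cast Fintype.card_pos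
  have hcard := card_roots B
  have htr : B.trace.re ≤ N * ρ := by
    rw [Matrix.trace_eq_sum_roots_charpoly, re_multiset_sum, hN, ← hcard]
    exact sum_le_card_mul _ _ _ (fun z hz => (Complex.re_le_norm z).trans (hρ z hz))
  have htr2 : -(N * ρ ^ 2) ≤ (B * B).trace.re := by
    have hr := roots_charpoly_aeval B (Polynomial.X ^ 2)
    simp only [map_pow, Polynomial.aeval_X, Polynomial.eval_pow, Polynomial.eval_X] at hr
    rw [← sq, Matrix.trace_eq_sum_roots_charpoly, hr, re_multiset_sum, Multiset.map_map]
    have := sum_le_card_mul B.charpoly.roots (fun z => -(z ^ 2).re) (ρ ^ 2) (by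
      intro z hz
      have h1 : -(z ^ 2).re ≤ ‖z ^ 2‖ := (neg_le_abs _).trans (Complex.abs_re_le_norm _)
      rw [norm_pow] at h1
      have h2 := hρ z hz
      have h3 := norm_nonneg z
      nlinarith)
    rw [hcard] at this
    rw [Multiset.sum_map_neg] at this
    have e : (Multiset.map (Complex.re ∘ fun z => z ^ 2) B.charpoly.roots) = Multiset.map (fun z => (z ^ 2).re) B.charpoly.roots := rfl
    rw [e]
    linarith
  have hsym : ∀ i j, B i j = B j i := fun i j => by
    conv_lhs => rw [← hB]
    rfl
  have hdiag : ∀ i, 0 ≤ (B i i).re := by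
    intro i
    have := hp (Pi.single i 1)
    simpa using this
  have hdt : ∀ i, (B i i).re ≤ B.trace.re := by
    intro i
    rw [Matrix.trace, Complex.re_sum]
    exact Finset.single_le_sum (f := fun i => (B i i).re) (fun j _ => hdiag j) (Finset.mem_univ i)
  have hoff : ∀ i j, (B i j).re ^ 2 ≤ (N * ρ) ^ 2 := by
    intro i j
    have h1 := hp (Pi.single i 1 + Pi.single j 1)
    have h2 := hp (Pi.single i 1 - Pi.single j 1)
    simp [Matrix.mulVec_add, Matrix.mulVec_sub, add_dotProduct, sub_dotProduct, hsym j i] at h1 h2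
    have := hdt i
    have := hdt j
    rw [← sq_abs]
    apply pow_le_pow_left₀ (abs_nonneg _)
    rw [abs_le]
    constructor <;> linarith
  have hB1 : ∑ i, ∑ j, (B i j).re ^ 2 ≤ N ^ 2 * (N * ρ) ^ 2 := by
    calc ∑ i, ∑ j, (B i j).re ^ 2 ≤ ∑ i : ι, ∑ j : ι, (N * ρ) ^ 2 :=
          Finset.sum_le_sum fun i _ => Finset.sum_le_sum fun j _ => hoff i j
      _ = N ^ 2 * (N * ρ) ^ 2 := by simp [hN]; ring
  have hB2 : (B * B).trace.re = ∑ i, ∑ j, ((B i j).re ^ 2 - (B i j).im ^ 2) := by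
    simp only [Matrix.trace, Matrix.diag_apply, Matrix.mul_apply, Complex.re_sum]
    refine Finset.sum_congr rfl fun i _ => Finset.sum_congr rfl fun j _ => ?_
    rw [hsym j i, Complex.mul_re]; ring
  have hsum : ∑ i, ∑ j, ‖B i j‖ ^ 2 = 2 * ∑ i, ∑ j, (B i j).re ^ 2 - (B * B).trace.re := by
    rw [hB2, Finset.mul_sum, ← Finset.sum_sub_distrib]
    refine Finset.sum_congr rfl fun i _ => ?_
    rw [Finset.mul_sum, ← Finset.sum_sub_distrib]
    refine Finset.sum_congr rfl fun j _ => ?_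
    rw [← Complex.normSq_eq_norm_sq, Complex.normSq_apply]; ring
  rw [hsum]
  have hNN : N ≤ N ^ 4 := le_self_pow₀ hN1 (by norm_num)
  have : N * ρ ^ 2 ≤ N ^ 4 * ρ ^ 2 := mul_le_mul_of_nonneg_right hNN (sq_nonneg _)
  nlinarith

theorem frob_lower (B : Matrix ι ι ℂ) (v : ι → ℂ) : nsq (B *ᵥ v) ≤ (∑ i, ∑ j, ‖B i j‖ ^ 2) * nsq v := by
  rw [nsq_eq, nsq_eq, Finset.sum_mul]
  refine Finset.sum_le_sum fun i _ => ?_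
  have h1 : ‖(B *ᵥ v) i‖ ≤ ∑ j, ‖B i j‖ * ‖v j‖ := by
    simp only [Matrix.mulVec, dotProduct]
    refine (norm_sum_le _ _).trans (le_of_eq ?_)
    simp
  calc ‖(B *ᵥ v) i‖ ^ 2 ≤ (∑ j, ‖B i j‖ * ‖v j‖) ^ 2 := by gcongr
    _ ≤ _ := Finset.sum_mul_sq_le_sq_mul_sq _ _ _

theorem prod_lower (B : Matrix ι ι ℂ) (hp : ∀ w, 0 ≤ (star w ⬝ᵥ (B *ᵥ w)).re) (β₁ : ℂ)
    (hβ₁ : β₁ ∈ B.charpoly.roots) (b : ℝ) (hb : 0 ≤ b) (hbβ : b ≤ ‖β₁‖) (s κ : ℝ) (hs : 0 < s) (hκ : 0 < κ) :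
    κ * (b / (1 + b)) * (min s κ) ^ (Fintype.card ι - 1) * ‖(1 + B).det‖ ≤ ‖((s : ℂ) • (1 : Matrix ι ι ℂ) + (κ : ℂ) • B).det‖ := by
  have e1 : (1 + B).det = (B.charpoly.roots.map (fun z => 1 + z)).prod := by
    have := det_aeval_eq B (1 + Polynomial.X)
    simpa using this
  have e2 : ((s : ℂ) • (1 : Matrix ι ι ℂ) + (κ : ℂ) • B).det = (B.charpoly.roots.map (fun z => (s : ℂ) + κ * z)).prod := by
    have := det_aeval_eq B (Polynomial.C (s : ℂ) + Polynomial.C (κ : ℂ) * Polynomial.X)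
    simp only [map_add, map_mul, Polynomial.aeval_C, Polynomial.aeval_X, Polynomial.eval_add, Polynomial.eval_mul,
      Polynomial.eval_C, Polynomial.eval_X, Algebra.algebraMap_eq_smul_one, smul_mul_assoc, one_mul] at this
    exact this
  rw [e1, e2]
  have hm : 0 < min s κ := lt_min hs hκ
  have hgen : ∀ z : ℂ, 0 ≤ z.re → min s κ * ‖1 + z‖ ≤ ‖(s : ℂ) + κ * z‖ := by
    intro z hz
    rw [← abs_of_pos hm, ← Real.norm_eq_abs, ← Complex.norm_real, ← norm_mul]
    rw [← sq_le_sq₀ (norm_nonneg _) (norm_nonneg _), ← Complex.normSq_eq_norm_sq, ← Complex.normSq_eq_norm_sq,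
      Complex.normSq_apply, Complex.normSq_apply]
    simp only [Complex.mul_re, Complex.add_re, Complex.one_re, Complex.ofReal_re, Complex.ofReal_im, Complex.mul_im,
      Complex.add_im, Complex.one_im]
    have h1 : min s κ ≤ s := min_le_left _ _
    have h2 : min s κ ≤ κ := min_le_right _ _
    generalize min s κ = m at *
    have h3 : m * (1 + z.re) ≤ s + κ * z.re := by nlinarith
    have h4 : m * (1 + z.re) * (m * (1 + z.re)) ≤ (s + κ * z.re) * (s + κ * z.re) := by
      have : 0 ≤ m * (1 + z.re) := by positivity
      exact mul_self_le_mul_self this h3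
    have h5 : (m * z.im) * (m * z.im) ≤ (κ * z.im) * (κ * z.im) := by
      have : m * m ≤ κ * κ := mul_self_le_mul_self hm.le h2
      nlinarith [mul_self_nonneg z.im]
    nlinarith
  have hsp : ∀ z : ℂ, 0 ≤ z.re → b ≤ ‖z‖ → κ * (b / (1 + b)) * ‖1 + z‖ ≤ ‖(s : ℂ) + κ * z‖ := by
    intro z hz hbz
    have h1 : κ * ‖z‖ ≤ ‖(s : ℂ) + κ * z‖ := by
      have hk : ‖(κ : ℂ) * z‖ = κ * ‖z‖ := by
        rw [norm_mul, Complex.norm_real, Real.norm_eq_abs, abs_of_pos hκ]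
      rw [← hk]
      rw [← sq_le_sq₀ (norm_nonneg _) (norm_nonneg _), ← Complex.normSq_eq_norm_sq, ← Complex.normSq_eq_norm_sq,
        Complex.normSq_apply, Complex.normSq_apply]
      simp
      nlinarith [mul_nonneg hκ.le hz]
    refine le_trans ?_ h1
    rw [mul_assoc]
    apply mul_le_mul_of_nonneg_left _ hκ.le
    have h2 : ‖1 + z‖ ≤ 1 + ‖z‖ := by simpa using norm_add_le 1 z
    rw [div_mul_eq_mul_div, div_le_iff₀ (by positivity)]
    nlinarith
  obtain ⟨rest, hrest⟩ := Multiset.exists_cons_of_mem hβ₁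
  have hre := root_re_nonneg B hp
  have hcard := card_roots B
  rw [hrest] at hre hcard ⊢
  rw [Multiset.card_cons] at hcard
  have hc : Fintype.card ι - 1 = Multiset.card rest := by omega
  rw [hc, Multiset.map_cons, Multiset.map_cons, Multiset.prod_cons, Multiset.prod_cons, norm_mul, norm_mul]
  have hrestb : ∀ m : Multiset ℂ, (∀ z ∈ m, 0 ≤ z.re) →
     (min s κ) ^ (Multiset.card m) * ‖(m.map (fun z => 1 + z)).prod‖ ≤ ‖(m.map (fun z => (s : ℂ) + κ * z)).prod‖ := by
    intro m
    induction m using Multiset.induction_on with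
    | empty => simp
    | cons a t ih =>
      intro h
      have h1 := hgen a (h a (Multiset.mem_cons_self _ _))
      have h2 := ih (fun z hz => h z (Multiset.mem_cons_of_mem hz))
      rw [Multiset.map_cons, Multiset.map_cons, Multiset.prod_cons, Multiset.prod_cons, norm_mul, norm_mul,
        Multiset.card_cons]
      calc _ = (min s κ * ‖1 + a‖) * (min s κ ^ Multiset.card t * ‖(t.map (fun z => 1 + z)).prod‖) := by ring
        _ ≤ _ := mul_le_mul h1 h2 (by positivity) (by positivity)
  have h1 := hsp β₁ (hre β₁ (Multiset.mem_cons_self _ _)) hbβ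
  have h2 := hrestb rest (fun z hz => hre z (Multiset.mem_cons_of_mem hz))
  calc _ = (κ * (b / (1 + b)) * ‖1 + β₁‖) * (min s κ ^ Multiset.card rest * ‖(rest.map (fun z => 1 + z)).prod‖) := by ring
    _ ≤ _ := mul_le_mul h1 h2 (by positivity) (by positivity)

end gen

theorem nsq_J {n : ℕ} (v : Idx n → ℂ) : nsq (Jmat n *ᵥ v) = nsq v := by
  rw [nsq, star_dot_mulVec, Jmat_conjTranspose, Matrix.mulVec_mulVec, neg_mul, Jmat_sq, neg_neg, Matrix.one_mulVec, nsq]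

theorem gain {n : ℕ} {A S : Matrix (Idx n) (Idx n) ℂ} (hA : Aᵀ = A) (hS : S = -(A * Jmat n))
    (hpos : RePosQ n S) (hnr : HasNonrealEig n S) :
    ∃ c > 0, c ≤ 1 ∧ ∀ t : ℝ, 0 ≤ t → (matCos (((2 * Real.pi * t : ℝ) : ℂ) • S)).det ≠ 0 →
      ∃ β ∈ (Jmat n * matTan (((2 * Real.pi * t : ℝ) : ℂ) • S)).charpoly.roots, c * min 1 t ≤ ‖β‖ := by
  obtain ⟨ω, hω, him⟩ := hnr
  obtain ⟨v, hv, hSv⟩ := exists_eigvec S ω hω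
  have hne : Nonempty (Idx n) := by
    obtain ⟨i, -⟩ := Function.ne_iff.1 hv
    exact ⟨i⟩
  set N : ℝ := ((Fintype.card (Idx n) : ℕ) : ℝ) with hN
  have hN1 : 1 ≤ N := by
    rw [hN]; exact_mod_cast Fintype.card_pos
  set q := min 1 (2 * Real.pi * |ω.im|) with hq
  have hq0 : 0 < q := lt_min one_pos (by positivity)
  have hq1 : q ≤ 1 := min_le_left _ _
  refine ⟨q / (4 * N ^ 2), by positivity, ?_, ?_⟩
  · rw [div_le_one (by positivity)]
    nlinarith
  intro t ht hd
  set B := Jmat n * matTan (((2 * Real.pi * t : ℝ) : ℂ) • S) with hB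
  by_contra hcon
  push Not at hcon
  have hBs := B_symm hA hS _ hd
  have hBp := B_pos hA hS hpos (2 * Real.pi * t) (by positivity) hd
  have hF := frob_bound B hBs hBp (q / (4 * N ^ 2) * min 1 t) (fun β hβ => (hcon β hβ).le)
  rw [← hN] at hF
  have hL := frob_lower B v
  have hBv : B *ᵥ v = Complex.tan (((2 * Real.pi * t : ℝ) : ℂ) * ω) • (Jmat n *ᵥ v) := by
    rw [hB, ← Matrix.mulVec_mulVec, matTan_eig S _ hd v ω hv hSv, Matrix.mulVec_smul]
  have hns : nsq (B *ᵥ v) = ‖Complex.tan (((2 * Real.pi * t : ℝ) : ℂ) * ω)‖ ^ 2 * nsq v := by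
    rw [hBv, ← nsq_J v, nsq_eq, nsq_eq, Finset.mul_sum]
    refine Finset.sum_congr rfl fun i _ => ?_
    simp [mul_pow]
  have hvp : 0 < nsq v := by
    by_contra hh
    exact hv (nsq_eq_zero v (not_lt.1 hh))
  rw [hns] at hL
  have hL2 := le_of_mul_le_mul_right hL hvp
  have hdet := hd
  have hcos : Complex.cos (((2 * Real.pi * t : ℝ) : ℂ) * ω) ≠ 0 := by
    rw [matCos_det] at hdet
    intro h0
    apply hdet
    apply Multiset.prod_eq_zero
    rw [Multiset.mem_map]
    exact ⟨ω, hω, h0⟩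
  have hdec : ((2 * Real.pi * t : ℝ) : ℂ) * ω = ((2 * Real.pi * t * ω.re : ℝ) : ℂ) + ((2 * Real.pi * t * ω.im : ℝ) : ℂ) * Complex.I := by
    apply Complex.ext <;> simp
  rw [hdec] at hL2 hcos
  have hT := tan_lower _ _ hcos
  set y := 2 * Real.pi * t * ω.im with hy
  have hm0 : 0 ≤ min 1 t := le_min zero_le_one ht
  have hyq : q * min 1 t ≤ |y| := by
    rw [hy, show 2 * Real.pi * t * ω.im = (2 * Real.pi * ω.im) * t by ring, abs_mul, abs_mul, abs_of_pos Real.two_pi_pos, abs_of_nonneg ht]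
    exact mul_le_mul (min_le_right _ _) (min_le_right _ _) hm0 (by positivity)
  have hqm1 : q * min 1 t ≤ 1 := mul_le_one₀ hq1 hm0 (min_le_left _ _)
  have hqm0 : 0 ≤ q * min 1 t := by positivity
  have hdiv : (q * min 1 t) ^ 2 / 2 ≤ y ^ 2 / (1 + y ^ 2) := by
    rw [div_le_div_iff₀ (by norm_num) (by positivity), ← sq_abs y]
    have : (q * min 1 t) ^ 2 ≤ |y| ^ 2 := by gcongr
    have h1 : (q * min 1 t) ^ 2 ≤ 1 := by nlinarith
    nlinarith [sq_nonneg |y|]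
  have hfin : (q * min 1 t) ^ 2 / 2 ≤ 3 * N ^ 4 * (q / (4 * N ^ 2) * min 1 t) ^ 2 := hdiv.trans (hT.trans (hL2.trans hF))
  have e : 3 * N ^ 4 * (q / (4 * N ^ 2) * min 1 t) ^ 2 = (3 / 16) * (q * min 1 t) ^ 2 := by
    field_simp; ring
  rw [e] at hfin
  have hz : q * min 1 t = 0 := by nlinarith
  have hm : min 1 t = 0 := by
    rcases mul_eq_zero.1 hz with h | h
    · exact absurd h hq0.ne'
    · exact h
  -- any root contradicts
  have hcr := card_roots B
  have : 0 < Multiset.card B.charpoly.roots := by rw [hcr]; exact Fintype.card_pos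
  obtain ⟨β, hβ⟩ := Multiset.card_pos_iff_exists_mem.1 this
  have := hcon β hβ
  rw [hm, mul_zero] at this
  exact absurd (norm_nonneg β) (not_le.2 this)

theorem det_lower {n : ℕ} {A S : Matrix (Idx n) (Idx n) ℂ} (hA : Aᵀ = A) (hS : S = -(A * Jmat n))
    (hpos : RePosQ n S) (hnr : HasNonrealEig n S) {l : List ℂ} (hl : IsPairingList n S l) :
    ∃ c > 0, ∀ t : ℝ, 0 ≤ t → (matCos (((2 * Real.pi * t : ℝ) : ℂ) • S)).det ≠ 0 →
      ∀ s κ : ℝ, 0 < s → 0 < κ →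
      c * Real.exp (4 * Real.pi * t * nuTotal n S) * min 1 t * κ * (min s κ) ^ (2 * n - 1) ≤
      ‖(matCos (((2 * Real.pi * t : ℝ) : ℂ) • S)).det *
        ((s : ℂ) • (1 : Matrix (Idx n) (Idx n) ℂ) + (κ : ℂ) • (Jmat n * matTan (((2 * Real.pi * t : ℝ) : ℂ) • S))).det‖ := by
  obtain ⟨c1, hc1, hc1', hg⟩ := gain hA hS hpos hnr
  obtain ⟨c2, hc2, hdg⟩ := det_growth hA hS hpos hnr hl
  refine ⟨c1 / 2 * c2, by positivity, ?_⟩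
  intro t ht hd s κ hs hκ
  obtain ⟨β, hβ, hβb⟩ := hg t ht hd
  have hBp := B_pos hA hS hpos (2 * Real.pi * t) (by positivity) hd
  have hm0 : 0 ≤ min 1 t := le_min zero_le_one ht
  have hP := prod_lower _ hBp β hβ _ (by positivity) hβb s κ hs hκ
  have hu : IsUnit (matCos (((2 * Real.pi * t : ℝ) : ℂ) • S)).det := isUnit_iff_ne_zero.2 hd
  have hD := hdg (2 * Real.pi * t) (by positivity)
  have e1 : (matCos (((2 * Real.pi * t : ℝ) : ℂ) • S) + Jmat n * matSin (((2 * Real.pi * t : ℝ) : ℂ) • S)).det =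
    (1 + Jmat n * matTan (((2 * Real.pi * t : ℝ) : ℂ) • S)).det * (matCos (((2 * Real.pi * t : ℝ) : ℂ) • S)).det := by
    generalize ((2 * Real.pi * t : ℝ) : ℂ) = z at hu ⊢
    rw [← Matrix.det_mul, add_mul, one_mul, mul_assoc, matTan, mul_assoc, Matrix.nonsing_inv_mul _ hu, mul_one]
  rw [e1, norm_mul] at hD
  have hcard : Fintype.card (Idx n) = 2 * n := by simp [Idx]; ring
  rw [hcard] at hP
  rw [norm_mul]
  have hb : c1 / 2 * min 1 t ≤ c1 * min 1 t / (1 + c1 * min 1 t) := by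
    rw [le_div_iff₀ (by positivity)]
    have : c1 * min 1 t ≤ 1 := mul_le_one₀ hc1' hm0 (min_le_left _ _)
    have h0 : 0 ≤ c1 * min 1 t := by positivity
    nlinarith
  have hmm : 0 < min s κ := lt_min hs hκ
  calc c1 / 2 * c2 * Real.exp (4 * Real.pi * t * nuTotal n S) * min 1 t * κ * (min s κ) ^ (2 * n - 1)
      = κ * (c1 / 2 * min 1 t) * (min s κ) ^ (2 * n - 1) * (c2 * Real.exp (2 * (2 * Real.pi * t) * nuTotal n S)) := by
        rw [show 2 * (2 * Real.pi * t) * nuTotal n S = 4 * Real.pi * t * nuTotal n S by ring]; ring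
    _ ≤ κ * (c1 * min 1 t / (1 + c1 * min 1 t)) * (min s κ) ^ (2 * n - 1) *
         (‖(1 + Jmat n * matTan (((2 * Real.pi * t : ℝ) : ℂ) • S)).det‖ * ‖(matCos (((2 * Real.pi * t : ℝ) : ℂ) • S)).det‖) := by
        gcongr
    _ = (κ * (c1 * min 1 t / (1 + c1 * min 1 t)) * (min s κ) ^ (2 * n - 1) * ‖(1 + Jmat n * matTan (((2 * Real.pi * t : ℝ) : ℂ) • S)).det‖) * ‖(matCos (((2 * Real.pi * t : ℝ) : ℂ) • S)).det‖ := by ring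
    _ ≤ _ := by
        rw [mul_comm (‖(matCos (((2 * Real.pi * t : ℝ) : ℂ) • S)).det‖)]
        exact mul_le_mul_of_nonneg_right hP (norm_nonneg _)
end part6

section part7
theorem spec_real {ι : Type} [Fintype ι] [DecidableEq ι] (D : Matrix ι ι ℝ) (hD : Dᵀ = D) :
    ∃ (W : Matrix ι ι ℝ) (d : ι → ℝ), Wᵀ * W = 1 ∧ Wᵀ * D * W = diagonal d := by
  have hH : D.IsHermitian := by
    rw [Matrix.IsHermitian, Matrix.conjTranspose_eq_transpose_of_trivial, hD]
  have h := hH.spectral_theorem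
  have hu := (Unitary.mem_iff.1 hH.eigenvectorUnitary.2).1
  set W : Matrix ι ι ℝ := (hH.eigenvectorUnitary : Matrix ι ι ℝ) with hW
  have hs : star W = Wᵀ := by
    rw [Matrix.star_eq_conjTranspose, Matrix.conjTranspose_eq_transpose_of_trivial]
  rw [hs] at hu
  refine ⟨W, hH.eigenvalues, hu, ?_⟩
  rw [Unitary.conjStarAlgAut_apply] at h
  have h' : D = W * diagonal hH.eigenvalues * Wᵀ := by
    rw [← hs]; exact h
  calc Wᵀ * D * W = Wᵀ * (W * diagonal hH.eigenvalues * Wᵀ) * W := by rw [← h']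
    _ = (Wᵀ * W) * diagonal hH.eigenvalues * (Wᵀ * W) := by noncomm_ring
    _ = _ := by rw [hu]; simp

theorem simdiag {ι : Type} [Fintype ι] [DecidableEq ι] (C1 C2 : Matrix ι ι ℝ) (h1 : C1ᵀ = C1) (h2 : C2ᵀ = C2)
    (hp : ∀ x : ι → ℝ, x ≠ 0 → 0 < x ⬝ᵥ (C1 *ᵥ x)) :
    ∃ (P : Matrix ι ι ℝ) (d : ι → ℝ), P.det ≠ 0 ∧ Pᵀ * C1 * P = 1 ∧ Pᵀ * C2 * P = diagonal d := by
  obtain ⟨V, e, hV, he⟩ := spec_real C1 h1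
  have hepos : ∀ i, 0 < e i := by
    intro i
    have hvi : V *ᵥ (Pi.single i 1) ≠ 0 := by
      intro h0
      have : (Vᵀ * V) *ᵥ (Pi.single i 1) = (0 : ι → ℝ) := by
        rw [← Matrix.mulVec_mulVec, h0, Matrix.mulVec_zero]
      rw [hV, Matrix.one_mulVec] at this
      have := congrFun this i
      simp at this
    have := hp _ hvi
    have e1 : (V *ᵥ (Pi.single i 1)) ⬝ᵥ (C1 *ᵥ (V *ᵥ (Pi.single i 1))) = e i := by
      have : (V *ᵥ (Pi.single i 1)) ⬝ᵥ (C1 *ᵥ (V *ᵥ (Pi.single i 1))) = (Pi.single i 1) ⬝ᵥ ((Vᵀ * C1 * V) *ᵥ (Pi.single i 1)) := by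
        rw [← Matrix.mulVec_mulVec, ← Matrix.mulVec_mulVec, Matrix.dotProduct_mulVec _ Vᵀ, Matrix.vecMul_transpose]
      rw [this, he]
      simp
    rwa [e1] at this
  set M := V * diagonal (fun i => (Real.sqrt (e i))⁻¹) with hM
  have hM1 : Mᵀ * C1 * M = 1 := by
    rw [hM, Matrix.transpose_mul, Matrix.diagonal_transpose]
    calc _ = diagonal (fun i => (Real.sqrt (e i))⁻¹) * (Vᵀ * C1 * V) * diagonal (fun i => (Real.sqrt (e i))⁻¹) := by
          noncomm_ring
      _ = 1 := by
          rw [he, Matrix.diagonal_mul_diagonal, Matrix.diagonal_mul_diagonal, ← Matrix.diagonal_one]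
          congr 1
          funext i
          have := Real.mul_self_sqrt (hepos i).le
          have h0 : Real.sqrt (e i) ≠ 0 := (Real.sqrt_pos.2 (hepos i)).ne'
          field_simp
          nlinarith
  obtain ⟨W, d, hW, hd⟩ := spec_real (Mᵀ * C2 * M) (by
    clear_value M
    rw [Matrix.transpose_mul, Matrix.transpose_mul, Matrix.transpose_transpose, h2, Matrix.mul_assoc])
  have hP1 : (M * W)ᵀ * C1 * (M * W) = 1 := by
    rw [Matrix.transpose_mul]
    calc _ = Wᵀ * (Mᵀ * C1 * M) * W := by noncomm_ring
      _ = 1 := by rw [hM1, Matrix.mul_one, hW]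
  refine ⟨M * W, d, ?_, hP1, ?_⟩
  · intro h0
    have := congrArg Matrix.det hP1
    rw [Matrix.det_mul, h0, mul_zero, Matrix.det_one] at this
    exact zero_ne_one this
  · rw [Matrix.transpose_mul, ← hd]; noncomm_ring

theorem integral_comp_mat {ι : Type} [Fintype ι] [DecidableEq ι] (P : Matrix ι ι ℝ) (hP : P.det ≠ 0) (f : (ι → ℝ) → ℂ) :
    ∫ x, f x = (|P.det| : ℝ) * ∫ x, f (P *ᵥ x) := by
  have h := Real.map_matrix_volume_pi_eq_smul_volume_pi hP
  have hme : MeasurableEmbedding (toLin' P) := by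
    have hdet : LinearMap.det (toLin' P) ≠ 0 := by rwa [LinearMap.det_toLin']
    exact ((LinearMap.equivOfDetNeZero (toLin' P) hdet).toContinuousLinearEquiv.toHomeomorph).measurableEmbedding
  have h2 := hme.integral_map (μ := volume) f
  rw [h, integral_smul_measure, ENNReal.toReal_ofReal (abs_nonneg _)] at h2
  have h3 : ∫ x, f (P *ᵥ x) = |P.det⁻¹| • ∫ x, f x := by
    rw [h2]; rfl
  rw [h3, abs_inv, Complex.real_smul, Complex.ofReal_inv, mul_inv_cancel_left₀]
  exact Complex.ofReal_ne_zero.2 (abs_ne_zero.2 hP)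

theorem gauss_bound {ι : Type} [Fintype ι] [DecidableEq ι] (C : Matrix ι ι ℂ) (hC : Cᵀ = C)
    (hp : ∀ x : ι → ℝ, x ≠ 0 → 0 < (((fun i => (x i : ℂ))) ⬝ᵥ (C *ᵥ (fun i => (x i : ℂ)))).re) (y : ι → ℝ) :
    ‖∫ x : ι → ℝ, Complex.exp (-((fun i => (x i : ℂ)) ⬝ᵥ (C *ᵥ (fun i => (x i : ℂ)))) + ((x ⬝ᵥ y : ℝ) : ℂ) * Complex.I)‖
      ≤ Real.sqrt Real.pi ^ (Fintype.card ι) * (Real.sqrt ‖C.det‖)⁻¹ := by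
  set C1 : Matrix ι ι ℝ := C.map Complex.re with hC1
  set C2 : Matrix ι ι ℝ := C.map Complex.im with hC2
  have hCd : C = C1.map (Complex.ofReal) + Complex.I • C2.map (Complex.ofReal) := by
    ext i j
    simp [hC1, hC2, mul_comm Complex.I]
  have t1 : C1ᵀ = C1 := by rw [hC1, ← Matrix.transpose_map, hC]
  have t2 : C2ᵀ = C2 := by rw [hC2, ← Matrix.transpose_map, hC]
  have hp1 : ∀ x : ι → ℝ, x ≠ 0 → 0 < x ⬝ᵥ (C1 *ᵥ x) := by
    intro x hx
    have := hp x hx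
    convert this using 1
    simp [dotProduct, Matrix.mulVec, Complex.re_sum, hC1]
  obtain ⟨P, d, hP, hd1, hd2⟩ := simdiag C1 C2 t1 t2 hp1
  set Pc : Matrix ι ι ℂ := P.map Complex.ofReal with hPc
  have hmap : ∀ X Y : Matrix ι ι ℝ, (X * Y).map Complex.ofReal = X.map Complex.ofReal * Y.map Complex.ofReal := fun X Y =>
    Matrix.map_mul (f := Complex.ofRealHom)
  set b : ι → ℂ := fun i => 1 + d i * Complex.I with hb
  have hdiag : Pcᵀ * C * Pc = diagonal b := by
    rw [hCd, mul_add, add_mul, Matrix.mul_smul, Matrix.smul_mul, hPc, ← Matrix.transpose_map, ← hmap, ← hmap, ← hmap, ← hmap, hd1, hd2]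
    ext i j
    by_cases hij : i = j
    · subst hij; simp [hb, mul_comm]
    · simp [hij]
  have hbre : ∀ i, 0 < (b i).re := by intro i; simp [hb]
  rw [integral_comp_mat P hP]
  have hintg : ∀ x : ι → ℝ, Complex.exp (-((fun i => ((P *ᵥ x) i : ℂ)) ⬝ᵥ (C *ᵥ (fun i => ((P *ᵥ x) i : ℂ)))) + (((P *ᵥ x) ⬝ᵥ y : ℝ) : ℂ) * Complex.I)
     = Complex.exp (-∑ i, b i * (x i : ℂ) ^ 2 + ∑ i, (((Pᵀ *ᵥ y) i : ℝ) : ℂ) * Complex.I * x i) := by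
    intro x
    have e1 : (fun i => ((P *ᵥ x) i : ℂ)) = Pc *ᵥ (fun i => (x i : ℂ)) := by
      funext i; simp [Matrix.mulVec, dotProduct, hPc]
    have e2 : (Pc *ᵥ (fun i => (x i : ℂ))) ⬝ᵥ (C *ᵥ (Pc *ᵥ (fun i => (x i : ℂ)))) = ∑ i, b i * (x i : ℂ) ^ 2 := by
      have : (Pc *ᵥ (fun i => (x i : ℂ))) ⬝ᵥ (C *ᵥ (Pc *ᵥ (fun i => (x i : ℂ)))) = (fun i => (x i : ℂ)) ⬝ᵥ ((Pcᵀ * C * Pc) *ᵥ (fun i => (x i : ℂ))) := by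
        rw [← Matrix.mulVec_mulVec, ← Matrix.mulVec_mulVec, Matrix.dotProduct_mulVec _ Pcᵀ, Matrix.vecMul_transpose]
      rw [this, hdiag]
      simp only [dotProduct, Matrix.mulVec_diagonal]
      exact Finset.sum_congr rfl fun i _ => by ring
    have e3 : (P *ᵥ x) ⬝ᵥ y = ∑ i, (Pᵀ *ᵥ y) i * x i := by
      have : (P *ᵥ x) ⬝ᵥ y = x ⬝ᵥ (Pᵀ *ᵥ y) := by
        rw [Matrix.dotProduct_mulVec, Matrix.vecMul_transpose]
      rw [this, dotProduct]
      exact Finset.sum_congr rfl fun i _ => by ring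
    rw [e1, e2, e3]
    congr 2
    push_cast
    rw [Finset.sum_mul]
    exact Finset.sum_congr rfl fun i _ => by ring
  simp_rw [hintg]
  rw [GaussianFourier.integral_cexp_neg_sum_mul_add hbre, norm_mul, norm_prod]
  have hfac : ∀ i, ‖(Real.pi / b i) ^ (1 / 2 : ℂ) * Complex.exp (((((Pᵀ *ᵥ y) i : ℝ) : ℂ) * Complex.I) ^ 2 / (4 * b i))‖
      ≤ Real.sqrt Real.pi * (Real.sqrt ‖b i‖)⁻¹ := by
    intro i
    rw [norm_mul]
    have hb0 : b i ≠ 0 := by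
      intro h0
      have := hbre i
      rw [h0] at this; simp at this
    have h1 : ‖(Real.pi / b i) ^ (1 / 2 : ℂ)‖ = Real.sqrt Real.pi * (Real.sqrt ‖b i‖)⁻¹ := by
      have : (1 / 2 : ℂ) = ((1 / 2 : ℝ) : ℂ) := by push_cast; ring
      rw [this, Complex.norm_cpow_real, norm_div, Complex.norm_real, Real.norm_eq_abs, abs_of_pos Real.pi_pos,
        ← Real.sqrt_eq_rpow, Real.sqrt_div Real.pi_pos.le, div_eq_mul_inv]
    have h2 : ‖Complex.exp (((((Pᵀ *ᵥ y) i : ℝ) : ℂ) * Complex.I) ^ 2 / (4 * b i))‖ ≤ 1 := by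
      rw [Complex.norm_exp, Real.exp_le_one_iff]
      generalize (Pᵀ *ᵥ y) i = q
      have : ((q : ℂ) * Complex.I) ^ 2 / (4 * b i) = ((-(q ^ 2) / 4 : ℝ) : ℂ) * (b i)⁻¹ := by
        rw [mul_pow, Complex.I_sq]; push_cast
        field_simp
      rw [this, Complex.re_ofReal_mul, Complex.inv_re]
      have h3 := hbre i
      have h4 : 0 ≤ (b i).re / Complex.normSq (b i) := div_nonneg h3.le (Complex.normSq_nonneg _)
      nlinarith [sq_nonneg q]
    rw [h1]
    exact mul_le_of_le_one_right (by positivity) h2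
  have hdet : P.det ^ 2 * ‖C.det‖ = ∏ i, ‖b i‖ := by
    have := congrArg (fun X => ‖Matrix.det X‖) hdiag
    simp only [Matrix.det_mul, Matrix.det_transpose, Matrix.det_diagonal, norm_mul, norm_prod] at this
    rw [← this]
    have e : ‖Pc.det‖ = |P.det| := by
      have : Pc.det = ((P.det : ℝ) : ℂ) := by
        rw [hPc]; exact (RingHom.map_det Complex.ofRealHom P).symm
      rw [this, Complex.norm_real, Real.norm_eq_abs]
    rw [e, ← sq_abs]; ring
  have hsq : ∏ i, Real.sqrt ‖b i‖ = |P.det| * Real.sqrt ‖C.det‖ := by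
    rw [← Real.sqrt_prod _ (fun i _ => norm_nonneg _), ← hdet, Real.sqrt_mul (sq_nonneg _), Real.sqrt_sq_eq_abs]
  calc _ ≤ |P.det| * ∏ i : ι, (Real.sqrt Real.pi * (Real.sqrt ‖b i‖)⁻¹) := by
        rw [Complex.norm_real, Real.norm_eq_abs, abs_abs]
        apply mul_le_mul_of_nonneg_left _ (abs_nonneg _)
        exact Finset.prod_le_prod (fun i _ => norm_nonneg _) (fun i _ => hfac i)
    _ = _ := by
        rw [Finset.prod_mul_distrib, Finset.prod_inv_distrib, hsq, Finset.prod_const, Finset.card_univ, mul_inv]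
        have : |P.det| ≠ 0 := abs_ne_zero.2 hP
        field_simp
end part7

section part8
def rho (n : ℕ) (x : Idx n → ℝ) : ℝ := ((1 + x ⬝ᵥ x) ^ (n + 1))⁻¹

theorem dot_self_nonneg' {n : ℕ} (x : Idx n → ℝ) : 0 ≤ x ⬝ᵥ x := by
  simp only [dotProduct]; exact Finset.sum_nonneg fun i _ => mul_self_nonneg _

theorem rho_cont (n : ℕ) : Continuous (rho n) := by
  unfold rho dotProduct
  refine Continuous.inv₀ (by fun_prop) (fun x => ?_)
  have := dot_self_nonneg' x
  rw [dotProduct] at this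
  positivity

theorem rho_pos {n : ℕ} (x : Idx n → ℝ) : 0 < rho n x := by
  have := dot_self_nonneg' x
  rw [rho]; positivity

theorem rho_integrable (n : ℕ) : Integrable (rho n) := by
  have h := integrable_rpow_neg_one_add_norm_sq (E := Idx n → ℝ) (μ := volume) (r := 2 * n + 2) (by simp; linarith)
  refine h.mono' (rho_cont n).aestronglyMeasurable (Filter.Eventually.of_forall fun x => ?_)
  rw [Real.norm_eq_abs, abs_of_pos (rho_pos x)]
  have e : (-(2 * (n : ℝ) + 2) / 2) = -((n + 1 : ℕ) : ℝ) := by push_cast; ring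
  rw [e, Real.rpow_neg (by positivity), Real.rpow_natCast, rho]
  have hx : ‖x‖ ^ 2 ≤ x ⬝ᵥ x := by
    have h1 : ‖x‖ ≤ Real.sqrt (x ⬝ᵥ x) := by
      rw [pi_norm_le_iff_of_nonneg (Real.sqrt_nonneg _)]
      intro i
      rw [Real.norm_eq_abs]
      apply Real.abs_le_sqrt
      rw [sq]
      simp only [dotProduct]
      exact Finset.single_le_sum (f := fun i => x i * x i) (fun i _ => mul_self_nonneg _) (Finset.mem_univ i)
    calc ‖x‖ ^ 2 ≤ Real.sqrt (x ⬝ᵥ x) ^ 2 := by gcongr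
      _ = _ := Real.sq_sqrt (dot_self_nonneg' x)
  gcongr

theorem subord {n : ℕ} (x : Idx n → ℝ) :
    ∫ s in Set.Ioi (0 : ℝ), s ^ n * Real.exp (-((1 + x ⬝ᵥ x) * s)) = (n.factorial : ℝ) * rho n x := by
  have hx := dot_self_nonneg' x
  have h := Real.integral_rpow_mul_exp_neg_mul_Ioi (a := n + 1) (r := 1 + x ⬝ᵥ x) (by positivity) (by positivity)
  rw [Real.Gamma_nat_eq_factorial, add_sub_cancel_right] at h
  simp only [Real.rpow_natCast] at h
  rw [h, rho, show ((n : ℝ) + 1) = ((n + 1 : ℕ) : ℝ) by push_cast; ring, Real.rpow_natCast]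
  rw [one_div, inv_pow]; ring

theorem exp_int (n : ℕ) : IntegrableOn (fun s : ℝ => s ^ n * Real.exp (-s)) (Set.Ioi 0) := by
  have := Real.GammaIntegral_convergent (s := n + 1) (by positivity)
  rw [add_sub_cancel_right] at this
  refine this.congr_fun (fun s _ => ?_) measurableSet_Ioi
  simp only [Real.rpow_natCast]; ring

theorem exp_int_val (n : ℕ) : ∫ s in Set.Ioi (0 : ℝ), s ^ n * Real.exp (-s) = n.factorial := by
  have := Real.Gamma_eq_integral (s := n + 1) (by positivity)
  rw [add_sub_cancel_right, Real.Gamma_nat_eq_factorial] at this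
  rw [this]
  refine setIntegral_congr_fun measurableSet_Ioi (fun s _ => ?_)
  simp only [Real.rpow_natCast]; ring

/-- Subordination bound: general. -/
theorem subord_bound {n : ℕ} (Bq : Matrix (Idx n) (Idx n) ℂ) (κ : ℝ) (hκ : 0 < κ)
    (hpos : ∀ x : Idx n → ℝ, 0 ≤ (realVec n x ⬝ᵥ (Bq *ᵥ realVec n x)).re) (hsym : Bqᵀ = Bq)
    (H : ℝ) (hH0 : 0 ≤ H)
    (hH : ∀ s : ℝ, 0 < s → (Real.sqrt ‖((s : ℂ) • (1 : Matrix (Idx n) (Idx n) ℂ) + (κ : ℂ) • Bq).det‖)⁻¹ ≤ H * (min s 1 ^ n)⁻¹)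
    (y : Idx n → ℝ) :
    ‖∫ x : Idx n → ℝ, Complex.exp (-(κ : ℂ) * (realVec n x ⬝ᵥ (Bq *ᵥ realVec n x))) * (rho n x : ℂ) *
      Complex.exp (((x ⬝ᵥ y : ℝ) : ℂ) * Complex.I)‖ ≤ 2 * Real.pi ^ n * H := by
  set q : (Idx n → ℝ) → ℂ := fun x => realVec n x ⬝ᵥ (Bq *ᵥ realVec n x) with hq
  have hqc : Continuous q := by
    simp only [hq, realVec, dotProduct, Matrix.mulVec]
    fun_prop
  have hdc : Continuous (fun x : Idx n → ℝ => x ⬝ᵥ x) := by simp only [dotProduct]; fun_prop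
  have hyc : Continuous (fun x : Idx n → ℝ => x ⬝ᵥ y) := by simp only [dotProduct]; fun_prop
  set Φ : (Idx n → ℝ) → ℝ → ℂ := fun x s => Complex.exp (-(κ : ℂ) * q x) * ((s ^ n * Real.exp (-((1 + x ⬝ᵥ x) * s)) : ℝ) : ℂ) *
      Complex.exp (((x ⬝ᵥ y : ℝ) : ℂ) * Complex.I) with hΦ
  have hΦc : Continuous (Function.uncurry Φ) := by
    simp only [hΦ, Function.uncurry]
    fun_prop
  have hΦn : ∀ x s, 0 < s → ‖Φ x s‖ ≤ s ^ n * Real.exp (-((1 + x ⬝ᵥ x) * s)) := by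
    intro x s hs
    simp only [hΦ]
    rw [norm_mul, norm_mul, Complex.norm_exp_ofReal_mul_I, mul_one, Complex.norm_real, Real.norm_eq_abs,
      abs_of_nonneg (by positivity)]
    apply mul_le_of_le_one_left (by positivity)
    rw [Complex.norm_exp, Real.exp_le_one_iff, ← Complex.ofReal_neg, Complex.re_ofReal_mul]
    have := hpos x
    nlinarith
  have hint1 : ∀ x : Idx n → ℝ, IntegrableOn (fun s : ℝ => s ^ n * Real.exp (-((1 + x ⬝ᵥ x) * s))) (Set.Ioi 0) := by
    intro x
    refine (exp_int n).mono' (by fun_prop) ?_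
    refine (ae_restrict_mem measurableSet_Ioi).mono fun s hs => ?_
    have hs : 0 < s := hs
    rw [Real.norm_eq_abs, abs_of_nonneg (by positivity)]
    have := dot_self_nonneg' x
    gcongr
    nlinarith
  have hintgΦ : Integrable (Function.uncurry Φ) (volume.prod (volume.restrict (Set.Ioi 0))) := by
    rw [integrable_prod_iff hΦc.aestronglyMeasurable]
    constructor
    · refine Filter.Eventually.of_forall fun x => ?_
      refine (hint1 x).mono' (by exact (hΦc.comp (by fun_prop : Continuous fun s : ℝ => (x, s))).aestronglyMeasurable) ?_
      exact (ae_restrict_mem measurableSet_Ioi).mono fun s hs => hΦn x s hs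
    · refine ((rho_integrable n).const_mul (n.factorial : ℝ)).mono' ?_ (Filter.Eventually.of_forall fun x => ?_)
      · exact (hΦc.norm.aestronglyMeasurable (μ := volume.prod (volume.restrict (Set.Ioi 0)))).integral_prod_right'
      · rw [Real.norm_eq_abs, abs_of_nonneg (integral_nonneg fun s => norm_nonneg _), ← subord]
        refine integral_mono_of_nonneg (Filter.Eventually.of_forall fun s => norm_nonneg _) (hint1 x) ?_
        exact (ae_restrict_mem measurableSet_Ioi).mono fun s hs => hΦn x s hs
  have hsw := integral_integral_swap hintgΦ
  have hl : ∀ x, ∫ s in Set.Ioi (0 : ℝ), Φ x s = (n.factorial : ℂ) * (Complex.exp (-(κ : ℂ) * q x) * (rho n x : ℂ) *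
      Complex.exp (((x ⬝ᵥ y : ℝ) : ℂ) * Complex.I)) := by
    intro x
    simp only [hΦ]
    rw [integral_mul_const, integral_const_mul, integral_complex_ofReal, subord]
    push_cast; ring
  simp_rw [hl] at hsw
  rw [integral_const_mul] at hsw
  have hr : ∀ s : ℝ, 0 < s → ‖∫ x, Φ x s‖ ≤ (s ^ n * Real.exp (-s) + Real.exp (-s)) * (Real.pi ^ n * H) := by
    intro s hs
    have e : ∀ x, Φ x s = ((s ^ n * Real.exp (-s) : ℝ) : ℂ) * Complex.exp (-((fun i => (x i : ℂ)) ⬝ᵥ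
       ((((s : ℂ) • (1 : Matrix (Idx n) (Idx n) ℂ) + (κ : ℂ) • Bq)) *ᵥ (fun i => (x i : ℂ)))) + ((x ⬝ᵥ y : ℝ) : ℂ) * Complex.I) := by
      intro x
      have e2 : (fun i => (x i : ℂ)) ⬝ᵥ ((((s : ℂ) • (1 : Matrix (Idx n) (Idx n) ℂ) + (κ : ℂ) • Bq)) *ᵥ (fun i => (x i : ℂ)))
         = (s : ℂ) * ((x ⬝ᵥ x : ℝ) : ℂ) + κ * q x := by
        rw [Matrix.add_mulVec, dotProduct_add, Matrix.smul_mulVec, Matrix.smul_mulVec, Matrix.one_mulVec, dotProduct_smul,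
          dotProduct_smul, smul_eq_mul, smul_eq_mul]
        congr 2
        simp [dotProduct]
      rw [e2]
      simp only [hΦ]
      push_cast
      have : -(((1 + ((x ⬝ᵥ x : ℝ) : ℂ)) * s)) = -(s : ℂ) + -(s * ((x ⬝ᵥ x : ℝ) : ℂ)) := by ring
      rw [this, Complex.exp_add, neg_add, Complex.exp_add, Complex.exp_add]
      rw [neg_mul]
      ring
    simp_rw [e]
    rw [integral_const_mul, norm_mul, Complex.norm_real, Real.norm_eq_abs, abs_of_nonneg (by positivity)]
    have hg := gauss_bound ((s : ℂ) • (1 : Matrix (Idx n) (Idx n) ℂ) + (κ : ℂ) • Bq)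
      (by rw [Matrix.transpose_add, Matrix.transpose_smul, Matrix.transpose_smul, Matrix.transpose_one, hsym]) (by
        intro x hx
        rw [Matrix.add_mulVec, dotProduct_add, Matrix.smul_mulVec, Matrix.smul_mulVec, Matrix.one_mulVec, dotProduct_smul,
          dotProduct_smul, smul_eq_mul, smul_eq_mul, Complex.add_re, Complex.re_ofReal_mul, Complex.re_ofReal_mul]
        have h1 : 0 < ((fun i => (x i : ℂ)) ⬝ᵥ (fun i => (x i : ℂ))).re := by
          have : ((fun i => (x i : ℂ)) ⬝ᵥ (fun i => (x i : ℂ))) = ((x ⬝ᵥ x : ℝ) : ℂ) := by simp [dotProduct]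
          rw [this, Complex.ofReal_re]
          refine lt_of_le_of_ne (dot_self_nonneg' x) (fun h0 => hx ?_)
          exact dotProduct_self_eq_zero.1 h0.symm
        have h2 := hpos x
        have h3 : 0 ≤ κ * ((fun i => (x i : ℂ)) ⬝ᵥ Bq *ᵥ (fun i => (x i : ℂ))).re := mul_nonneg hκ.le h2
        have := mul_pos hs h1
        linarith) y
    have hcard : Fintype.card (Idx n) = 2 * n := by simp [Idx]; ring
    rw [hcard, pow_mul, Real.sq_sqrt Real.pi_pos.le] at hg
    have hk : s ^ n * (min s 1 ^ n)⁻¹ ≤ s ^ n + 1 := by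
      rcases le_total s 1 with h | h
      · rw [min_eq_left h, mul_inv_cancel₀ (by positivity)]
        have : 0 ≤ s ^ n := by positivity
        linarith
      · rw [min_eq_right h, one_pow, inv_one, mul_one]; linarith
    calc _ ≤ s ^ n * Real.exp (-s) * (Real.pi ^ n * (H * (min s 1 ^ n)⁻¹)) := by
          gcongr
          exact hg.trans (mul_le_mul_of_nonneg_left (hH s hs) (by positivity))
      _ = (s ^ n * (min s 1 ^ n)⁻¹) * (Real.exp (-s) * (Real.pi ^ n * H)) := by ring
      _ ≤ (s ^ n + 1) * (Real.exp (-s) * (Real.pi ^ n * H)) := by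
          apply mul_le_mul_of_nonneg_right hk; positivity
      _ = _ := by ring
  have hbound : ‖∫ s in Set.Ioi (0 : ℝ), ∫ x, Φ x s‖ ≤ (n.factorial + 1) * (Real.pi ^ n * H) := by
    have hi0 := exp_int 0
    simp only [pow_zero, one_mul] at hi0
    have hi : IntegrableOn (fun s : ℝ => (s ^ n * Real.exp (-s) + Real.exp (-s)) * (Real.pi ^ n * H)) (Set.Ioi 0) :=
      ((exp_int n).add hi0).mul_const _
    refine (norm_integral_le_of_norm_le hi ((ae_restrict_mem measurableSet_Ioi).mono fun s hs => hr s hs)).trans (le_of_eq ?_)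
    have hv0 := exp_int_val 0
    simp only [pow_zero, one_mul] at hv0
    rw [integral_mul_const, integral_add (exp_int n) hi0, exp_int_val, hv0]
    simp
  rw [← hsw, norm_mul] at hbound
  simp only [Complex.norm_natCast] at hbound
  have hf : (1 : ℝ) ≤ n.factorial := by exact_mod_cast Nat.one_le_iff_ne_zero.2 (Nat.factorial_ne_zero n)
  have h0 : 0 ≤ Real.pi ^ n * H := by positivity
  refine le_of_mul_le_mul_left (hbound.trans ?_) (lt_of_lt_of_le one_pos hf)
  nlinarith
end part8

section part9
/-- the matrix B(t) = J tan(2πtS) -/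
def Bt (n : ℕ) (S : Matrix (Idx n) (Idx n) ℂ) (t : ℝ) : Matrix (Idx n) (Idx n) ℂ :=
  Jmat n * matTan (((2 * Real.pi * t : ℝ) : ℂ) • S)

/-- non-singularity of cos(2πtS) -/
def NonSing (n : ℕ) (S : Matrix (Idx n) (Idx n) ℂ) (t : ℝ) : Prop :=
  (matCos (((2 * Real.pi * t : ℝ) : ℂ) • S)).det ≠ 0

theorem GammaHat_eq (n : ℕ) (μ t : ℝ) (S : Matrix (Idx n) (Idx n) ℂ) (l : List ℂ) (w : Idx n → ℂ) :
    GammaHat n μ (t : ℂ) S l w = (sqrtDetCos t l)⁻¹ *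
      Complex.exp (-((2 * Real.pi / |μ| : ℝ) : ℂ) * (w ⬝ᵥ (Bt n S t *ᵥ w))) := by
  rw [GammaHat, sigmaC, Bt, ← Matrix.mulVec_mulVec]
  push_cast
  rfl

theorem star_realVec (n : ℕ) (x : Idx n → ℝ) : star (realVec n x) = realVec n x := by
  funext i; simp [realVec]

theorem Bt_pos {n : ℕ} {A S : Matrix (Idx n) (Idx n) ℂ} (hA : Aᵀ = A) (hS : S = -(A * Jmat n))
    (hpos : RePosQ n S) {t : ℝ} (ht : 0 ≤ t) (hd : NonSing n S t) (x : Idx n → ℝ) :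
    0 ≤ (realVec n x ⬝ᵥ (Bt n S t *ᵥ realVec n x)).re := by
  have := B_pos hA hS hpos (2 * Real.pi * t) (by positivity) hd (realVec n x)
  rwa [star_realVec] at this

theorem Bt_symm {n : ℕ} {A S : Matrix (Idx n) (Idx n) ℂ} (hA : Aᵀ = A) (hS : S = -(A * Jmat n))
    {t : ℝ} (hd : NonSing n S t) : (Bt n S t)ᵀ = Bt n S t := B_symm hA hS _ hd

theorem sqrtDetCos_sq {n : ℕ} {S : Matrix (Idx n) (Idx n) ℂ} {l : List ℂ} (hl : IsPairingList n S l) (t : ℝ) :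
    (matCos (((2 * Real.pi * t : ℝ) : ℂ) • S)).det = sqrtDetCos t l ^ 2 := by
  rw [← matCos_det_pair hl]; push_cast; rfl

theorem sqrtDetCos_ne {n : ℕ} {S : Matrix (Idx n) (Idx n) ℂ} {l : List ℂ} (hl : IsPairingList n S l) {t : ℝ}
   (hd : NonSing n S t) : sqrtDetCos t l ≠ 0 := by
  intro h
  rw [NonSing, sqrtDetCos_sq hl, h] at hd
  simp at hd

theorem GammaHat_norm_le {n : ℕ} {A S : Matrix (Idx n) (Idx n) ℂ} (hA : Aᵀ = A) (hS : S = -(A * Jmat n))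
    (hpos : RePosQ n S) {t : ℝ} (ht : 0 ≤ t) (hd : NonSing n S t) (μ : ℝ) (l : List ℂ) (x : Idx n → ℝ) :
    ‖GammaHat n μ (t : ℂ) S l (realVec n x)‖ ≤ ‖(sqrtDetCos t l)⁻¹‖ := by
  rw [GammaHat_eq, norm_mul]
  apply mul_le_of_le_one_right (norm_nonneg _)
  rw [Complex.norm_exp, Real.exp_le_one_iff, ← Complex.ofReal_neg, Complex.re_ofReal_mul]
  have := Bt_pos hA hS hpos ht hd x
  have : 0 ≤ 2 * Real.pi / |μ| := by positivity
  nlinarith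

theorem GammaHat_cont (n : ℕ) (μ t : ℝ) (S : Matrix (Idx n) (Idx n) ℂ) (l : List ℂ) :
    Continuous (fun x : Idx n → ℝ => GammaHat n μ (t : ℂ) S l (realVec n x)) := by
  simp only [GammaHat_eq, realVec, dotProduct, Matrix.mulVec]
  fun_prop

theorem n_pos {n : ℕ} {S : Matrix (Idx n) (Idx n) ℂ} (hnr : HasNonrealEig n S) : 1 ≤ n := by
  obtain ⟨ω, hω, him⟩ := hnr
  obtain ⟨v, hv, hSv⟩ := exists_eigvec S ω hω
  obtain ⟨i, -⟩ := Function.ne_iff.1 hv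
  rcases i with i | i <;> exact Nat.one_le_iff_ne_zero.2 (fun h => by subst h; exact i.elim0)

def Ebd (n : ℕ) (S : Matrix (Idx n) (Idx n) ℂ) (μ t : ℝ) : ℝ :=
  Real.exp (-(2 * Real.pi * nuTotal n S * t)) * (Real.sqrt (min 1 t))⁻¹ * (Real.sqrt |μ| * (1 + |μ|) ^ n)

theorem W_bound {n : ℕ} {A S : Matrix (Idx n) (Idx n) ℂ} (hA : Aᵀ = A) (hS : S = -(A * Jmat n))
    (hpos : RePosQ n S) (hnr : HasNonrealEig n S) {l : List ℂ} (hl : IsPairingList n S l) :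
    ∃ C0 > 0, ∀ μ : ℝ, μ ≠ 0 → ∀ t : ℝ, 0 < t → NonSing n S t → ∀ y : Idx n → ℝ,
     ‖∫ x : Idx n → ℝ, GammaHat n μ (t : ℂ) S l (realVec n x) * (rho n x : ℂ) *
      Complex.exp (((x ⬝ᵥ y : ℝ) : ℂ) * Complex.I)‖ ≤ C0 * Ebd n S μ t := by
  obtain ⟨c, hc, hlow⟩ := det_lower hA hS hpos hnr hl
  have hn := n_pos hnr
  refine ⟨2 * Real.pi ^ n * (Real.sqrt c)⁻¹, by positivity, ?_⟩
  intro μ hμ t ht hd y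
  have hμ' : 0 < |μ| := abs_pos.2 hμ
  set κ := 2 * Real.pi / |μ| with hκ
  have hκ0 : 0 < κ := by positivity
  have hq0 := sqrtDetCos_ne hl hd
  set q := ‖sqrtDetCos t l‖ with hq
  have hqp : 0 < q := norm_pos_iff.2 hq0
  have hmt : 0 < min 1 t := lt_min one_pos ht
  set H := q * ((Real.sqrt c)⁻¹ * Real.exp (-(2 * Real.pi * nuTotal n S * t)) * (Real.sqrt (min 1 t))⁻¹ * ((Real.sqrt κ)⁻¹ * (min κ 1 ^ n)⁻¹)) with hH
  have hk1 : 0 < min κ 1 := lt_min hκ0 one_pos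
  have hsb := subord_bound (Bt n S t) κ hκ0 (Bt_pos hA hS hpos ht.le hd) (Bt_symm hA hS hd) H (by positivity) (by
    intro s hs
    have h1 := hlow t ht.le hd s κ hs hκ0
    rw [norm_mul, sqrtDetCos_sq hl, norm_pow, ← hq] at h1
    have hs1 : 0 < min s 1 := lt_min hs one_pos
    have hmm : (min s 1 * min κ 1) ^ (2 * n) ≤ (min s κ) ^ (2 * n - 1) := by
      have ha : min s 1 * min κ 1 ≤ min s κ := by
        apply le_min
        · calc _ ≤ s * 1 := mul_le_mul (min_le_left _ _) (min_le_right _ _) hk1.le hs.le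
            _ = s := mul_one s
        · calc _ ≤ 1 * κ := mul_le_mul (min_le_right _ _) (min_le_left _ _) hk1.le one_pos.le
            _ = κ := one_mul κ
      have hb : min s 1 * min κ 1 ≤ 1 := mul_le_one₀ (min_le_right _ _) hk1.le (min_le_right _ _)
      calc _ ≤ (min s 1 * min κ 1) ^ (2 * n - 1) := pow_le_pow_of_le_one (by positivity) hb (by omega)
        _ ≤ _ := by gcongr
    set D := ‖((s : ℂ) • (1 : Matrix (Idx n) (Idx n) ℂ) + (κ : ℂ) • Bt n S t).det‖ with hD
    have h2 : c * Real.exp (4 * Real.pi * t * nuTotal n S) * min 1 t * κ * (min s 1 * min κ 1) ^ (2 * n) ≤ q ^ 2 * D := by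
      refine le_trans ?_ h1
      gcongr
    have h3 := Real.sqrt_le_sqrt h2
    rw [Real.sqrt_mul (sq_nonneg q), Real.sqrt_sq hqp.le, Real.sqrt_mul (by positivity), Real.sqrt_mul (by positivity),
      Real.sqrt_mul (by positivity), Real.sqrt_mul (by positivity), mul_comm 2 n, pow_mul, Real.sqrt_sq (by positivity), mul_pow] at h3
    have h4 : Real.sqrt (Real.exp (4 * Real.pi * t * nuTotal n S)) = Real.exp (2 * Real.pi * nuTotal n S * t) := by
      rw [Real.sqrt_eq_iff_mul_self_eq (by positivity) (by positivity), ← Real.exp_add]; ring_nf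
    rw [h4] at h3
    have hDp : 0 < Real.sqrt D := by
      by_contra h0
      have : Real.sqrt D = 0 := le_antisymm (not_lt.1 h0) (Real.sqrt_nonneg _)
      rw [this, mul_zero] at h3
      exact absurd h3 (not_le.2 (by positivity))
    rw [hH, Real.exp_neg]
    rw [inv_le_iff_one_le_mul₀ hDp]
    calc (1 : ℝ) = (q * Real.sqrt D) * (q * Real.sqrt D)⁻¹ := by rw [mul_inv_cancel₀ (by positivity)]
      _ ≤ (q * Real.sqrt D) * (√c * Real.exp (2 * Real.pi * nuTotal n S * t) * √(min 1 t) * √κ * (min s 1 ^ n * min κ 1 ^ n))⁻¹ := by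
          gcongr
      _ = _ := by simp only [mul_inv]; ring) y
  have e : ∀ x : Idx n → ℝ, GammaHat n μ (t : ℂ) S l (realVec n x) * (rho n x : ℂ) * Complex.exp (((x ⬝ᵥ y : ℝ) : ℂ) * Complex.I)
     = (sqrtDetCos t l)⁻¹ * (Complex.exp (-(κ : ℂ) * (realVec n x ⬝ᵥ (Bt n S t *ᵥ realVec n x))) * (rho n x : ℂ) *
      Complex.exp (((x ⬝ᵥ y : ℝ) : ℂ) * Complex.I)) := by
    intro x; rw [GammaHat_eq]; ring
  simp_rw [e]
  rw [integral_const_mul, norm_mul, norm_inv, ← hq]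
  have hk2 : (Real.sqrt κ)⁻¹ ≤ Real.sqrt |μ| := by
    rw [← Real.sqrt_inv]
    apply Real.sqrt_le_sqrt
    rw [hκ, inv_div, div_le_iff₀ (by positivity)]
    nlinarith [Real.pi_gt_three]
  have hk3 : (min κ 1 ^ n)⁻¹ ≤ (1 + |μ|) ^ n := by
    rw [← inv_pow]
    gcongr
    rw [inv_le_iff_one_le_mul₀ hk1]
    rcases le_total κ 1 with h | h
    · rw [min_eq_left h, hκ, mul_div_assoc', le_div_iff₀ hμ']
      nlinarith [Real.pi_gt_three]
    · rw [min_eq_right h]; linarith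
  calc _ ≤ q⁻¹ * (2 * Real.pi ^ n * H) := by gcongr
    _ = 2 * Real.pi ^ n * ((Real.sqrt c)⁻¹ * Real.exp (-(2 * Real.pi * nuTotal n S * t)) * (Real.sqrt (min 1 t))⁻¹ * ((Real.sqrt κ)⁻¹ * (min κ 1 ^ n)⁻¹)) := by
        rw [hH]; field_simp
    _ ≤ 2 * Real.pi ^ n * ((Real.sqrt c)⁻¹ * Real.exp (-(2 * Real.pi * nuTotal n S * t)) * (Real.sqrt (min 1 t))⁻¹ * (Real.sqrt |μ| * (1 + |μ|) ^ n)) := by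
        gcongr
    _ = _ := by rw [Ebd]; ring

/-! ### transfer to `Pl n` -/

theorem plVec_mp (n : ℕ) : MeasurePreserving (fun w : Pl n => plVec n w) volume volume := by
  have h := volume_measurePreserving_sumPiEquivProdPi_symm (fun _ : Fin n ⊕ Fin n => ℝ)
  exact h

theorem plVec_me (n : ℕ) : MeasurableEmbedding (fun w : Pl n => plVec n w) :=
  (MeasurableEquiv.sumPiEquivProdPi (fun _ : Fin n ⊕ Fin n => ℝ)).symm.measurableEmbedding

theorem integral_plVec (n : ℕ) (f : (Idx n → ℝ) → ℂ) : ∫ w : Pl n, f (plVec n w) = ∫ x, f x :=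
  (plVec_mp n).integral_comp (plVec_me n) f

theorem integrable_plVec (n : ℕ) (f : (Idx n → ℝ) → ℂ) : Integrable (fun w : Pl n => f (plVec n w)) ↔ Integrable f :=
  (plVec_mp n).integrable_comp_emb (plVec_me n)

/-! ### singular set is countable -/
theorem sing_countable {n : ℕ} (S : Matrix (Idx n) (Idx n) ℂ) : {t : ℝ | ¬ NonSing n S t}.Countable := by
  have hsub : {t : ℝ | ¬ NonSing n S t} ⊆ ⋃ z ∈ S.charpoly.roots.toFinset, ⋃ k : ℤ,
      {t : ℝ | ((2 * Real.pi * t : ℝ) : ℂ) * z = (2 * k + 1) * Real.pi / 2} := by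
    intro t ht
    simp only [Set.mem_setOf_eq, NonSing, not_not] at ht
    rw [matCos_det, Multiset.prod_eq_zero_iff, Multiset.mem_map] at ht
    obtain ⟨z, hz, hc⟩ := ht
    obtain ⟨k, hk⟩ := Complex.cos_eq_zero_iff.1 hc
    simp only [Set.mem_iUnion]
    exact ⟨z, by simpa using hz, k, hk⟩
  refine Set.Countable.mono hsub ?_
  refine Set.Countable.biUnion (Finset.countable_toSet _) fun z _ => Set.countable_iUnion fun k => ?_
  apply Set.Subsingleton.countable
  intro a ha b hb
  simp only [Set.mem_setOf_eq] at ha hb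
  have hne : ((2 * k + 1) * Real.pi / 2 : ℂ) ≠ 0 := by
    have h1 : (2 * (k : ℂ) + 1) ≠ 0 := by
      have : (2 * k + 1 : ℤ) ≠ 0 := by omega
      exact_mod_cast this
    have h2 : (Real.pi : ℂ) ≠ 0 := by exact_mod_cast Real.pi_ne_zero
    exact div_ne_zero (mul_ne_zero h1 h2) two_ne_zero
  have hz : z ≠ 0 := by
    intro h; rw [h, mul_zero] at ha; exact hne ha.symm
  have := mul_right_cancel₀ hz (ha.trans hb.symm)
  have := Complex.ofReal_injective this
  have hp := Real.pi_pos
  nlinarith [mul_left_cancel₀ (by positivity : (2 * Real.pi) ≠ 0) this]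
end part9

section part10
section TFgen
open scoped FourierTransform LineDeriv
variable {E : Type} [NormedAddCommGroup E] [NormedSpace ℝ E] [FiniteDimensional ℝ E] [MeasureSpace E] [BorelSpace E]
variable {V : Type} [NormedAddCommGroup V] [InnerProductSpace ℝ V] [FiniteDimensional ℝ V] [MeasurableSpace V] [BorelSpace V]

def TF (e r : E ≃L[ℝ] V) : SchwartzMap E ℂ →L[ℂ] SchwartzMap E ℂ :=
  (SchwartzMap.compCLMOfContinuousLinearEquiv ℂ r) ∘L (FourierTransform.fourierCLM ℂ (SchwartzMap V ℂ)) ∘L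
    (SchwartzMap.compCLMOfContinuousLinearEquiv ℂ e.symm)

def TI (e r : E ≃L[ℝ] V) : SchwartzMap E ℂ →L[ℂ] SchwartzMap E ℂ :=
  (SchwartzMap.compCLMOfContinuousLinearEquiv ℂ e) ∘L (FourierTransform.fourierInvCLM ℂ (SchwartzMap V ℂ)) ∘L
    (SchwartzMap.compCLMOfContinuousLinearEquiv ℂ r.symm)

theorem TF_TI (e r : E ≃L[ℝ] V) (g : SchwartzMap E ℂ) : TF e r (TI e r g) = g := by
  have h : SchwartzMap.compCLMOfContinuousLinearEquiv ℂ e.symm (SchwartzMap.compCLMOfContinuousLinearEquiv ℂ e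
    (𝓕⁻ (SchwartzMap.compCLMOfContinuousLinearEquiv ℂ r.symm g))) = 𝓕⁻ (SchwartzMap.compCLMOfContinuousLinearEquiv ℂ r.symm g) := by
    ext x; simp
  simp only [TF, TI, ContinuousLinearMap.comp_apply, FourierTransform.fourierCLM_apply, FourierTransform.fourierInvCLM_apply]
  rw [h, FourierTransform.fourier_fourierInv_eq]
  ext x; simp

theorem TI_TF (e r : E ≃L[ℝ] V) (g : SchwartzMap E ℂ) : TI e r (TF e r g) = g := by
  have h : SchwartzMap.compCLMOfContinuousLinearEquiv ℂ r.symm (SchwartzMap.compCLMOfContinuousLinearEquiv ℂ r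
    (𝓕 (SchwartzMap.compCLMOfContinuousLinearEquiv ℂ e.symm g))) = 𝓕 (SchwartzMap.compCLMOfContinuousLinearEquiv ℂ e.symm g) := by
    ext x; simp
  simp only [TF, TI, ContinuousLinearMap.comp_apply, FourierTransform.fourierCLM_apply, FourierTransform.fourierInvCLM_apply]
  rw [h, FourierTransform.fourierInv_fourier_eq]
  ext x; simp

theorem TF_apply (e r : E ≃L[ℝ] V) (he : MeasurePreserving e volume volume) (f : SchwartzMap E ℂ) (w : E) :
    TF e r f w = ∫ v, f v * Complex.exp (-(2 * (Real.pi : ℂ) * Complex.I) * ((inner ℝ (e v) (r w) : ℝ) : ℂ)) := by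
  simp only [TF, ContinuousLinearMap.comp_apply, FourierTransform.fourierCLM_apply]
  rw [SchwartzMap.compCLMOfContinuousLinearEquiv_apply, Function.comp_apply, SchwartzMap.fourier_coe, Real.fourier_eq',
    ← he.integral_comp e.toHomeomorph.measurableEmbedding]
  refine integral_congr_ae (Filter.Eventually.of_forall fun v => ?_)
  simp only [SchwartzMap.compCLMOfContinuousLinearEquiv_apply, Function.comp_apply, ContinuousLinearEquiv.symm_apply_apply, smul_eq_mul]
  rw [mul_comm]
  congr 2
  push_cast; ring

theorem TI_apply (e r : E ≃L[ℝ] V) (hr : MeasurePreserving r volume volume) (g : SchwartzMap E ℂ) (v : E) :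
    TI e r g v = ∫ w, g w * Complex.exp ((2 * (Real.pi : ℂ) * Complex.I) * ((inner ℝ (e v) (r w) : ℝ) : ℂ)) := by
  simp only [TI, ContinuousLinearMap.comp_apply, FourierTransform.fourierInvCLM_apply]
  rw [SchwartzMap.compCLMOfContinuousLinearEquiv_apply, Function.comp_apply, SchwartzMap.fourierInv_coe, Real.fourierInv_eq',
    ← hr.integral_comp r.toHomeomorph.measurableEmbedding]
  refine integral_congr_ae (Filter.Eventually.of_forall fun v => ?_)
  simp only [SchwartzMap.compCLMOfContinuousLinearEquiv_apply, Function.comp_apply, ContinuousLinearEquiv.symm_apply_apply, smul_eq_mul]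
  rw [mul_comm, real_inner_comm]
  congr 2
  push_cast; ring

theorem TF_deriv (e r : E ≃L[ℝ] V) (f : SchwartzMap E ℂ) (m w : E) :
    TF e r (∂_{m} f) w = (2 * (Real.pi : ℂ) * Complex.I) * ((inner ℝ (e m) (r w) : ℝ) : ℂ) * TF e r f w := by
  simp only [TF, ContinuousLinearMap.comp_apply, FourierTransform.fourierCLM_apply]
  have h : SchwartzMap.compCLMOfContinuousLinearEquiv ℂ e.symm (∂_{m} f) = ∂_{e m} (SchwartzMap.compCLMOfContinuousLinearEquiv ℂ e.symm f) := by
    rw [SchwartzMap.lineDerivOp_compCLMOfContinuousLinearEquiv]; simp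
  have ht : (inner ℝ · (e m) : V → ℝ).HasTemperateGrowth := by fun_prop
  rw [h, SchwartzMap.fourier_lineDerivOp_eq]
  simp only [SchwartzMap.compCLMOfContinuousLinearEquiv_apply, Function.comp_apply, SchwartzMap.smul_apply]
  rw [SchwartzMap.smulLeftCLM_apply_apply ht, real_inner_comm]
  simp [mul_assoc]

theorem TF_mul (e r : E ≃L[ℝ] V) (f h : SchwartzMap E ℂ) (m w : E) (hh : ∀ v, h v = ((inner ℝ (e v) (r m) : ℝ) : ℂ) * f v) :
    TF e r h w = -(2 * (Real.pi : ℂ) * Complex.I)⁻¹ * (∂_{m} (TF e r f)) w := by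
  have hpi : (2 * (Real.pi : ℂ) * Complex.I) ≠ 0 := by
    simp [Real.pi_ne_zero]
  have ht : (inner ℝ · (r m) : V → ℝ).HasTemperateGrowth := by fun_prop
  have h1 : ∂_{m} (TF e r f) = -(2 * (Real.pi : ℂ) * Complex.I) • TF e r h := by
    simp only [TF, ContinuousLinearMap.comp_apply, FourierTransform.fourierCLM_apply]
    rw [SchwartzMap.lineDerivOp_compCLMOfContinuousLinearEquiv, SchwartzMap.lineDerivOp_fourier_eq]
    have h2 : SchwartzMap.smulLeftCLM ℂ (inner ℝ · (r m) : V → ℝ) (SchwartzMap.compCLMOfContinuousLinearEquiv ℂ e.symm f)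
        = SchwartzMap.compCLMOfContinuousLinearEquiv ℂ e.symm h := by
      ext x
      rw [SchwartzMap.smulLeftCLM_apply_apply ht]
      simp [hh]
    rw [h2, FourierTransform.fourier_smul]
    ext x
    simp
  rw [h1, SchwartzMap.smul_apply, smul_eq_mul, neg_mul, neg_mul, mul_neg, neg_neg, inv_mul_cancel_left₀ hpi]

end TFgen
end part10

section part11
abbrev VP (n : ℕ) := EuclideanSpace ℝ (Idx n)
abbrev VH (n : ℕ) := WithLp 2 (VP n × ℝ)

def ePl (n : ℕ) : Pl n ≃ₗ[ℝ] VP n where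
  toFun w := WithLp.toLp 2 (plVec n w)
  invFun x := (fun j => x (Sum.inl j), fun j => x (Sum.inr j))
  left_inv w := by simp [plVec]
  right_inv x := by ext i; cases i <;> simp [plVec]
  map_add' v w := by ext i; cases i <;> simp [plVec]
  map_smul' c w := by ext i; cases i <;> simp [plVec]

def rot (n : ℕ) : Pl n ≃ₗ[ℝ] Pl n where
  toFun w := (-w.2, w.1)
  invFun w := (w.2, -w.1)
  left_inv w := by simp
  right_inv w := by simp
  map_add' v w := by ext i <;> simp [add_comm]
  map_smul' c w := by ext i <;> simp

def eP (n : ℕ) : Pl n ≃L[ℝ] VP n := (ePl n).toContinuousLinearEquiv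
def rP (n : ℕ) : Pl n ≃L[ℝ] VP n := ((rot n).trans (ePl n)).toContinuousLinearEquiv

def eH (n : ℕ) : Hgrp n ≃L[ℝ] VH n :=
  ((ContinuousLinearEquiv.prodAssoc ℝ (Fin n → ℝ) (Fin n → ℝ) ℝ).symm.trans
    ((eP n).prodCongr (ContinuousLinearEquiv.refl ℝ ℝ))).trans (WithLp.prodContinuousLinearEquiv 2 ℝ (VP n) ℝ).symm
def rH (n : ℕ) : Hgrp n ≃L[ℝ] VH n :=
  ((ContinuousLinearEquiv.prodAssoc ℝ (Fin n → ℝ) (Fin n → ℝ) ℝ).symm.trans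
    ((rP n).prodCongr (ContinuousLinearEquiv.neg ℝ))).trans (WithLp.prodContinuousLinearEquiv 2 ℝ (VP n) ℝ).symm

theorem eP_apply (n : ℕ) (w : Pl n) : eP n w = WithLp.toLp 2 (plVec n w) := rfl
theorem rP_apply (n : ℕ) (w : Pl n) : rP n w = eP n (-w.2, w.1) := rfl
theorem eH_apply (n : ℕ) (p : Hgrp n) : eH n p = WithLp.toLp 2 (eP n (p.1, p.2.1), p.2.2) := rfl
theorem rH_apply (n : ℕ) (p : Hgrp n) : rH n p = WithLp.toLp 2 (rP n (p.1, p.2.1), -p.2.2) := rfl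

theorem sigmaR_eq (n : ℕ) (v w : Pl n) : sigmaR n (plVec n v) (plVec n w) = ∑ j, (v.1 j * w.2 j - v.2 j * w.1 j) := by
  simp [sigmaR, plVec, JmatR, Matrix.fromBlocks_mulVec, dotProduct, Finset.sum_sub_distrib, Matrix.neg_mulVec]; ring

theorem inner_P (n : ℕ) (v w : Pl n) : inner ℝ (eP n v) (rP n w) = sigmaR n (plVec n w) (plVec n v) := by
  rw [sigmaR_eq, rP_apply, eP_apply, eP_apply]
  simp [PiLp.inner_apply, plVec, Finset.sum_sub_distrib, mul_comm]; ring

theorem inner_H (n : ℕ) (p q : Hgrp n) : inner ℝ (eH n p) (rH n q) =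
    sigmaR n (plVec n (q.1, q.2.1)) (plVec n (p.1, p.2.1)) - q.2.2 * p.2.2 := by
  rw [eH_apply, rH_apply, WithLp.prod_inner_apply]
  simp only [inner_P]
  simp; ring

theorem eP_mp (n : ℕ) : MeasurePreserving (eP n) volume volume :=
  (PiLp.volume_preserving_toLp (Idx n)).comp (plVec_mp n)

theorem rot_mp (n : ℕ) : MeasurePreserving (fun w : Pl n => (-w.2, w.1)) volume volume := by
  have h1 : MeasurePreserving (Prod.swap : Pl n → Pl n) volume volume := Measure.measurePreserving_swap
  have h2 : MeasurePreserving (fun w : Fin n → ℝ => -w) volume volume := Measure.measurePreserving_neg _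
  have h3 : MeasurePreserving (Prod.map (fun w : Fin n → ℝ => -w) id : Pl n → Pl n) volume volume :=
    h2.prod (MeasurePreserving.id _)
  exact h3.comp h1

theorem rP_mp (n : ℕ) : MeasurePreserving (rP n) volume volume := (eP_mp n).comp (rot_mp n)

theorem assoc_mp (n : ℕ) : MeasurePreserving (fun p : Hgrp n => (((p.1, p.2.1), p.2.2) : Pl n × ℝ)) volume volume :=
  (MeasurePreserving.symm MeasurableEquiv.prodAssoc volume_preserving_prodAssoc : _)

theorem eH_mp (n : ℕ) : MeasurePreserving (eH n) volume volume := by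
  have h : MeasurePreserving (Prod.map (eP n) id : Pl n × ℝ → VP n × ℝ) volume volume :=
    (eP_mp n).prod (MeasurePreserving.id _)
  exact (WithLp.volume_preserving_toLp _ _).comp (h.comp (assoc_mp n))

theorem rH_mp (n : ℕ) : MeasurePreserving (rH n) volume volume := by
  have h : MeasurePreserving (Prod.map (rP n) (fun u : ℝ => -u) : Pl n × ℝ → VP n × ℝ) volume volume :=
    (rP_mp n).prod (Measure.measurePreserving_neg _)
  exact (WithLp.volume_preserving_toLp _ _).comp (h.comp (assoc_mp n))
end part11

section part12
structure Hyp (n : ℕ) (A S : Matrix (Idx n) (Idx n) ℂ) (l : List ℂ) : Prop where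
  hA : Aᵀ = A
  hS : S = -(A * Jmat n)
  hpos : RePosQ n S
  hnr : HasNonrealEig n S
  hl : IsPairingList n S l

instance instHaarA (n : ℕ) : (volume : Measure ((Fin n → ℝ) × ℝ)).IsAddHaarMeasure :=
  Measure.prod.instIsAddHaarMeasure volume volume
instance instHaarP (n : ℕ) : (volume : Measure (Pl n)).IsAddHaarMeasure :=
  Measure.prod.instIsAddHaarMeasure volume volume
instance instHaarH (n : ℕ) : (volume : Measure (Hgrp n)).IsAddHaarMeasure :=
  Measure.prod.instIsAddHaarMeasure volume volume

abbrev FH (n : ℕ) := TF (eH n) (rH n)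
abbrev IH (n : ℕ) := TI (eH n) (rH n)
abbrev FP (n : ℕ) := TF (eP n) (rP n)
abbrev IP (n : ℕ) := TI (eP n) (rP n)

/-- the point (w, μ) -/
def hk {n : ℕ} (w : Pl n) (μ : ℝ) : Hgrp n := (w.1, w.2, μ)

def sg {n : ℕ} (v w : Pl n) : ℝ := sigmaR n (plVec n v) (plVec n w)

theorem sg_antisymm {n : ℕ} (v w : Pl n) : sg v w = - sg w v := by
  simp only [sg, sigmaR_eq, ← Finset.sum_neg_distrib]
  exact Finset.sum_congr rfl fun j _ => by ring

theorem integral_H {n : ℕ} (f : Hgrp n → ℂ) : ∫ p, f p = ∫ q : Pl n × ℝ, f (hk q.1 q.2) := by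
  rw [← (assoc_mp n).integral_comp (MeasurableEquiv.prodAssoc.symm.measurableEmbedding) (fun q : Pl n × ℝ => f (hk q.1 q.2))]
  rfl

theorem integrable_H {n : ℕ} {f : Hgrp n → ℂ} (hf : Integrable f) : Integrable (fun q : Pl n × ℝ => f (hk q.1 q.2)) := by
  rw [← (assoc_mp n).integrable_comp_emb (MeasurableEquiv.prodAssoc.symm.measurableEmbedding)]
  exact hf

theorem norm_expI (x : ℝ) : ‖Complex.exp ((x : ℂ) * I)‖ = 1 := by
  rw [Complex.norm_exp_ofReal_mul_I]

theorem norm_exp2 (x : ℝ) : ‖Complex.exp (-(2 * (Real.pi : ℂ) * Complex.I) * (x : ℂ))‖ = 1 := by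
  rw [show -(2 * (Real.pi : ℂ) * Complex.I) * (x : ℂ) = ((-2 * Real.pi * x : ℝ) : ℂ) * I by push_cast; ring, norm_expI]

theorem sg_cont {n : ℕ} : Continuous (fun q : Pl n × Pl n => sg q.1 q.2) := by
  simp only [sg, sigmaR_eq]
  fun_prop

theorem FH_apply {n : ℕ} (f : SchwartzMap (Hgrp n) ℂ) (w : Pl n) (μ : ℝ) :
    FH n f (hk w μ) = ∫ q : Pl n × ℝ, f (hk q.1 q.2) *
      Complex.exp (-(2 * (Real.pi : ℂ) * Complex.I) * ((sg w q.1 - μ * q.2 : ℝ) : ℂ)) := by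
  rw [TF_apply _ _ (eH_mp n), integral_H]
  simp only [inner_H]
  rfl

theorem FP_apply {n : ℕ} (f : SchwartzMap (Pl n) ℂ) (w : Pl n) :
    FP n f w = ∫ v : Pl n, f v * Complex.exp (-(2 * (Real.pi : ℂ) * Complex.I) * ((sg w v : ℝ) : ℂ)) := by
  rw [TF_apply _ _ (eP_mp n)]
  simp only [inner_P]
  rfl

theorem FP_inv {n : ℕ} (h : SchwartzMap (Pl n) ℂ) (v : Pl n) :
    h v = ∫ w : Pl n, FP n h w * Complex.exp (-(2 * (Real.pi : ℂ) * Complex.I) * ((sg v w : ℝ) : ℂ)) := by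
  conv_lhs => rw [← TI_TF (eP n) (rP n) h]
  rw [TI_apply _ _ (rP_mp n)]
  simp only [inner_P]
  refine integral_congr_ae (Filter.Eventually.of_forall fun w => ?_)
  simp only
  rw [sg_antisymm v w]
  congr 2
  push_cast
  simp [sg]

theorem FP_invol {n : ℕ} (h : SchwartzMap (Pl n) ℂ) : FP n (FP n h) = h := by
  ext v
  rw [FP_apply, ← FP_inv]

theorem slice {n : ℕ} (f : SchwartzMap (Hgrp n) ℂ) (μ : ℝ) (F : SchwartzMap (Pl n) ℂ)
    (hF : ∀ v : Pl n, F v = ∫ u : ℝ, f (v.1, v.2, u) *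
              Complex.exp (2 * (Real.pi : ℂ) * Complex.I * (μ : ℂ) * (u : ℂ))) (w : Pl n) :
    FP n F w = FH n f (hk w μ) := by
  rw [FH_apply, FP_apply]
  have hc : Continuous (fun q : Pl n × ℝ => Complex.exp (-(2 * (Real.pi : ℂ) * Complex.I) * ((sg w q.1 - μ * q.2 : ℝ) : ℂ))) := by
    have := (sg_cont (n := n)).comp (show Continuous (fun q : Pl n × ℝ => (w, q.1)) by fun_prop)
    simp only [Function.comp_def] at this
    fun_prop
  rw [Measure.volume_eq_prod (Pl n) ℝ, integral_prod]
  · refine integral_congr_ae (Filter.Eventually.of_forall fun v => ?_)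
    simp only
    rw [hF, ← integral_mul_const]
    refine integral_congr_ae (Filter.Eventually.of_forall fun u => ?_)
    simp only [hk]
    rw [mul_assoc, ← Complex.exp_add]
    congr 2
    push_cast; ring
  · exact (integrable_H f.integrable).mul_bdd (c := 1) hc.aestronglyMeasurable
      (Filter.Eventually.of_forall fun q => (norm_exp2 _).le)

def Iw (n : ℕ) (S : Matrix (Idx n) (Idx n) ℂ) (l : List ℂ) (f : SchwartzMap (Hgrp n) ℂ) (μ t : ℝ) : ℂ :=
  ∫ w : Pl n, GammaHat n μ t S l (realVec n (plVec n w)) * FH n f (hk w μ)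

/-! ### multiplier -/
def mfun (n : ℕ) (p : Hgrp n) : ℝ :=
  (1 + plVec n (p.1, p.2.1) ⬝ᵥ plVec n (p.1, p.2.1)) ^ (n+1) * (1 + p.2.2 ^ 2) ^ (n + 1)

theorem mfun_tg (n : ℕ) : (mfun n).HasTemperateGrowth := by
  have h1 : ∀ i : Fin n, (fun p : Hgrp n => p.1 i).HasTemperateGrowth := fun i =>
    ((ContinuousLinearMap.proj (R := ℝ) (φ := fun _ : Fin n => ℝ) i).comp (ContinuousLinearMap.fst ℝ (Fin n → ℝ) ((Fin n → ℝ) × ℝ))).hasTemperateGrowth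
  have h2 : ∀ i : Fin n, (fun p : Hgrp n => p.2.1 i).HasTemperateGrowth := fun i =>
    (((ContinuousLinearMap.proj (R := ℝ) (φ := fun _ : Fin n => ℝ) i).comp (ContinuousLinearMap.fst ℝ (Fin n → ℝ) ℝ)).comp (ContinuousLinearMap.snd ℝ (Fin n → ℝ) ((Fin n → ℝ) × ℝ))).hasTemperateGrowth
  have h3 : (fun p : Hgrp n => p.2.2).HasTemperateGrowth :=
    ((ContinuousLinearMap.snd ℝ (Fin n → ℝ) ℝ).comp (ContinuousLinearMap.snd ℝ (Fin n → ℝ) ((Fin n → ℝ) × ℝ))).hasTemperateGrowth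
  unfold mfun
  simp only [plVec, dotProduct, Fintype.sum_sum_type, Sum.elim_inl, Sum.elim_inr]
  have e1 : (fun p : Hgrp n => ∑ i, p.1 i * p.1 i).HasTemperateGrowth :=
    Function.HasTemperateGrowth.sum (fun i _ => (h1 i).mul (h1 i))
  have e2 : (fun p : Hgrp n => ∑ i, p.2.1 i * p.2.1 i).HasTemperateGrowth :=
    Function.HasTemperateGrowth.sum (fun i _ => (h2 i).mul (h2 i))
  fun_prop

theorem mfunC_tg (n : ℕ) : (fun p => ((mfun n p : ℝ) : ℂ)).HasTemperateGrowth := 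
  (Complex.ofRealCLM.hasTemperateGrowth).comp (mfun_tg n)

def ft (n : ℕ) : SchwartzMap (Hgrp n) ℂ →L[ℂ] SchwartzMap (Hgrp n) ℂ :=
  (IH n) ∘L (SchwartzMap.smulLeftCLM ℂ (fun p => ((mfun n p : ℝ) : ℂ))) ∘L (FH n)

theorem FH_ft {n : ℕ} (f : SchwartzMap (Hgrp n) ℂ) (w : Pl n) (μ : ℝ) :
    FH n f (hk w μ) = (((1 + μ ^ 2) ^ (n+1))⁻¹ : ℝ) * (rho n (plVec n w) : ℂ) * FH n (ft n f) (hk w μ) := by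
  have h : FH n (ft n f) = SchwartzMap.smulLeftCLM ℂ (fun p => ((mfun n p : ℝ) : ℂ)) (FH n f) := by
    simp only [ft, ContinuousLinearMap.comp_apply]
    exact TF_TI (eH n) (rH n) _
  rw [h, SchwartzMap.smulLeftCLM_apply_apply (mfunC_tg n)]
  have h1 : 0 < 1 + plVec n w ⬝ᵥ plVec n w := by
    have := dot_self_nonneg' (plVec n w)
    linarith
  have h2 : (0:ℝ) < 1 + μ^2 := by positivity
  rw [smul_eq_mul, ← mul_assoc, ← Complex.ofReal_mul, ← Complex.ofReal_mul]
  have : ((1 + μ ^ 2) ^ (n+1))⁻¹ * rho n (plVec n w) * mfun n (hk w μ) = 1 := by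
    simp only [mfun, hk, rho]
    have h3 := h1.ne'
    have h4 := h2.ne'
    field_simp
  rw [this]; simp

theorem Iw_swap {n : ℕ} {A S : Matrix (Idx n) (Idx n) ℂ} {l : List ℂ} (H : Hyp n A S l)
    (f : SchwartzMap (Hgrp n) ℂ) {μ t : ℝ} (ht : 0 ≤ t) (hd : NonSing n S t) :
    Iw n S l f μ t = (((1 + μ ^ 2) ^ (n+1))⁻¹ : ℝ) * ∫ q : Pl n × ℝ, ft n f (hk q.1 q.2) * 
      ∫ w : Pl n, (GammaHat n μ t S l (realVec n (plVec n w)) * (rho n (plVec n w) : ℂ)) *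
        Complex.exp (-(2 * (Real.pi : ℂ) * Complex.I) * ((sg w q.1 - μ * q.2 : ℝ) : ℂ)) := by
  have hGc : Continuous (fun w : Pl n => GammaHat n μ t S l (realVec n (plVec n w)) * (rho n (plVec n w) : ℂ)) := by
    have hp : Continuous (plVec n) := by
      unfold plVec
      refine continuous_pi fun i => ?_
      cases i <;> simp <;> fun_prop
    exact ((GammaHat_cont n μ t S l).comp hp).mul (Complex.continuous_ofReal.comp ((rho_cont n).comp hp))
  have hG : Integrable (fun w : Pl n => GammaHat n μ t S l (realVec n (plVec n w)) * (rho n (plVec n w) : ℂ)) := by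
    rw [integrable_plVec n (fun x => GammaHat n μ t S l (realVec n x) * (rho n x : ℂ))]
    exact (rho_integrable n).ofReal.bdd_mul (GammaHat_cont n μ t S l).aestronglyMeasurable
      (Filter.Eventually.of_forall fun x => GammaHat_norm_le H.hA H.hS H.hpos ht hd μ l x)
  have hc : Continuous (fun z : Pl n × (Pl n × ℝ) => Complex.exp (-(2 * (Real.pi : ℂ) * Complex.I) * ((sg z.1 z.2.1 - μ * z.2.2 : ℝ) : ℂ))) := by
    have := (sg_cont (n := n)).comp (show Continuous (fun z : Pl n × (Pl n × ℝ) => (z.1, z.2.1)) by fun_prop)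
    simp only [Function.comp_def] at this
    fun_prop
  have hI := ((hG.mul_prod (integrable_H (ft n f).integrable)).mul_bdd (c := 1) hc.aestronglyMeasurable
      (Filter.Eventually.of_forall fun q => (norm_exp2 _).le))
  rw [Iw]
  simp_rw [FH_ft f, FH_apply (ft n f)]
  have h1 : ∀ w : Pl n, GammaHat n μ t S l (realVec n (plVec n w)) * ((((1 + μ ^ 2) ^ (n+1))⁻¹ : ℝ) * (rho n (plVec n w) : ℂ) * 
      ∫ q : Pl n × ℝ, ft n f (hk q.1 q.2) *
      Complex.exp (-(2 * (Real.pi : ℂ) * Complex.I) * ((sg w q.1 - μ * q.2 : ℝ) : ℂ)))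
      = (((1 + μ ^ 2) ^ (n+1))⁻¹ : ℝ) * ∫ q : Pl n × ℝ, (GammaHat n μ t S l (realVec n (plVec n w)) * (rho n (plVec n w) : ℂ)) * ft n f (hk q.1 q.2) *
      Complex.exp (-(2 * (Real.pi : ℂ) * Complex.I) * ((sg w q.1 - μ * q.2 : ℝ) : ℂ)) := by
    intro w
    simp_rw [mul_assoc (GammaHat n μ t S l (realVec n (plVec n w)) * (rho n (plVec n w) : ℂ))]
    rw [integral_const_mul]
    ring
  simp_rw [h1]
  rw [integral_const_mul]
  congr 1
  rw [integral_integral_swap hI]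
  refine integral_congr_ae (Filter.Eventually.of_forall fun q => ?_)
  simp only
  rw [← integral_const_mul]
  refine integral_congr_ae (Filter.Eventually.of_forall fun w => ?_)
  simp only
  ring

theorem Iw_bound {n : ℕ} {A S : Matrix (Idx n) (Idx n) ℂ} {l : List ℂ} (H : Hyp n A S l) :
    ∃ C0 > 0, ∀ f : SchwartzMap (Hgrp n) ℂ, ∀ μ : ℝ, μ ≠ 0 → ∀ t > 0, NonSing n S t →
      ‖Iw n S l f μ t‖ ≤ C0 * (((1 + μ ^ 2) ^ (n+1))⁻¹ * Ebd n S μ t) * ∫ p, ‖ft n f p‖ := by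
  obtain ⟨C0, hC0, hW⟩ := W_bound H.hA H.hS H.hpos H.hnr H.hl
  refine ⟨C0, hC0, fun f μ hμ t ht hd => ?_⟩
  rw [Iw_swap H f ht.le hd, norm_mul, Complex.norm_real, Real.norm_of_nonneg (by positivity)]
  rw [show C0 * (((1 + μ ^ 2) ^ (n+1))⁻¹ * Ebd n S μ t) * ∫ p, ‖ft n f p‖ = ((1 + μ ^ 2) ^ (n+1))⁻¹ * (C0 * Ebd n S μ t * ∫ p, ‖ft n f p‖) by ring]
  refine mul_le_mul_of_nonneg_left ?_ (by positivity)
  have hintg : (∫ p, ‖ft n f p‖) = ∫ q : Pl n × ℝ, ‖ft n f (hk q.1 q.2)‖ := by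
    rw [← (assoc_mp n).integral_comp (MeasurableEquiv.prodAssoc.symm.measurableEmbedding) (fun q : Pl n × ℝ => ‖ft n f (hk q.1 q.2)‖)]
    rfl
  rw [hintg, ← integral_const_mul]
  refine norm_integral_le_of_norm_le ((integrable_H (ft n f).integrable).norm.const_mul _) (Filter.Eventually.of_forall fun q => ?_)
  rw [norm_mul, mul_comm]
  refine mul_le_mul_of_nonneg_right ?_ (norm_nonneg _)
  have h2 : ∫ w : Pl n, (GammaHat n μ t S l (realVec n (plVec n w)) * (rho n (plVec n w) : ℂ)) *
        Complex.exp (-(2 * (Real.pi : ℂ) * Complex.I) * ((sg w q.1 - μ * q.2 : ℝ) : ℂ))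
      = (∫ x : Idx n → ℝ, GammaHat n μ t S l (realVec n x) * (rho n x:ℂ) * 
          Complex.exp (((x ⬝ᵥ (-(2 * Real.pi) • (JmatR n *ᵥ plVec n q.1)):ℝ):ℂ)*I)) * Complex.exp (((2 * Real.pi * μ * q.2 : ℝ) : ℂ) * I) := by
    rw [← integral_plVec, ← integral_mul_const]
    refine integral_congr_ae (Filter.Eventually.of_forall fun w => ?_)
    simp only
    rw [mul_assoc _ (cexp _) (cexp _), ← Complex.exp_add]
    congr 2
    rw [dotProduct_smul]
    simp only [sg, sigmaR, smul_eq_mul]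
    push_cast; ring
  rw [h2, norm_mul, norm_expI, mul_one]
  exact hW μ hμ t ht hd _
end part12

section part13
theorem sqrt_int : IntegrableOn (fun s : ℝ => (Real.sqrt s)⁻¹) (Set.Ioc 0 1) := by
  have h := (intervalIntegral.intervalIntegrable_rpow' (a := 0) (b := 1) (r := -(1/2)) (by norm_num)).1
  refine h.congr_fun (fun s hs => ?_) measurableSet_Ioc
  simp only
  rw [Real.rpow_neg hs.1.le, ← Real.sqrt_eq_rpow]

def wa (n : ℕ) (μ : ℝ) : ℝ := |μ|⁻¹ * (((1 + μ ^ 2) ^ (n+1))⁻¹ * (Real.sqrt |μ| * (1 + |μ|) ^ n))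

def wb (c t : ℝ) : ℝ := Real.exp (-(c * t)) * (Real.sqrt (min 1 t))⁻¹

theorem wa_meas (n : ℕ) : Measurable (wa n) := by
  unfold wa; fun_prop

theorem wb_meas (c : ℝ) : Measurable (wb c) := by
  unfold wb; fun_prop

theorem wb_nonneg (c t : ℝ) : 0 ≤ wb c t := by unfold wb; positivity
theorem wa_nonneg (n : ℕ) (t : ℝ) : 0 ≤ wa n t := by unfold wa; positivity

theorem wb_int {c : ℝ} (hc : 0 < c) : IntegrableOn (wb c) (Set.Ioi 0) := by
  rw [← Set.Ioc_union_Ioi_eq_Ioi zero_le_one, integrableOn_union]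
  constructor
  · refine Integrable.mono' sqrt_int (wb_meas c).aestronglyMeasurable ?_
    refine (ae_restrict_iff' measurableSet_Ioc).2 (Filter.Eventually.of_forall fun t ht => ?_)
    rw [Real.norm_of_nonneg (wb_nonneg c t), wb, min_eq_right ht.2]
    refine mul_le_of_le_one_left (by positivity) ?_
    rw [Real.exp_le_one_iff]
    have := mul_pos hc ht.1
    linarith
  · have h := exp_neg_integrableOn_Ioi 1 hc
    refine h.congr_fun (fun t ht => ?_) measurableSet_Ioi
    rw [wb, min_eq_left (le_of_lt ht)]
    simp

theorem wa_le (n : ℕ) {s : ℝ} (hs : 0 < s) : wa n s ≤ 2 ^ n * ((Real.sqrt s)⁻¹ * (1 + s ^ 2)⁻¹) := by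
  have h1 : (1 + s) ^ n ≤ 2 ^ n * (1 + s ^ 2) ^ n := by
    rw [← mul_pow]
    exact pow_le_pow_left₀ (by positivity) (by nlinarith [sq_nonneg (s - 1), sq_nonneg s]) n
  have h2 : s⁻¹ * Real.sqrt s = (Real.sqrt s)⁻¹ := by
    have := Real.mul_self_sqrt hs.le
    have h3 : Real.sqrt s ≠ 0 := (Real.sqrt_pos.2 hs).ne'
    rw [eq_comm, inv_eq_iff_eq_inv]
    field_simp
    nlinarith
  have h3 : (0:ℝ) < 1 + s ^ 2 := by positivity
  rw [wa, abs_of_pos hs]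
  calc s⁻¹ * (((1 + s ^ 2) ^ (n+1))⁻¹ * (Real.sqrt s * (1 + s) ^ n))
      = (Real.sqrt s)⁻¹ * (((1 + s ^ 2) ^ (n+1))⁻¹ * (1 + s) ^ n) := by rw [← h2]; ring
    _ ≤ (Real.sqrt s)⁻¹ * (((1 + s ^ 2) ^ (n+1))⁻¹ * (2 ^ n * (1 + s ^ 2) ^ n)) := by gcongr
    _ = _ := by field_simp; ring

theorem wa_int0 (n : ℕ) : IntegrableOn (wa n) (Set.Ioi 0) := by
  rw [← Set.Ioc_union_Ioi_eq_Ioi zero_le_one, integrableOn_union]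
  constructor
  · refine Integrable.mono' (sqrt_int.const_mul (2 ^ n)) (wa_meas n).aestronglyMeasurable ?_
    refine (ae_restrict_iff' measurableSet_Ioc).2 (Filter.Eventually.of_forall fun t ht => ?_)
    rw [Real.norm_of_nonneg (wa_nonneg n t)]
    refine (wa_le n ht.1).trans ?_
    gcongr
    refine mul_le_of_le_one_right (by positivity) ?_
    apply inv_le_one_of_one_le₀
    nlinarith [sq_nonneg t]
  · refine Integrable.mono' ((integrable_inv_one_add_sq.integrableOn (s := Set.Ioi 1)).const_mul (2 ^ n)) (wa_meas n).aestronglyMeasurable ?_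
    refine (ae_restrict_iff' measurableSet_Ioi).2 (Filter.Eventually.of_forall fun t ht => ?_)
    have ht' : (1:ℝ) < t := ht
    rw [Real.norm_of_nonneg (wa_nonneg n t)]
    refine (wa_le n (by linarith)).trans ?_
    gcongr
    refine mul_le_of_le_one_left (by positivity) ?_
    apply inv_le_one_of_one_le₀
    rw [Real.one_le_sqrt]
    exact ht'.le

theorem wa_int (n : ℕ) : Integrable (wa n) := by
  have h0 := wa_int0 n
  have h1 : IntegrableOn (wa n) (Set.Iio 0) := by
    have := (Measure.measurePreserving_neg (volume : Measure ℝ)).integrableOn_comp_preimage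
      (MeasurableEquiv.neg ℝ).measurableEmbedding (f := wa n) (s := Set.Ioi 0)
    have h2 := this.2 h0
    simp only [Set.neg_preimage, Set.neg_Ioi, neg_zero] at h2
    refine h2.congr_fun (fun t _ => ?_) measurableSet_Iio
    simp [wa]
  have h2 : IntegrableOn (wa n) (Set.Iic 0) := by rwa [integrableOn_Iic_iff_integrableOn_Iio]
  rw [← integrableOn_univ, ← Set.Iic_union_Ioi (a := (0:ℝ))]
  exact h2.union h0

def Dom : Set (ℝ × ℝ) := {p : ℝ × ℝ | p.1 ≠ 0 ∧ 0 < p.2}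

theorem Dom_eq : Dom = {0}ᶜ ×ˢ Set.Ioi 0 := by
  ext p; simp [Dom]

theorem Dom_meas : MeasurableSet Dom := by
  rw [Dom_eq]; exact (measurableSet_singleton _).compl.prod measurableSet_Ioi

theorem Dom_measure : (volume : Measure (ℝ × ℝ)).restrict Dom = (volume : Measure ℝ).prod (volume.restrict (Set.Ioi 0)) := by
  rw [Dom_eq, Measure.volume_eq_prod, ← Measure.prod_restrict]
  congr 1
  exact Measure.restrict_eq_self_of_ae_mem (by simp [ae_iff])

theorem maj_int (n : ℕ) {c : ℝ} (hc : 0 < c) : IntegrableOn (fun p : ℝ × ℝ => wa n p.1 * wb c p.2) Dom := by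
  rw [IntegrableOn, Dom_measure]
  exact (wa_int n).mul_prod (wb_int hc)

theorem ae_nonsing {n : ℕ} (S : Matrix (Idx n) (Idx n) ℂ) : ∀ᵐ p : ℝ × ℝ ∂(volume.restrict Dom), p ∈ Dom ∧ NonSing n S p.2 := by
  have h1 : ∀ᵐ t : ℝ ∂(volume : Measure ℝ), NonSing n S t := (sing_countable S).measure_zero _
  have h2 : ∀ᵐ p : ℝ × ℝ ∂(volume : Measure (ℝ × ℝ)), NonSing n S p.2 :=
    (Measure.quasiMeasurePreserving_snd (μ := (volume : Measure ℝ)) (ν := (volume : Measure ℝ))).ae h1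
  filter_upwards [ae_restrict_of_ae h2, ae_restrict_mem Dom_meas] with p h h' using ⟨h', h⟩

/-! measurability -/
section
open scoped Matrix.Norms.Operator
theorem matCos_cont {n : ℕ} (S : Matrix (Idx n) (Idx n) ℂ) : Continuous (fun t : ℝ => matCos (((2 * Real.pi * t : ℝ) : ℂ) • S)) := by
  have h : Continuous (fun z : ℂ => matCos (z • S)) :=
    continuous_iff_continuousAt.2 fun z => (matCos_hasDerivAt S z).continuousAt
  exact h.comp (by fun_prop : Continuous fun t : ℝ => ((2 * Real.pi * t : ℝ) : ℂ))
theorem matSin_cont {n : ℕ} (S : Matrix (Idx n) (Idx n) ℂ) : Continuous (fun t : ℝ => matSin (((2 * Real.pi * t : ℝ) : ℂ) • S)) := by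
  have h : Continuous (fun z : ℂ => matSin (z • S)) :=
    continuous_iff_continuousAt.2 fun z => (matSin_hasDerivAt S z).continuousAt
  exact h.comp (by fun_prop : Continuous fun t : ℝ => ((2 * Real.pi * t : ℝ) : ℂ))
end

theorem Bt_meas {n : ℕ} (S : Matrix (Idx n) (Idx n) ℂ) (i j : Idx n) : Measurable (fun t : ℝ => Bt n S t i j) := by
  have hc := matCos_cont S
  have hs := matSin_cont S
  have hinv : ∀ a b, Measurable (fun t : ℝ => (matCos (((2 * Real.pi * t : ℝ) : ℂ) • S))⁻¹ a b) := by
    intro a b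
    simp only [Matrix.inv_def, Ring.inverse_eq_inv', Matrix.smul_apply, smul_eq_mul]
    exact (hc.matrix_det.measurable.inv).mul (hc.matrix_adjugate.matrix_elem a b).measurable
  unfold Bt matTan
  simp only [Matrix.mul_apply]
  refine Finset.measurable_sum _ fun k _ => measurable_const.mul ?_
  refine Finset.measurable_sum _ fun k' _ => ?_
  exact (hs.matrix_elem k k').measurable.mul (hinv k' j)

theorem Iw_meas (n : ℕ) (S : Matrix (Idx n) (Idx n) ℂ) (l : List ℂ) (f : SchwartzMap (Hgrp n) ℂ) :
    StronglyMeasurable (fun p : ℝ × ℝ => Iw n S l f p.1 p.2) := by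
  unfold Iw
  have hg : Measurable (fun z : (ℝ × ℝ) × Pl n => GammaHat n z.1.1 (z.1.2 : ℝ) S l (realVec n (plVec n z.2))) := by
    simp only [GammaHat_eq, realVec, dotProduct, Matrix.mulVec]
    have hs : Measurable (fun z : (ℝ × ℝ) × Pl n => (sqrtDetCos ((z.1.2 : ℝ) : ℂ) l)⁻¹) := by
      unfold sqrtDetCos; fun_prop
    have hv : ∀ i, Measurable (fun z : (ℝ × ℝ) × Pl n => ((plVec n z.2 i : ℝ) : ℂ)) := by
      intro i; cases i <;> simp [plVec] <;> fun_prop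
    have hb : ∀ i j, Measurable (fun z : (ℝ × ℝ) × Pl n => Bt n S z.1.2 i j) := fun i j =>
      (Bt_meas S i j).comp (by fun_prop)
    fun_prop
  have hf : Measurable (fun z : (ℝ × ℝ) × Pl n => FH n f (hk z.2 z.1.1)) := by
    have : Continuous (fun z : (ℝ × ℝ) × Pl n => (hk z.2 z.1.1 : Hgrp n)) := by unfold hk; fun_prop
    exact ((FH n f).continuous.comp this).measurable
  exact (hg.mul hf).stronglyMeasurable.integral_prod_right (f := fun (p : ℝ × ℝ) (w : Pl n) => GammaHat n p.1 (p.2 : ℝ) S l (realVec n (plVec n w)) * FH n f (hk w p.1))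

def Kint (n : ℕ) (S : Matrix (Idx n) (Idx n) ℂ) (l : List ℂ) (α : ℂ) (f : SchwartzMap (Hgrp n) ℂ) (p : ℝ × ℝ) : ℂ :=
  Complex.exp (-(2 * (Real.pi : ℂ) * α * (p.2 : ℂ) * ((Real.sign p.1 : ℝ) : ℂ))) * Iw n S l f p.1 p.2 / ((|p.1| : ℝ) : ℂ)

theorem norm_expα (α : ℂ) (μ : ℝ) {t : ℝ} (ht : 0 ≤ t) :
    ‖Complex.exp (-(2 * (Real.pi : ℂ) * α * (t : ℂ) * ((Real.sign μ : ℝ) : ℂ)))‖ ≤ Real.exp (2 * Real.pi * |α.re| * t) := by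
  rw [Complex.norm_exp, Real.exp_le_exp]
  have : (-(2 * (Real.pi : ℂ) * α * (t : ℂ) * ((Real.sign μ : ℝ) : ℂ))).re = -(2 * Real.pi * t * (α.re * Real.sign μ)) := by
    rw [show -(2 * (Real.pi : ℂ) * α * (t : ℂ) * ((Real.sign μ : ℝ) : ℂ)) = ((-(2 * Real.pi * t * Real.sign μ) : ℝ) : ℂ) * α by push_cast; ring,
      Complex.re_ofReal_mul]
    ring
  rw [this]
  have h2 : -|α.re| ≤ α.re * Real.sign μ := by
    rcases Real.sign_apply_eq μ with h | h | h <;> rw [h] <;> [skip; skip; skip] <;>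
      nlinarith [neg_abs_le α.re, le_abs_self α.re, abs_nonneg α.re]
  have h3 : 0 ≤ 2 * Real.pi * t := by positivity
  nlinarith [mul_le_mul_of_nonneg_left h2 h3]

theorem Kint_meas (n : ℕ) (S : Matrix (Idx n) (Idx n) ℂ) (l : List ℂ) (α : ℂ) (f : SchwartzMap (Hgrp n) ℂ) :
    Measurable (Kint n S l α f) := by
  unfold Kint
  have hs : Measurable Real.sign := by
    unfold Real.sign
    exact Measurable.ite (measurableSet_Iio) measurable_const (Measurable.ite (measurableSet_Ioi) measurable_const measurable_const)
  have := (Iw_meas n S l f).measurable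
  fun_prop

theorem Kint_bound {n : ℕ} {A S : Matrix (Idx n) (Idx n) ℂ} {l : List ℂ} (H : Hyp n A S l) (α : ℂ) :
    ∃ C0 > 0, ∀ f : SchwartzMap (Hgrp n) ℂ, ∀ p ∈ Dom, NonSing n S p.2 →
      ‖Kint n S l α f p‖ ≤ (C0 * ∫ q, ‖ft n f q‖) * (wa n p.1 * wb (2 * Real.pi * (nuTotal n S - |α.re|)) p.2) := by
  obtain ⟨C0, hC0, h⟩ := Iw_bound H
  refine ⟨C0, hC0, fun f p hp hd => ?_⟩
  have h1 := h f p.1 hp.1 p.2 hp.2 hd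
  rw [Kint, norm_div, norm_mul, Complex.norm_real, Real.norm_eq_abs, abs_abs]
  calc _ ≤ Real.exp (2 * Real.pi * |α.re| * p.2) * (C0 * (((1 + p.1 ^ 2) ^ (n+1))⁻¹ * Ebd n S p.1 p.2) * ∫ p, ‖ft n f p‖) / |p.1| := by
        gcongr
        exact norm_expα α p.1 hp.2.le
    _ = _ := by
      rw [Ebd, wa, wb, show -(2 * Real.pi * (nuTotal n S - |α.re|) * p.2) = 2 * Real.pi * |α.re| * p.2 + -(2 * Real.pi * nuTotal n S * p.2) by ring, Real.exp_add]
      field_simp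

theorem Kint_int {n : ℕ} {A S : Matrix (Idx n) (Idx n) ℂ} {l : List ℂ} (H : Hyp n A S l) (α : ℂ) (hα : |α.re| < nuTotal n S)
    (f : SchwartzMap (Hgrp n) ℂ) : IntegrableOn (Kint n S l α f) Dom := by
  obtain ⟨C0, hC0, h⟩ := Kint_bound H α
  have hc : 0 < 2 * Real.pi * (nuTotal n S - |α.re|) := by
    have := Real.pi_pos
    have : 0 < nuTotal n S - |α.re| := by linarith
    positivity
  refine Integrable.mono' ((maj_int n hc).const_mul (C0 * ∫ q, ‖ft n f q‖)) (Kint_meas n S l α f).aestronglyMeasurable ?_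
  filter_upwards [ae_nonsing S] with p hp using h f p hp.1 hp.2
end part13

section part14
theorem plVec_cont (n : ℕ) : Continuous (plVec n) := by
  unfold plVec
  refine continuous_pi fun i => ?_
  cases i <;> simp <;> fun_prop

/-- slicing a Schwartz function on the group at a fixed last coordinate -/
def sliceMap (n : ℕ) (μ : ℝ) : SchwartzMap (Hgrp n) ℂ →L[ℂ] SchwartzMap (Pl n) ℂ :=
  SchwartzMap.compCLMOfAntilipschitz ℂ (K := 1) (g := fun w : Pl n => (hk w μ : Hgrp n))
    (by
      have h : (fun w : Pl n => (hk w μ : Hgrp n)) = fun w => 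
          ((ContinuousLinearMap.fst ℝ (Fin n → ℝ) (Fin n → ℝ)).prod ((ContinuousLinearMap.snd ℝ (Fin n → ℝ) (Fin n → ℝ)).prod 0)) w + ((0, 0, μ) : Hgrp n) := by
        ext w <;> simp [hk]
      rw [h]
      exact (ContinuousLinearMap.hasTemperateGrowth _).add (Function.HasTemperateGrowth.const _))
    (by
      refine AntilipschitzWith.of_le_mul_dist fun v w => ?_
      simp only [hk, Prod.dist_eq, NNReal.coe_one, one_mul]
      simp)

@[simp] theorem sliceMap_apply (n : ℕ) (μ : ℝ) (f : SchwartzMap (Hgrp n) ℂ) (w : Pl n) : sliceMap n μ f w = f (hk w μ) := rfl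

theorem G_int {n : ℕ} {A S : Matrix (Idx n) (Idx n) ℂ} {l : List ℂ} (H : Hyp n A S l)
    {t : ℝ} (μ : ℝ) (ht : 0 ≤ t) (hd : NonSing n S t) (g : SchwartzMap (Pl n) ℂ) :
    Integrable (fun w : Pl n => GammaHat n μ t S l (realVec n (plVec n w)) * g w) :=
  g.integrable.bdd_mul ((GammaHat_cont n μ t S l).comp (plVec_cont n)).aestronglyMeasurable
      (Filter.Eventually.of_forall fun x => GammaHat_norm_le H.hA H.hS H.hpos ht hd μ l _)

theorem Iw_add {n : ℕ} {A S : Matrix (Idx n) (Idx n) ℂ} {l : List ℂ} (H : Hyp n A S l)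
    {t : ℝ} (μ : ℝ) (ht : 0 ≤ t) (hd : NonSing n S t) (f g : SchwartzMap (Hgrp n) ℂ) :
    Iw n S l (f + g) μ t = Iw n S l f μ t + Iw n S l g μ t := by
  unfold Iw
  refine Eq.trans ?_ (integral_add (G_int H μ ht hd (sliceMap n μ (FH n f))) (G_int H μ ht hd (sliceMap n μ (FH n g))))
  refine integral_congr_ae (Filter.Eventually.of_forall fun w => ?_)
  simp [mul_add]

theorem Iw_smul {n : ℕ} (S : Matrix (Idx n) (Idx n) ℂ) (l : List ℂ) 
    (t : ℝ) (μ : ℝ) (c : ℂ) (f : SchwartzMap (Hgrp n) ℂ) :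
    Iw n S l (c • f) μ t = c * Iw n S l f μ t := by
  unfold Iw
  rw [← integral_const_mul]
  refine integral_congr_ae (Filter.Eventually.of_forall fun w => ?_)
  simp only [map_smul, SchwartzMap.smul_apply, smul_eq_mul]
  ring

def Klin {n : ℕ} {A S : Matrix (Idx n) (Idx n) ℂ} {l : List ℂ} (H : Hyp n A S l) (α : ℂ) (hα : |α.re| < nuTotal n S) :
    SchwartzMap (Hgrp n) ℂ →ₗ[ℂ] ℂ where
  toFun f := -∫ p in Dom, Kint n S l α f p
  map_add' f g := by
    rw [← neg_add, ← integral_add (Kint_int H α hα f) (Kint_int H α hα g)]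
    congr 1
    refine integral_congr_ae ?_
    filter_upwards [ae_nonsing S] with p hp
    simp only [Kint]
    rw [Iw_add H _ hp.1.2.le hp.2]
    ring
  map_smul' c f := by
    simp only [RingHom.id_apply, smul_eq_mul, mul_neg]
    rw [← integral_const_mul]
    congr 1
    refine integral_congr_ae (Filter.Eventually.of_forall fun p => ?_)
    simp only [Kint, Iw_smul]
    ring

def KK {n : ℕ} {A S : Matrix (Idx n) (Idx n) ℂ} {l : List ℂ} (H : Hyp n A S l) (α : ℂ) (hα : |α.re| < nuTotal n S) :
    SchwartzMap (Hgrp n) ℂ →L[ℂ] ℂ where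
  toLinearMap := Klin H α hα
  cont := by
    obtain ⟨C0, hC0, h⟩ := Kint_bound H α
    have hc : 0 < 2 * Real.pi * (nuTotal n S - |α.re|) := by
      have := Real.pi_pos
      have : 0 < nuTotal n S - |α.re| := by linarith
      positivity
    set M := ∫ p in Dom, (wa n p.1 * wb (2 * Real.pi * (nuTotal n S - |α.re|)) p.2)
    have hb : ∀ f, ‖Klin H α hα f‖ ≤ (C0 * M) * ‖SchwartzMap.toLpCLM ℂ ℂ 1 volume (ft n f)‖ := by
      intro f
      have e1 : ‖SchwartzMap.toLpCLM ℂ ℂ 1 volume (ft n f)‖ = ∫ q, ‖ft n f q‖ := by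
        rw [L1.norm_eq_integral_norm]
        refine integral_congr_ae ?_
        filter_upwards [(ft n f).coeFn_toLp 1 volume] with q hq
        rw [SchwartzMap.toLpCLM_apply, hq]
      rw [e1]
      show ‖-∫ p in Dom, Kint n S l α f p‖ ≤ _
      rw [norm_neg, show C0 * M * (∫ q, ‖ft n f q‖) = (C0 * ∫ q, ‖ft n f q‖) * M by ring, ← integral_const_mul]
      refine norm_integral_le_of_norm_le ((maj_int n hc).const_mul _) ?_
      filter_upwards [ae_nonsing S] with p hp using h f p hp.1 hp.2
    show Continuous (Klin H α hα)
    refine continuous_of_continuousAt_zero (Klin H α hα) ?_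
    rw [ContinuousAt, map_zero]
    refine squeeze_zero_norm hb ?_
    have : Continuous (fun f => (C0 * M) * ‖SchwartzMap.toLpCLM ℂ ℂ 1 volume (ft n f)‖) := by fun_prop
    have h0 := this.tendsto 0
    rw [map_zero, map_zero, norm_zero, mul_zero] at h0
    exact h0

theorem KK_apply {n : ℕ} {A S : Matrix (Idx n) (Idx n) ℂ} {l : List ℂ} (H : Hyp n A S l) (α : ℂ) (hα : |α.re| < nuTotal n S)
    (f : SchwartzMap (Hgrp n) ℂ) : KK H α hα f = -∫ p in Dom, Kint n S l α f p := rfl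

/-- property of the kernel used -/
def GamFT (n : ℕ) (S : Matrix (Idx n) (Idx n) ℂ) (l : List ℂ) (Γ : ℝ → ℝ → SchwartzMap (Pl n) ℂ →L[ℂ] ℂ) : Prop :=
  ∀ μ : ℝ, μ ≠ 0 → ∀ t : ℝ, 0 ≤ t →
        (matCos (((2 * Real.pi * t : ℝ) : ℂ) • S)).det ≠ 0 →
        ∀ g h : SchwartzMap (Pl n) ℂ,
          (∀ w : Pl n, h w = ∫ v : Pl n, g v *
              Complex.exp (-(2 * (Real.pi : ℂ) * Complex.I) *
                ((sigmaR n (plVec n w) (plVec n v) : ℝ) : ℂ))) →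
          Γ μ t h = ∫ w : Pl n, GammaHat n μ (t : ℂ) S l (realVec n (plVec n w)) * g w

theorem Gam_eq {n : ℕ} {S : Matrix (Idx n) (Idx n) ℂ} {l : List ℂ} {Γ : ℝ → ℝ → SchwartzMap (Pl n) ℂ →L[ℂ] ℂ}
    (hG : GamFT n S l Γ) {μ : ℝ} (hμ : μ ≠ 0) {t : ℝ} (ht : 0 ≤ t) (hd : NonSing n S t) (g : SchwartzMap (Pl n) ℂ) :
    Γ μ t (FP n g) = ∫ w : Pl n, GammaHat n μ (t : ℂ) S l (realVec n (plVec n w)) * g w :=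
  hG μ hμ t ht hd g _ (fun w => FP_apply g w)

theorem part1 {n : ℕ} {A S : Matrix (Idx n) (Idx n) ℂ} {l : List ℂ} (H : Hyp n A S l) (α : ℂ) (hα : |α.re| < nuTotal n S)
    {Γ : ℝ → ℝ → SchwartzMap (Pl n) ℂ →L[ℂ] ℂ} (hG : GamFT n S l Γ)
    (f : SchwartzMap (Hgrp n) ℂ) (F : ℝ → SchwartzMap (Pl n) ℂ)
    (hF : ∀ μ : ℝ, ∀ v : Pl n, F μ v =
            ∫ u : ℝ, f (v.1, v.2, u) *
              Complex.exp (2 * (Real.pi : ℂ) * Complex.I * (μ : ℂ) * (u : ℂ))) :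
    (fun p : ℝ × ℝ =>
            Complex.exp (-(2 * (Real.pi : ℂ) * α * (p.2 : ℂ) * ((Real.sign p.1 : ℝ) : ℂ))) *
              Γ p.1 p.2 (F p.1) / ((|p.1| : ℝ) : ℂ)) =ᵐ[volume.restrict Dom] Kint n S l α f := by
  filter_upwards [ae_nonsing S] with p hp
  rw [Kint]
  congr 2
  have h1 : F p.1 = FP n (sliceMap n p.1 (FH n f)) := by
    have : FP n (F p.1) = sliceMap n p.1 (FH n f) := by
      ext w
      rw [slice f p.1 (F p.1) (hF p.1) w]; rfl
    rw [← this, FP_invol]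
  rw [h1, Gam_eq hG hp.1.1 hp.1.2.le hp.2]
  rfl
end part14

section part15
open scoped LineDeriv

section
variable {E : Type} [NormedAddCommGroup E] [NormedSpace ℝ E]
/-- multiplication of a Schwartz function by a real-linear function -/
def mulL (ℓ : E →L[ℝ] ℂ) : SchwartzMap E ℂ →L[ℂ] SchwartzMap E ℂ := SchwartzMap.smulLeftCLM ℂ (ℓ : E → ℂ)

@[simp] theorem mulL_apply (ℓ : E →L[ℝ] ℂ) (f : SchwartzMap E ℂ) (x : E) : mulL ℓ f x = ℓ x * f x := by
  rw [mulL, SchwartzMap.smulLeftCLM_apply_apply ℓ.hasTemperateGrowth, smul_eq_mul]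

theorem deriv_mulL (ℓ : E →L[ℝ] ℂ) (f : SchwartzMap E ℂ) (m : E) :
    ∂_{m} (mulL ℓ f) = ℓ m • f + mulL ℓ (∂_{m} f) := by
  ext x
  rw [SchwartzMap.add_apply, SchwartzMap.smul_apply, mulL_apply, SchwartzMap.lineDerivOp_apply_eq_fderiv, SchwartzMap.lineDerivOp_apply_eq_fderiv]
  have h : (⇑(mulL ℓ f) : E → ℂ) = fun x => ℓ x * f x := by ext x; simp
  rw [h, fderiv_fun_mul (ℓ.differentiableAt) (f.differentiableAt)]
  simp [mul_comm]; ring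
end

/-- coordinate vectors -/
def bP {n : ℕ} : Idx n → Pl n
  | Sum.inl j => (Pi.single j 1, 0)
  | Sum.inr j => (0, Pi.single j 1)

def lin {n : ℕ} (v : Idx n → ℂ) : Pl n →L[ℝ] ℂ :=
  ∑ j, (v (Sum.inl j) • (Complex.ofRealCLM ∘L (ContinuousLinearMap.proj (R := ℝ) (φ := fun _ : Fin n => ℝ) j) ∘L (ContinuousLinearMap.fst ℝ (Fin n → ℝ) (Fin n → ℝ)))
    + v (Sum.inr j) • (Complex.ofRealCLM ∘L (ContinuousLinearMap.proj (R := ℝ) (φ := fun _ : Fin n => ℝ) j) ∘L (ContinuousLinearMap.snd ℝ (Fin n → ℝ) (Fin n → ℝ))))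

theorem lin_apply {n : ℕ} (v : Idx n → ℂ) (w : Pl n) : lin v w = v ⬝ᵥ realVec n (plVec n w) := by
  simp [lin, dotProduct, realVec, plVec, Finset.sum_add_distrib]

theorem lin_bP {n : ℕ} (v : Idx n → ℂ) (k : Idx n) : lin v (bP k) = v k := by
  rw [lin_apply]
  cases k with
  | inl j => simp [bP, realVec, plVec, dotProduct, Pi.single_apply, apply_ite Complex.ofReal]
  | inr j => simp [bP, realVec, plVec, dotProduct, Pi.single_apply, apply_ite Complex.ofReal]

def Ds (n : ℕ) (μ : ℝ) (k : Idx n) (g : SchwartzMap (Pl n) ℂ) : SchwartzMap (Pl n) ℂ :=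
  -((μ : ℂ) / 2) • ∂_{bP k} g - (2 * (Real.pi : ℂ) * I) • mulL (lin (Jmat n k)) g

def xc {n : ℕ} (j : Fin n) : Hgrp n →L[ℝ] ℂ := Complex.ofRealCLM ∘L (ContinuousLinearMap.proj (R := ℝ) (φ := fun _ : Fin n => ℝ) j) ∘L (ContinuousLinearMap.fst ℝ (Fin n → ℝ) ((Fin n → ℝ) × ℝ))
def yc {n : ℕ} (j : Fin n) : Hgrp n →L[ℝ] ℂ := Complex.ofRealCLM ∘L (ContinuousLinearMap.proj (R := ℝ) (φ := fun _ : Fin n => ℝ) j) ∘L (ContinuousLinearMap.fst ℝ (Fin n → ℝ) ℝ) ∘L (ContinuousLinearMap.snd ℝ (Fin n → ℝ) ((Fin n → ℝ) × ℝ))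

theorem xc_apply {n : ℕ} (j : Fin n) (p : Hgrp n) : xc j p = (p.1 j : ℂ) := rfl
theorem yc_apply {n : ℕ} (j : Fin n) (p : Hgrp n) : yc j p = (p.2.1 j : ℂ) := rfl

def dU {n : ℕ} (f : SchwartzMap (Hgrp n) ℂ) : SchwartzMap (Hgrp n) ℂ := ∂_{((0, 0, 1) : Hgrp n)} f

def Vs {n : ℕ} : Idx n → SchwartzMap (Hgrp n) ℂ → SchwartzMap (Hgrp n) ℂ
  | Sum.inl j => fun f => ∂_{((Pi.single j 1, 0, 0) : Hgrp n)} f - (2 : ℂ)⁻¹ • mulL (yc j) (dU f)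
  | Sum.inr j => fun f => ∂_{((0, Pi.single j 1, 0) : Hgrp n)} f + (2 : ℂ)⁻¹ • mulL (xc j) (dU f)

theorem Vs_coe {n : ℕ} (k : Idx n) (f : SchwartzMap (Hgrp n) ℂ) : ⇑(Vs k f) = Vop n k ⇑f := by
  cases k with
  | inl j =>
    ext p
    simp only [Vs, Vop, Xop, dU, SchwartzMap.sub_apply, SchwartzMap.smul_apply, mulL_apply, SchwartzMap.lineDerivOp_apply_eq_fderiv, yc_apply, smul_eq_mul]
    ring
  | inr j =>
    ext p
    simp only [Vs, Vop, Yop, dU, SchwartzMap.add_apply, SchwartzMap.smul_apply, mulL_apply, SchwartzMap.lineDerivOp_apply_eq_fderiv, xc_apply, smul_eq_mul]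
    ring

theorem slice_dU {n : ℕ} (μ : ℝ) (f : SchwartzMap (Hgrp n) ℂ) :
    sliceMap n μ (FH n (dU f)) = (-(2 * (Real.pi : ℂ) * I * μ)) • sliceMap n μ (FH n f) := by
  ext w
  rw [sliceMap_apply, SchwartzMap.smul_apply, sliceMap_apply, dU, TF_deriv, inner_H, sigmaR_eq]
  simp [hk]

theorem slice_deriv {n : ℕ} (μ : ℝ) (f : SchwartzMap (Hgrp n) ℂ) (m : Pl n) (w : Pl n) :
    (∂_{((m.1, m.2, 0) : Hgrp n)} f) (hk w μ) = (∂_{m} (sliceMap n μ f)) w := by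
  rw [SchwartzMap.lineDerivOp_apply_eq_fderiv, SchwartzMap.lineDerivOp_apply_eq_fderiv]
  have h : (⇑(sliceMap n μ f) : Pl n → ℂ) = fun w => f (hk w μ) := rfl
  have hd : HasFDerivAt (fun w : Pl n => (hk w μ : Hgrp n)) ((ContinuousLinearMap.fst ℝ (Fin n → ℝ) (Fin n → ℝ)).prod ((ContinuousLinearMap.snd ℝ (Fin n → ℝ) (Fin n → ℝ)).prod 0)) w := by
    unfold hk
    exact (hasFDerivAt_fst).prodMk ((hasFDerivAt_snd).prodMk (hasFDerivAt_const μ w))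
  have h2 := (f.differentiableAt (x := hk w μ)).hasFDerivAt.comp w hd
  rw [h]
  have h3 : HasFDerivAt (fun w => f (hk w μ)) _ w := h2
  rw [h3.fderiv]
  simp

theorem slice_Vs {n : ℕ} (μ : ℝ) (k : Idx n) (f : SchwartzMap (Hgrp n) ℂ) :
    sliceMap n μ (FH n (Vs k f)) = Ds n μ k (sliceMap n μ (FH n f)) := by
  have hpi : (2 * (Real.pi : ℂ) * Complex.I) ≠ 0 := by simp [Real.pi_ne_zero]
  ext w
  cases k with
  | inl j =>
    have e1 : FH n (mulL (yc j) (dU f)) (hk w μ) = -(2 * (Real.pi : ℂ) * Complex.I)⁻¹ * (∂_{((Pi.single j 1, 0, 0) : Hgrp n)} (FH n (dU f))) (hk w μ) := by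
      apply TF_mul
      intro v
      rw [mulL_apply, yc_apply, inner_H, sigmaR_eq]
      simp [Pi.single_apply]
    have e2 := slice_deriv μ (FH n (dU f)) (bP (Sum.inl j)) w
    simp only [bP] at e2
    have e3 : lin (Jmat n (Sum.inl j)) w = (w.2 j : ℂ) := by
      rw [lin_apply]
      simp [dotProduct, Jmat, Matrix.one_apply, realVec, plVec]
    have e4 : FH n (∂_{((Pi.single j 1, 0, 0) : Hgrp n)} f) (hk w μ) = -(2 * (Real.pi : ℂ) * Complex.I) * (w.2 j : ℂ) * FH n f (hk w μ) := by
      rw [TF_deriv, inner_H, sigmaR_eq]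
      simp [Pi.single_apply, hk]
    rw [sliceMap_apply, Vs, Ds, map_sub, map_smul, SchwartzMap.sub_apply, SchwartzMap.smul_apply, e1, e2, e4, slice_dU, LineDeriv.lineDerivOp_smul]
    simp only [SchwartzMap.sub_apply, SchwartzMap.smul_apply, mulL_apply, e3, sliceMap_apply, smul_eq_mul, bP]
    field_simp
    ring
  | inr j =>
    have e1 : FH n (mulL (xc j) (dU f)) (hk w μ) = -(2 * (Real.pi : ℂ) * Complex.I)⁻¹ * (∂_{-((0, Pi.single j 1, 0) : Hgrp n)} (FH n (dU f))) (hk w μ) := by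
      apply TF_mul
      intro v
      rw [mulL_apply, xc_apply, inner_H, sigmaR_eq]
      simp [Pi.single_apply]
    have e2 := slice_deriv μ (FH n (dU f)) (bP (Sum.inr j)) w
    simp only [bP] at e2
    have e3 : lin (Jmat n (Sum.inr j)) w = -(w.1 j : ℂ) := by
      rw [lin_apply]
      simp [dotProduct, Jmat, Matrix.one_apply, realVec, plVec]
    have e4 : FH n (∂_{((0, Pi.single j 1, 0) : Hgrp n)} f) (hk w μ) = (2 * (Real.pi : ℂ) * Complex.I) * (w.1 j : ℂ) * FH n f (hk w μ) := by
      rw [TF_deriv, inner_H, sigmaR_eq]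
      simp [Pi.single_apply, hk]
    rw [sliceMap_apply, Vs, Ds, map_add, map_smul, SchwartzMap.add_apply, SchwartzMap.smul_apply, e1, LineDeriv.lineDerivOp_left_neg, SchwartzMap.neg_apply, e2, e4, slice_dU, LineDeriv.lineDerivOp_smul]
    simp only [SchwartzMap.sub_apply, SchwartzMap.smul_apply, mulL_apply, e3, sliceMap_apply, smul_eq_mul, bP]
    field_simp
    ring

theorem slice_L {n : ℕ} (A : Matrix (Idx n) (Idx n) ℂ) (α : ℂ) (φ ψ : SchwartzMap (Hgrp n) ℂ) (h : ⇑ψ = Lop n A (-α) ⇑φ) (μ : ℝ) :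
    sliceMap n μ (FH n ψ) = (∑ j, ∑ k, A j k • Ds n μ j (Ds n μ k (sliceMap n μ (FH n φ)))) - (2 * (Real.pi : ℂ) * α * μ) • sliceMap n μ (FH n φ) := by
  have h1 : ψ = (∑ j, ∑ k, A j k • Vs j (Vs k φ)) + (-(I * α)) • dU φ := by
    ext p
    rw [h]
    simp only [Lop, SchwartzMap.add_apply, SchwartzMap.sum_apply, SchwartzMap.smul_apply, Vs_coe, smul_eq_mul, Uop, dU, SchwartzMap.lineDerivOp_apply_eq_fderiv]
    ring
  rw [h1]
  simp only [map_add, map_sum, map_smul, slice_Vs, slice_dU]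
  rw [smul_smul, sub_eq_add_neg, ← neg_smul]
  congr 2
  linear_combination (-2 * (Real.pi:ℂ) * α * μ) * Complex.I_sq * (-1)
end part15

section part16
open scoped LineDeriv

section
variable {n : ℕ}

/-- the complexified position vector -/
abbrev xv (w : Pl n) : Idx n → ℂ := realVec n (plVec n w)

theorem lin_single (i : Idx n) (w : Pl n) : lin (Pi.single i 1) w = xv w i := by
  rw [lin_apply]; simp

theorem quad_fderiv (B : Matrix (Idx n) (Idx n) ℂ) (hB : Bᵀ = B) (w : Pl n) :
    ∃ Q : Pl n →L[ℝ] ℂ, HasFDerivAt (fun w : Pl n => xv w ⬝ᵥ (B *ᵥ xv w)) Q w ∧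
      ∀ k, Q (bP k) = 2 * lin (B k) w := by
  have h : (fun w : Pl n => xv w ⬝ᵥ (B *ᵥ xv w)) = fun w => ∑ i, lin (Pi.single i 1) w * lin (B i) w := by
    ext w
    simp only [dotProduct, lin_single]
    refine Finset.sum_congr rfl fun i _ => ?_
    rw [lin_apply]; rfl
  rw [h]
  refine ⟨_, HasFDerivAt.fun_sum (fun i _ => ((lin (Pi.single i 1)).hasFDerivAt).mul ((lin (B i)).hasFDerivAt)), fun k => ?_⟩
  simp only [ContinuousLinearMap.sum_apply, ContinuousLinearMap.add_apply, ContinuousLinearMap.smul_apply, lin_bP, lin_single, smul_eq_mul, Finset.sum_add_distrib]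
  have e1 : ∑ x, xv w x * B x k = lin (B k) w := by
    rw [lin_apply, dotProduct]
    refine Finset.sum_congr rfl fun i _ => ?_
    rw [mul_comm, ← Matrix.transpose_apply B, hB]
  have e2 : ∑ x, lin (B x) w * (Pi.single x 1 : Idx n → ℂ) k = lin (B k) w := by
    simp [Pi.single_apply]
  rw [e1, e2]; ring

variable {A S : Matrix (Idx n) (Idx n) ℂ} {l : List ℂ}

/-- the multiplier as a function on the plane -/
def Gf (n : ℕ) (S : Matrix (Idx n) (Idx n) ℂ) (l : List ℂ) (μ t : ℝ) (w : Pl n) : ℂ := GammaHat n μ t S l (xv w)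

theorem Gf_fderiv (H : Hyp n A S l) {t : ℝ} (μ : ℝ) (hd : NonSing n S t) (w : Pl n) :
    DifferentiableAt ℝ (Gf n S l μ t) w ∧ ∀ k, fderiv ℝ (Gf n S l μ t) w (bP k) =
      Gf n S l μ t w * ((-(2 * (2 * Real.pi / |μ| : ℝ) : ℂ)) * lin (Bt n S t k) w) := by
  obtain ⟨Q, hQ, hk⟩ := quad_fderiv (Bt n S t) (Bt_symm H.hA H.hS hd) w
  have h0 := ((hQ.const_mul (-((2 * Real.pi / |μ| : ℝ) : ℂ))).cexp).const_mul (sqrtDetCos t l)⁻¹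
  have h1 : (fun w => (sqrtDetCos t l)⁻¹ * Complex.exp (-((2 * Real.pi / |μ| : ℝ) : ℂ) * (xv w ⬝ᵥ (Bt n S t *ᵥ xv w)))) = Gf n S l μ t := by
    ext w; rw [Gf, GammaHat_eq]
  have h := h0
  rw [h1] at h
  refine ⟨h.differentiableAt, fun k => ?_⟩
  rw [h.fderiv]
  simp only [ContinuousLinearMap.smul_apply, hk, smul_eq_mul]
  rw [Gf, GammaHat_eq]
  ring

/-- the pairing -/
def IG (n : ℕ) (S : Matrix (Idx n) (Idx n) ℂ) (l : List ℂ) (μ t : ℝ) (g : SchwartzMap (Pl n) ℂ) : ℂ := ∫ w, Gf n S l μ t w * g w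

theorem Gf_int (H : Hyp n A S l) {t : ℝ} (μ : ℝ) (ht : 0 ≤ t) (hd : NonSing n S t) (g : SchwartzMap (Pl n) ℂ) :
    Integrable (fun w : Pl n => Gf n S l μ t w * g w) := G_int H μ ht hd g

theorem IG_add (H : Hyp n A S l) {t : ℝ} (μ : ℝ) (ht : 0 ≤ t) (hd : NonSing n S t) (f g : SchwartzMap (Pl n) ℂ) :
    IG n S l μ t (f + g) = IG n S l μ t f + IG n S l μ t g := by
  unfold IG
  rw [← integral_add (Gf_int H μ ht hd f) (Gf_int H μ ht hd g)]
  simp [mul_add]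

theorem IG_smul (t μ : ℝ) (c : ℂ) (g : SchwartzMap (Pl n) ℂ) :
    IG n S l μ t (c • g) = c * IG n S l μ t g := by
  unfold IG
  rw [← integral_const_mul]
  refine integral_congr_ae (Filter.Eventually.of_forall fun w => ?_)
  simp only [SchwartzMap.smul_apply, smul_eq_mul]
  ring

def IGl (H : Hyp n A S l) {t : ℝ} (μ : ℝ) (ht : 0 ≤ t) (hd : NonSing n S t) : SchwartzMap (Pl n) ℂ →ₗ[ℂ] ℂ where
  toFun := IG n S l μ t
  map_add' := IG_add H μ ht hd
  map_smul' c g := by rw [IG_smul]; rfl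

theorem ibp (H : Hyp n A S l) {t : ℝ} (μ : ℝ) (ht : 0 ≤ t) (hd : NonSing n S t) (k : Idx n) (g : SchwartzMap (Pl n) ℂ) :
    IGl H μ ht hd (∂_{bP k} g) = (2 * (2 * Real.pi / |μ| : ℝ) : ℂ) * IGl H μ ht hd (mulL (lin (Bt n S t k)) g) := by
  have key := integral_mul_fderiv_eq_neg_fderiv_mul_of_integrable (μ := (volume : Measure (Pl n))) (f := Gf n S l μ t) (g := ⇑g) (v := bP k) ?_ ?_ (Gf_int H μ ht hd g)
    (fun x _ => (Gf_fderiv H μ hd x).1) (fun x _ => g.differentiableAt)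
  · show ∫ w, _ = _ * ∫ w, _
    simp only [SchwartzMap.lineDerivOp_apply_eq_fderiv, mulL_apply]
    rw [key, ← integral_neg, ← integral_const_mul]
    refine integral_congr_ae (Filter.Eventually.of_forall fun w => ?_)
    simp only [(Gf_fderiv H μ hd w).2]
    ring
  · have := (Gf_int H μ ht hd (mulL (lin (Bt n S t k)) g)).const_mul (-(2 * (2 * Real.pi / |μ| : ℝ) : ℂ))
    refine this.congr (Filter.Eventually.of_forall fun w => ?_)
    simp only [(Gf_fderiv H μ hd w).2, mulL_apply]
    ring
  · have := Gf_int H μ ht hd (∂_{bP k} g)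
    simpa only [SchwartzMap.lineDerivOp_apply_eq_fderiv] using this

/-- matrix M = s B + i J -/
def Mm (n : ℕ) (S : Matrix (Idx n) (Idx n) ℂ) (μ t : ℝ) : Matrix (Idx n) (Idx n) ℂ :=
  ((Real.sign μ : ℝ) : ℂ) • Bt n S t + I • Jmat n

def Lm (n : ℕ) (S : Matrix (Idx n) (Idx n) ℂ) (μ t : ℝ) (j : Idx n) : Pl n →L[ℝ] ℂ :=
  lin ((-(2 * (Real.pi : ℂ))) • Mm n S μ t j)

theorem Lm_apply (μ t : ℝ) (j : Idx n) (w : Pl n) : Lm n S μ t j w = -(2 * (Real.pi : ℂ)) * (Mm n S μ t *ᵥ xv w) j := by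
  rw [Lm, lin_apply, smul_dotProduct]; rfl

theorem mu_sign {μ : ℝ} (hμ : μ ≠ 0) : μ * (2 * Real.pi / |μ|) = 2 * Real.pi * Real.sign μ := by
  rcases lt_or_gt_of_ne hμ with h | h
  · rw [abs_of_neg h, Real.sign_of_neg h]; field_simp
  · rw [abs_of_pos h, Real.sign_of_pos h]; field_simp

theorem IG_Ds (H : Hyp n A S l) {t μ : ℝ} (hμ : μ ≠ 0) (ht : 0 ≤ t) (hd : NonSing n S t) (k : Idx n) (g : SchwartzMap (Pl n) ℂ) :
    IGl H μ ht hd (Ds n μ k g) = IGl H μ ht hd (mulL (Lm n S μ t k) g) := by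
  have h1 : mulL (Lm n S μ t k) g = (-(2 * (Real.pi : ℂ)) * (Real.sign μ : ℝ)) • mulL (lin (Bt n S t k)) g + (-(2 * (Real.pi : ℂ) * I)) • mulL (lin (Jmat n k)) g := by
    ext w
    simp only [mulL_apply, SchwartzMap.add_apply, SchwartzMap.smul_apply, Lm_apply, Mm, Matrix.add_mulVec, Matrix.smul_mulVec, Pi.add_apply, Pi.smul_apply, smul_eq_mul, lin_apply]
    have e1 : (Bt n S t *ᵥ xv w) k = Bt n S t k ⬝ᵥ xv w := rfl
    have e2 : (Jmat n *ᵥ xv w) k = Jmat n k ⬝ᵥ xv w := rfl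
    rw [e1, e2]
    ring
  rw [h1, Ds]
  simp only [map_add, map_sub, map_smul, ibp, smul_eq_mul]
  have := congrArg (fun x : ℝ => (x : ℂ)) (mu_sign hμ)
  simp only [Complex.ofReal_mul] at this
  rw [Complex.ofReal_ofNat] at this
  linear_combination (-1) * (IGl H μ ht hd) ((mulL (lin (Bt n S t k))) g) * this

theorem mulL_Ds (ℓ : Pl n →L[ℝ] ℂ) (μ : ℝ) (k : Idx n) (g : SchwartzMap (Pl n) ℂ) :
    mulL ℓ (Ds n μ k g) = Ds n μ k (mulL ℓ g) + ((μ : ℂ) / 2 * ℓ (bP k)) • g := by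
  ext w
  simp only [Ds, deriv_mulL, SchwartzMap.add_apply, SchwartzMap.sub_apply, SchwartzMap.smul_apply, mulL_apply, smul_eq_mul]
  ring

theorem IG_DsDs (H : Hyp n A S l) {t μ : ℝ} (hμ : μ ≠ 0) (ht : 0 ≤ t) (hd : NonSing n S t) (j k : Idx n) (g : SchwartzMap (Pl n) ℂ) :
    IGl H μ ht hd (Ds n μ j (Ds n μ k g)) = IGl H μ ht hd (mulL (Lm n S μ t k) (mulL (Lm n S μ t j) g)) 
      - (Real.pi * μ * Mm n S μ t j k) * IGl H μ ht hd g := by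
  rw [IG_Ds H hμ, mulL_Ds, map_add, map_smul, IG_Ds H hμ]
  have : Lm n S μ t j (bP k) = -(2 * (Real.pi : ℂ)) * Mm n S μ t j k := by
    rw [Lm, lin_bP]; rfl
  rw [this, smul_eq_mul]
  ring

theorem A_eq (H : Hyp n A S l) : A = S * Jmat n := by
  rw [H.hS, neg_mul, Matrix.mul_assoc, Jmat_sq]; simp

abbrev Tt (S : Matrix (Idx n) (Idx n) ℂ) (t : ℝ) := matTan (((2 * Real.pi * t : ℝ) : ℂ) • S)

theorem ST_comm {t : ℝ} (hd : NonSing n S t) : S * Tt S t = Tt S t * S :=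
  adjoin_comm S _ _ (Algebra.self_mem_adjoin_singleton ℂ S) (matTan_mem S _ hd)

theorem sign_sq {μ : ℝ} (hμ : μ ≠ 0) : ((Real.sign μ : ℝ) : ℂ) * ((Real.sign μ : ℝ) : ℂ) = 1 := by
  rcases lt_or_gt_of_ne hμ with h | h
  · rw [Real.sign_of_neg h]; norm_num
  · rw [Real.sign_of_pos h]; norm_num

theorem MAM (H : Hyp n A S l) {t μ : ℝ} (hμ : μ ≠ 0) (hd : NonSing n S t) :
    (Mm n S μ t)ᵀ * A * Mm n S μ t = -(Jmat n * S * (1 + Tt S t * Tt S t)) := by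
  rw [Mm, Matrix.transpose_add, Matrix.transpose_smul, Matrix.transpose_smul, Bt_symm H.hA H.hS hd, Jmat_transpose, A_eq H, Bt]
  have e : S * matTan (((2 * Real.pi * t : ℝ) : ℂ) • S) = matTan (((2 * Real.pi * t : ℝ) : ℂ) • S) * S := ST_comm hd
  unfold Tt
  set T := matTan (((2 * Real.pi * t : ℝ) : ℂ) • S)
  set J := Jmat n
  set s := ((Real.sign μ : ℝ) : ℂ)
  have hs : s * s = 1 := sign_sq hμ
  have hJ : J * J = -1 := Jmat_sq n
  have h1 : (s • (J * T) + I • -J) = J * (s • T - I • 1) := by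
    rw [mul_sub]; simp [sub_eq_add_neg]
  have h2 : (s • (J * T) + I • J) = J * (s • T + I • 1) := by
    rw [mul_add]; simp
  rw [h1, h2]
  calc J * (s • T - I • 1) * (S * J) * (J * (s • T + I • 1)) = J * (s • T - I • 1) * S * (J * J) * (s • T + I • 1) := by noncomm_ring
    _ = -(J * ((s • T - I • 1) * S * (s • T + I • 1))) := by rw [hJ]; simp only [Matrix.mul_neg, Matrix.neg_mul, Matrix.mul_one, Matrix.mul_assoc]
    _ = _ := by
      rw [Matrix.mul_assoc J S]
      congr 2
      have h3 : (s • T - I • (1 : Matrix (Idx n) (Idx n) ℂ)) * S = S * (s • T - I • 1) := by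
        rw [sub_mul, mul_sub]; simp [e]
      rw [h3, Matrix.mul_assoc]
      congr 1
      simp only [sub_mul, mul_add, smul_mul_assoc, mul_smul_comm, Matrix.one_mul, Matrix.mul_one, smul_add, smul_smul, hs, Complex.I_mul_I, one_smul, mul_one, one_mul]
      simp only [smul_sub, smul_smul, hs, Complex.I_mul_I, mul_comm I s, one_smul, neg_smul]
      abel

theorem trAB (H : Hyp n A S l) {t μ : ℝ} (hd : NonSing n S t) :
    ∑ j, ∑ k, A j k * Mm n S μ t j k = - ((Real.sign μ : ℝ) : ℂ) * (S * Tt S t).trace := by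
  have h0 : ∑ j, ∑ k, A j k * Mm n S μ t j k = (A * Mm n S μ t).trace := by
    rw [Matrix.trace, Finset.sum_comm]
    refine Finset.sum_congr rfl fun i _ => ?_
    rw [Matrix.diag_apply, Matrix.mul_apply]
    refine Finset.sum_congr rfl fun j _ => ?_
    rw [← Matrix.transpose_apply A, H.hA]
  have h1 : (A * Jmat n).trace = 0 := by
    have h := Matrix.trace_transpose (A * Jmat n)
    rw [Matrix.transpose_mul, H.hA, Jmat_transpose, neg_mul, Matrix.trace_neg, Matrix.trace_mul_comm] at h
    have h2 : (2:ℂ) * (A * Jmat n).trace = 0 := by linear_combination -h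
    simpa using h2
  have h3 : A * Bt n S t = -(S * Tt S t) := by
    rw [A_eq H, Bt, Matrix.mul_assoc, ← Matrix.mul_assoc (Jmat n), Jmat_sq, Matrix.neg_mul, Matrix.one_mul, Matrix.mul_neg]
  rw [h0, Mm, Matrix.mul_add, Matrix.mul_smul, Matrix.mul_smul, Matrix.trace_add, Matrix.trace_smul, Matrix.trace_smul, h1, h3]
  simp

/-- the derivative multiplier -/
def Rm (n : ℕ) (S : Matrix (Idx n) (Idx n) ℂ) (μ t : ℝ) (w : Pl n) : ℂ :=
  (Real.pi * |μ| : ℝ) * (S * Tt S t).trace - 4 * (Real.pi : ℂ)^2 * (xv w ⬝ᵥ ((Jmat n * S * (1 + Tt S t * Tt S t)) *ᵥ xv w))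

theorem abs_sign (μ : ℝ) : (μ : ℂ) * ((Real.sign μ : ℝ) : ℂ) = ((|μ| : ℝ) : ℂ) := by
  rw [← Complex.ofReal_mul]
  congr 1
  rcases lt_trichotomy μ 0 with h | h | h
  · rw [Real.sign_of_neg h, abs_of_neg h]; ring
  · simp [h]
  · rw [Real.sign_of_pos h, abs_of_pos h]; ring

theorem IG_L (H : Hyp n A S l) {t μ : ℝ} (hμ : μ ≠ 0) (ht : 0 ≤ t) (hd : NonSing n S t) (g : SchwartzMap (Pl n) ℂ) :
    IG n S l μ t (∑ j, ∑ k, A j k • Ds n μ j (Ds n μ k g)) = ∫ w, Gf n S l μ t w * (Rm n S μ t w * g w) := by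
  have h1 : IG n S l μ t (∑ j, ∑ k, A j k • Ds n μ j (Ds n μ k g)) = IGl H μ ht hd (∑ j, ∑ k, A j k • Ds n μ j (Ds n μ k g)) := rfl
  have h2 : IGl H μ ht hd (∑ j, ∑ k, A j k • Ds n μ j (Ds n μ k g)) = 
     IGl H μ ht hd ((∑ j, ∑ k, A j k • (mulL (Lm n S μ t k) (mulL (Lm n S μ t j) g))) + ((Real.pi * |μ| : ℝ) * (S * Tt S t).trace) • g) := by
    simp only [map_sum, map_smul, map_add, IG_DsDs H hμ, smul_eq_mul, mul_sub, Finset.sum_sub_distrib]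
    rw [sub_eq_add_neg]
    congr 1
    have h3 : ∑ j, ∑ k, A j k * (Real.pi * μ * Mm n S μ t j k * IGl H μ ht hd g) = (Real.pi * μ * IGl H μ ht hd g) * ∑ j, ∑ k, A j k * Mm n S μ t j k := by
      simp only [Finset.mul_sum]
      refine Finset.sum_congr rfl fun j _ => Finset.sum_congr rfl fun k _ => by ring
    rw [h3, trAB H hd, Complex.ofReal_mul, ← abs_sign μ]
    ring
  rw [h1, h2]
  show ∫ w, _ = _
  refine integral_congr_ae (Filter.Eventually.of_forall fun w => ?_)
  simp only [SchwartzMap.add_apply, SchwartzMap.sum_apply, SchwartzMap.smul_apply, mulL_apply, smul_eq_mul]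
  congr 1
  rw [Rm]
  have h4 : xv w ⬝ᵥ ((Jmat n * S * (1 + Tt S t * Tt S t)) *ᵥ xv w) = - ∑ j, ∑ k, A j k * ((Mm n S μ t *ᵥ xv w) k * (Mm n S μ t *ᵥ xv w) j) := by
    rw [← neg_neg (Jmat n * S * (1 + Tt S t * Tt S t)), ← MAM H hμ hd, Matrix.neg_mulVec, dotProduct_neg, Matrix.mul_assoc, ← Matrix.mulVec_mulVec, ← Matrix.mulVec_mulVec,
      Matrix.dotProduct_mulVec, Matrix.vecMul_transpose]
    congr 1
    generalize Mm n S μ t *ᵥ xv w = y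
    simp only [dotProduct, Matrix.mulVec, Finset.mul_sum]
    refine Finset.sum_congr rfl fun j _ => Finset.sum_congr rfl fun k _ => by ring
  rw [h4]
  simp only [Lm_apply]
  have h5 : ∑ j, ∑ k, A j k * (-(2 * (Real.pi:ℂ)) * (Mm n S μ t *ᵥ xv w) k * (-(2 * (Real.pi:ℂ)) * (Mm n S μ t *ᵥ xv w) j * g w)) = 
     4 * (Real.pi : ℂ)^2 * g w * ∑ j, ∑ k, A j k * ((Mm n S μ t *ᵥ xv w) k * (Mm n S μ t *ᵥ xv w) j) := by
    simp only [Finset.mul_sum]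
    refine Finset.sum_congr rfl fun j _ => Finset.sum_congr rfl fun k _ => by ring
  rw [h5]
  ring
end
end part16

section part17
section
variable {n : ℕ} {A S : Matrix (Idx n) (Idx n) ℂ} {l : List ℂ}
open scoped Matrix.Norms.Operator

theorem quad_deriv (x : Idx n → ℂ) {t : ℝ} (hd : NonSing n S t) :
    HasDerivAt (fun t : ℝ => x ⬝ᵥ (Bt n S t *ᵥ x)) ((2 * Real.pi : ℂ) * (x ⬝ᵥ ((Jmat n * S * (1 + Tt S t * Tt S t)) *ᵥ x))) t := by
  let Λ : Matrix (Idx n) (Idx n) ℂ →ₗ[ℂ] ℂ :=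
    { toFun := fun M => x ⬝ᵥ ((Jmat n * M) *ᵥ x)
      map_add' := fun M N => by rw [Matrix.mul_add, Matrix.add_mulVec, dotProduct_add]
      map_smul' := fun c M => by rw [Matrix.mul_smul, Matrix.smul_mulVec, dotProduct_smul]; rfl }
  have h1 := (LinearMap.toContinuousLinearMap Λ).hasFDerivAt.comp_hasDerivAt _ (matTan_hasDerivAt S _ hd)
  have h2 : HasDerivAt (fun z : ℂ => Λ (matTan (z • S))) (Λ (S * (1 + Tt S t * Tt S t))) ((2 * Real.pi * t : ℝ) : ℂ) := h1
  have h3 := h2.comp_ofReal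
  have h4 : HasDerivAt (fun t : ℝ => 2 * Real.pi * t) (2 * Real.pi) t := by
    simpa using (hasDerivAt_id t).const_mul (2 * Real.pi)
  have h5 := h3.scomp t h4
  simp only [Function.comp_def] at h5
  refine HasDerivAt.congr_deriv (f := fun t : ℝ => x ⬝ᵥ (Bt n S t *ᵥ x)) h5 ?_
  rw [Complex.real_smul]
  push_cast
  congr 1
  show x ⬝ᵥ ((Jmat n * (S * (1 + Tt S t * Tt S t))) *ᵥ x) = _
  rw [Matrix.mul_assoc]

theorem Tt_cont {t : ℝ} (hd : NonSing n S t) : ContinuousAt (fun t : ℝ => Tt S t) t := by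
  have h := (matTan_hasDerivAt S _ hd).continuousAt
  exact ContinuousAt.comp (f := fun t : ℝ => ((2 * Real.pi * t : ℝ) : ℂ)) h (by fun_prop)
end

section
variable {n : ℕ} {A S : Matrix (Idx n) (Idx n) ℂ} {l : List ℂ}

theorem sqrt_deriv (H : Hyp n A S l) {t : ℝ} (hd : NonSing n S t) :
    HasDerivAt (fun t : ℝ => (sqrtDetCos t l)⁻¹) ((sqrtDetCos t l)⁻¹ * ((Real.pi : ℂ) * (S * Tt S t).trace)) t := by
  have hne : sqrtDetCos t l ≠ 0 := sqrtDetCos_ne H.hl hd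
  have hci : ∀ i : Fin l.length, Complex.cos (2 * (Real.pi : ℂ) * t * l.get i) ≠ 0 := by
    intro i h
    exact hne (Finset.prod_eq_zero (Finset.mem_univ i) h)
  have h1 : HasDerivAt (fun z : ℂ => sqrtDetCos z l) (-(sqrtDetCos t l * ((Real.pi : ℂ) * (S * Tt S t).trace))) (t : ℂ) := by
    have hi : ∀ i : Fin l.length, HasDerivAt (fun z : ℂ => Complex.cos (2 * (Real.pi : ℂ) * z * l.get i)) (-Complex.sin (2 * (Real.pi : ℂ) * t * l.get i) * (2 * (Real.pi : ℂ) * l.get i)) (t : ℂ) := by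
      intro i
      have h0 : HasDerivAt (fun z : ℂ => 2 * (Real.pi : ℂ) * z * l.get i) (2 * (Real.pi : ℂ) * l.get i) (t : ℂ) := by
        simpa using ((hasDerivAt_id (t : ℂ)).const_mul (2 * (Real.pi : ℂ))).mul_const (l.get i)
      exact h0.ccos
    have h2 := HasDerivAt.fun_finsetProd (u := Finset.univ) (fun i _ => hi i)
    refine h2.congr_deriv ?_
    rw [trace_S_tan S _ hd, sum_pair H.hl]
    have e1 : ((l : Multiset ℂ).map (fun x => x * Complex.tan (((2 * Real.pi * t : ℝ) : ℂ) * x))).sum = ∑ i : Fin l.length, l.get i * Complex.tan (2 * (Real.pi : ℂ) * t * l.get i) := by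
      rw [Multiset.map_coe, Multiset.sum_coe]
      conv_lhs => rw [← List.ofFn_get l]
      rw [List.map_ofFn, List.sum_ofFn]
      simp [Function.comp_def]
    rw [e1, Finset.mul_sum, Finset.mul_sum, Finset.mul_sum, ← Finset.sum_neg_distrib]
    refine Finset.sum_congr rfl fun i _ => ?_
    rw [sqrtDetCos, ← Finset.mul_prod_erase Finset.univ _ (Finset.mem_univ i), smul_eq_mul, Complex.tan_eq_sin_div_cos]
    have := hci i
    field_simp
  have h3 := (h1.comp_ofReal).inv hne
  refine h3.congr_deriv ?_
  field_simp

theorem Gf_deriv (H : Hyp n A S l) {t μ : ℝ} (hμ : μ ≠ 0) (hd : NonSing n S t) (w : Pl n) :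
    HasDerivAt (fun t : ℝ => Gf n S l μ t w) (Gf n S l μ t w * (((|μ| : ℝ) : ℂ)⁻¹ * Rm n S μ t w)) t := by
  have h1 := (sqrt_deriv H hd).mul (((quad_deriv (S := S) (xv w) hd).const_mul (-((2 * Real.pi / |μ| : ℝ) : ℂ))).cexp)
  have h2 : (fun t : ℝ => Gf n S l μ t w) = fun t : ℝ => (sqrtDetCos t l)⁻¹ * Complex.exp (-((2 * Real.pi / |μ| : ℝ) : ℂ) * (xv w ⬝ᵥ (Bt n S t *ᵥ xv w))) := by
    ext t; rw [Gf, GammaHat_eq]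
  rw [h2]
  refine h1.congr_deriv ?_
  rw [Gf, GammaHat_eq, Rm]
  have : ((|μ| : ℝ) : ℂ) ≠ 0 := by simpa using hμ
  push_cast
  field_simp
  ring

theorem NonSing_open {t : ℝ} (hd : NonSing n S t) : ∀ᶠ s in nhds t, NonSing n S s :=
  (((matCos_cont S).matrix_det).continuousAt (x := t)).eventually_ne hd

/-- the locally bounded prefactor -/
def Pc (n : ℕ) (S : Matrix (Idx n) (Idx n) ℂ) (l : List ℂ) (μ t : ℝ) : ℝ :=
  ‖(sqrtDetCos t l)⁻¹‖ * (‖((Real.pi * |μ| : ℝ) : ℂ) * (S * Tt S t).trace‖ + 4 * Real.pi^2 * ∑ i, ∑ j, ‖(Jmat n * S * (1 + Tt S t * Tt S t)) i j‖)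

theorem Pc_cont (H : Hyp n A S l) (μ : ℝ) {t : ℝ} (hd : NonSing n S t) : ContinuousAt (Pc n S l μ) t := by
  have h1 : ContinuousAt (fun t : ℝ => (sqrtDetCos t l)⁻¹) t := (sqrt_deriv H hd).continuousAt
  have hT : ContinuousAt (fun t : ℝ => Tt S t) t := Tt_cont hd
  have h2 : ContinuousAt (fun t : ℝ => (S * Tt S t).trace) t :=
    ContinuousAt.comp (g := fun M : Matrix (Idx n) (Idx n) ℂ => (S * M).trace) (f := fun t : ℝ => Tt S t) (Continuous.continuousAt (by fun_prop)) hT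
  have h3 : ∀ i j, ContinuousAt (fun t : ℝ => (Jmat n * S * (1 + Tt S t * Tt S t)) i j) t := fun i j =>
    ContinuousAt.comp (g := fun M : Matrix (Idx n) (Idx n) ℂ => (Jmat n * S * (1 + M * M)) i j) (f := fun t : ℝ => Tt S t) (Continuous.continuousAt (by 
      apply Continuous.matrix_elem; fun_prop)) hT
  unfold Pc
  fun_prop

theorem quad_norm (E : Matrix (Idx n) (Idx n) ℂ) (w : Pl n) :
    ‖xv w ⬝ᵥ (E *ᵥ xv w)‖ ≤ (∑ i, ∑ j, ‖E i j‖) * (1 + plVec n w ⬝ᵥ plVec n w) := by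
  simp only [dotProduct, Matrix.mulVec, Finset.mul_sum]
  refine (norm_sum_le _ _).trans ?_
  rw [Finset.sum_mul]
  refine Finset.sum_le_sum fun i _ => (norm_sum_le _ _).trans ?_
  rw [Finset.sum_mul]
  refine Finset.sum_le_sum fun j _ => ?_
  rw [norm_mul, norm_mul]
  have hi : ∀ i, ‖xv w i‖ ^ 2 ≤ ∑ i, plVec n w i * plVec n w i := by
    intro i
    have : ‖xv w i‖ ^ 2 = plVec n w i * plVec n w i := by
      simp [realVec, sq]
    rw [this]
    exact Finset.single_le_sum (f := fun i => plVec n w i * plVec n w i) (fun k _ => mul_self_nonneg _) (Finset.mem_univ i)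
  have h1 := hi i
  have h2 := hi j
  have h3 : ‖xv w i‖ * ‖xv w j‖ ≤ 1 + ∑ i, plVec n w i * plVec n w i := by nlinarith [sq_nonneg (‖xv w i‖ - ‖xv w j‖)]
  calc ‖xv w i‖ * (‖E i j‖ * ‖xv w j‖) = ‖E i j‖ * (‖xv w i‖ * ‖xv w j‖) := by ring
    _ ≤ _ := mul_le_mul_of_nonneg_left h3 (norm_nonneg _)

theorem Rm_bound (H : Hyp n A S l) (μ : ℝ) {t : ℝ} (ht : 0 ≤ t) (hd : NonSing n S t) (w : Pl n) :
    ‖Gf n S l μ t w * Rm n S μ t w‖ ≤ Pc n S l μ t * (1 + plVec n w ⬝ᵥ plVec n w) := by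
  have h0 : 0 ≤ plVec n w ⬝ᵥ plVec n w := dot_self_nonneg' _
  rw [norm_mul, Pc, mul_assoc]
  refine mul_le_mul (GammaHat_norm_le H.hA H.hS H.hpos ht hd μ l _) ?_ (norm_nonneg _) (norm_nonneg _)
  rw [Rm, add_mul]
  refine (norm_sub_le _ _).trans (add_le_add ?_ ?_)
  · exact le_mul_of_one_le_right (norm_nonneg _) (by linarith)
  · rw [norm_mul, mul_assoc (4 * Real.pi ^ 2)]
    have : ‖(4 * (Real.pi : ℂ)^2)‖ = 4 * Real.pi ^ 2 := by simp
    rw [this]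
    exact mul_le_mul_of_nonneg_left (quad_norm _ w) (by positivity)

theorem dot_int (g : SchwartzMap (Pl n) ℂ) : Integrable (fun w : Pl n => (1 + plVec n w ⬝ᵥ plVec n w) * ‖g w‖) := by
  have h1 := (g + ∑ i, mulL (lin (Pi.single i 1)) (mulL (lin (Pi.single i 1)) g)).integrable (μ := volume) |>.norm
  refine h1.congr (Filter.Eventually.of_forall fun w => ?_)
  simp only [SchwartzMap.add_apply, SchwartzMap.sum_apply, mulL_apply, lin_single]
  have h0 : 0 ≤ plVec n w ⬝ᵥ plVec n w := dot_self_nonneg' _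
  have : g w + ∑ x, xv w x * (xv w x * g w) = ((1 + plVec n w ⬝ᵥ plVec n w : ℝ) : ℂ) * g w := by
    simp only [← mul_assoc, ← Finset.sum_mul, dotProduct, realVec]
    push_cast; ring
  rw [this, norm_mul, Complex.norm_real, Real.norm_of_nonneg (by linarith)]

theorem IG_deriv (H : Hyp n A S l) {t μ : ℝ} (hμ : μ ≠ 0) (ht : 0 < t) (hd : NonSing n S t) (g : SchwartzMap (Pl n) ℂ) :
    HasDerivAt (fun t => IG n S l μ t g) (((|μ| : ℝ) : ℂ)⁻¹ * ∫ w, Gf n S l μ t w * (Rm n S μ t w * g w)) t := by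
  have hev : ∀ᶠ s in nhds t, 0 < s ∧ NonSing n S s ∧ Pc n S l μ s < Pc n S l μ t + 1 :=
    (lt_mem_nhds ht).and ((NonSing_open hd).and ((Pc_cont H μ hd).eventually_lt continuousAt_const (by simp)))
  have hGc : ∀ s : ℝ, Continuous (Gf n S l μ s) := fun s => (GammaHat_cont n μ s S l).comp (plVec_cont n)
  have hqc : ∀ s : ℝ, Continuous (Rm n S μ s) := by
    intro s
    unfold Rm
    have : Continuous (fun w : Pl n => xv w) := by
      refine continuous_pi fun i => ?_
      exact Complex.continuous_ofReal.comp ((continuous_apply i).comp (plVec_cont n))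
    fun_prop
  have key := hasDerivAt_integral_of_dominated_loc_of_deriv_le (μ := (volume : Measure (Pl n))) (F := fun t w => Gf n S l μ t w * g w)
    (F' := fun t w => Gf n S l μ t w * (((|μ| : ℝ) : ℂ)⁻¹ * Rm n S μ t w) * g w) (x₀ := t)
    (bound := fun w => |μ|⁻¹ * (Pc n S l μ t + 1) * ((1 + plVec n w ⬝ᵥ plVec n w) * ‖g w‖)) hev
    (Filter.Eventually.of_forall fun s => ((hGc s).mul g.continuous).aestronglyMeasurable) (Gf_int H μ ht.le hd g)
    (((hGc t).mul (continuous_const.mul (hqc t))).mul g.continuous).aestronglyMeasurable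
    (Filter.Eventually.of_forall fun w s hs => by
      have h0 : 0 ≤ plVec n w ⬝ᵥ plVec n w := dot_self_nonneg' _
      have h1 := Rm_bound H μ hs.1.le hs.2.1 w
      have h2 : ‖Gf n S l μ s w * (((|μ| : ℝ) : ℂ)⁻¹ * Rm n S μ s w) * g w‖ = |μ|⁻¹ * (‖Gf n S l μ s w * Rm n S μ s w‖ * ‖g w‖) := by
        simp only [norm_mul, norm_inv, Complex.norm_real, Real.norm_eq_abs, abs_abs]
        ring
      rw [h2, mul_assoc, ← mul_assoc (Pc n S l μ t + 1)]
      refine mul_le_mul_of_nonneg_left (mul_le_mul_of_nonneg_right (h1.trans ?_) (norm_nonneg _)) (by positivity)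
      exact mul_le_mul_of_nonneg_right hs.2.2.le (by linarith))
    ((dot_int g).const_mul _)
    (Filter.Eventually.of_forall fun w s hs => (Gf_deriv H hμ hs.2.1 w).mul_const _)
  refine key.2.congr_deriv ?_
  rw [← integral_const_mul]
  refine integral_congr_ae (Filter.Eventually.of_forall fun w => ?_)
  simp only
  ring
end
end part17

section part18
section
variable {n : ℕ} {A S : Matrix (Idx n) (Idx n) ℂ} {l : List ℂ}

theorem matCos_zero' (S : Matrix (Idx n) (Idx n) ℂ) : matCos (((2 * Real.pi * 0 : ℝ) : ℂ) • S) = 1 := by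
  rw [matCos_eq]
  simp [eS_zero]
  rw [← add_smul]; norm_num

theorem matSin_zero' (S : Matrix (Idx n) (Idx n) ℂ) : matSin (((2 * Real.pi * 0 : ℝ) : ℂ) • S) = 0 := by
  rw [matSin_eq]
  simp [eS_zero]

theorem NonSing_zero : NonSing n S 0 := by
  rw [NonSing, matCos_zero']; simp

theorem Gf_zero (μ : ℝ) (w : Pl n) : Gf n S l μ 0 w = 1 := by
  rw [Gf, GammaHat_eq, Bt, matTan, matSin_zero']
  simp [sqrtDetCos]

theorem Iw_eq (f : SchwartzMap (Hgrp n) ℂ) (μ t : ℝ) : Iw n S l f μ t = IG n S l μ t (sliceMap n μ (FH n f)) := rfl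

theorem Iw_L (H : Hyp n A S l) (α : ℂ) {t μ : ℝ} (hμ : μ ≠ 0) (ht : 0 ≤ t) (hd : NonSing n S t) 
    (φ ψ : SchwartzMap (Hgrp n) ℂ) (h : ⇑ψ = Lop n A (-α) ⇑φ) :
    Iw n S l ψ μ t = (∫ w, Gf n S l μ t w * (Rm n S μ t w * sliceMap n μ (FH n φ) w)) - (2 * (Real.pi : ℂ) * α * μ) * Iw n S l φ μ t := by
  rw [Iw_eq, slice_L A α φ ψ h μ, sub_eq_add_neg, ← neg_smul, IG_add H μ ht hd, IG_smul, IG_L H hμ ht hd, ← Iw_eq]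
  ring

theorem tint (H : Hyp n A S l) (α : ℂ) {μ : ℝ} (hμ : μ ≠ 0)
    {Γ : ℝ → ℝ → SchwartzMap (Pl n) ℂ →L[ℂ] ℂ} (hG : GamFT n S l Γ)
    (hcont : ∀ g : SchwartzMap (Pl n) ℂ, ContinuousOn (fun t => Γ μ t g) (Set.Ici 0))
    (φ ψ : SchwartzMap (Hgrp n) ℂ) (h : ⇑ψ = Lop n A (-α) ⇑φ)
    (hφ : IntegrableOn (fun t => Kint n S l α φ (μ, t)) (Set.Ioi 0))
    (hψ : IntegrableOn (fun t => Kint n S l α ψ (μ, t)) (Set.Ioi 0)) :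
    ∫ t in Set.Ioi 0, Kint n S l α ψ (μ, t) = - ∫ w, FH n φ (hk w μ) := by
  set g := sliceMap n μ (FH n φ) with hg
  have hm : ((|μ| : ℝ) : ℂ) ≠ 0 := by simpa using hμ
  set θ : ℝ → ℂ := fun t => Complex.exp (-(2 * (Real.pi : ℂ) * α * (t : ℂ) * ((Real.sign μ : ℝ) : ℂ))) * Γ μ t (FP n g) with hθ
  have hθc : ContinuousOn θ (Set.Ici 0) := by
    refine ContinuousOn.mul (Continuous.continuousOn (by fun_prop)) (hcont _)
  have hGI : ∀ t, 0 ≤ t → NonSing n S t → Γ μ t (FP n g) = Iw n S l φ μ t := fun t ht hd => Gam_eq hG hμ ht hd g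
  have hθd : ∀ t, 0 < t → NonSing n S t → HasDerivAt θ (Kint n S l α ψ (μ, t)) t := by
    intro t ht hd
    have h1 : HasDerivAt (fun t => Γ μ t (FP n g)) (((|μ| : ℝ) : ℂ)⁻¹ * ∫ w, Gf n S l μ t w * (Rm n S μ t w * g w)) t := by
      refine (IG_deriv H hμ ht hd g).congr_of_eventuallyEq ?_
      filter_upwards [lt_mem_nhds ht, NonSing_open hd] with s hs hs' using hGI s hs.le hs'
    have h2 : HasDerivAt (fun t : ℝ => Complex.exp (-(2 * (Real.pi : ℂ) * α * (t : ℂ) * ((Real.sign μ : ℝ) : ℂ)))) 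
        (Complex.exp (-(2 * (Real.pi : ℂ) * α * (t : ℂ) * ((Real.sign μ : ℝ) : ℂ))) * (-(2 * (Real.pi : ℂ) * α * ((Real.sign μ : ℝ) : ℂ)))) t := by
      have h3 : HasDerivAt (fun z : ℂ => -(2 * (Real.pi : ℂ) * α * z * ((Real.sign μ : ℝ) : ℂ))) (-(2 * (Real.pi : ℂ) * α * ((Real.sign μ : ℝ) : ℂ))) (t : ℂ) := by
        exact ((((hasDerivAt_id (t : ℂ)).const_mul (2 * (Real.pi : ℂ) * α)).mul_const ((Real.sign μ : ℝ) : ℂ)).neg).congr_deriv (by ring)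
      exact (h3.cexp).comp_ofReal
    refine (h2.mul h1).congr_deriv ?_
    rw [hGI t ht.le hd, Kint]
    simp only
    rw [Iw_L H α hμ ht.le hd φ ψ h, ← hg]
    have e := abs_sign μ
    have e2 := sign_sq hμ
    set s := ((Real.sign μ : ℝ) : ℂ)
    have e3 : (μ : ℂ) = ((|μ| : ℝ) : ℂ) * s := by rw [← e, mul_assoc, e2, mul_one]
    rw [e3]
    field_simp
    ring
  have hftc : ∀ T : ℝ, 0 ≤ T → ∫ t in (0:ℝ)..T, Kint n S l α ψ (μ, t) = θ T - θ 0 := by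
    intro T hT
    refine integral_eq_of_hasDerivAt_off_countable_of_le θ _ hT (sing_countable S) (hθc.mono Set.Icc_subset_Ici_self) ?_ ?_
    · rintro t ⟨ht, hs⟩
      exact hθd t ht.1 (by simpa using hs)
    · rw [intervalIntegrable_iff_integrableOn_Ioc_of_le hT]
      exact hψ.mono_set Set.Ioc_subset_Ioi_self
  have hlim := intervalIntegral_tendsto_integral_Ioi 0 hψ (Filter.tendsto_id)
  have hlim2 : Filter.Tendsto θ Filter.atTop (nhds ((∫ t in Set.Ioi 0, Kint n S l α ψ (μ, t)) + θ 0)) := by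
    refine (hlim.add_const (θ 0)).congr' ?_
    filter_upwards [Filter.eventually_ge_atTop 0] with T hT
    simp only [id]
    rw [hftc T hT]; ring
  have hθi : IntegrableOn θ (Set.Ioi 0) := by
    refine (hφ.const_mul ((|μ| : ℝ) : ℂ)).congr ?_
    have h1 : ∀ᵐ t : ℝ ∂(volume : Measure ℝ), NonSing n S t := (sing_countable S).measure_zero _
    filter_upwards [ae_restrict_of_ae h1, ae_restrict_mem measurableSet_Ioi] with t ht ht'
    simp only [hθ, Kint]
    rw [hGI t (le_of_lt ht') ht]
    field_simp
  have h0 : (∫ t in Set.Ioi 0, Kint n S l α ψ (μ, t)) + θ 0 = 0 := by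
    refine IntegrableAtFilter.eq_zero_of_tendsto (l := Filter.atTop) ⟨Set.Ioi 0, Filter.Ioi_mem_atTop 0, hθi⟩ ?_ hlim2
    intro s hs
    rcases Filter.mem_atTop_sets.1 hs with ⟨b, hb⟩
    rw [← top_le_iff, ← Real.volume_Ici (a := b)]
    exact measure_mono hb
  have h00 : θ 0 = ∫ w, FH n φ (hk w μ) := by
    simp only [hθ]
    rw [hGI 0 le_rfl NonSing_zero, Iw_eq, IG]
    simp [Gf_zero]
  rw [← h00]
  linear_combination h0

theorem part2 (H : Hyp n A S l) (α : ℂ) (hα : |α.re| < nuTotal n S)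
    {Γ : ℝ → ℝ → SchwartzMap (Pl n) ℂ →L[ℂ] ℂ} (hG : GamFT n S l Γ)
    (hcont : ∀ μ : ℝ, μ ≠ 0 → ∀ g : SchwartzMap (Pl n) ℂ, ContinuousOn (fun t => Γ μ t g) (Set.Ici 0))
    (φ ψ : SchwartzMap (Hgrp n) ℂ) (h : ⇑ψ = Lop n A (-α) ⇑φ) : KK H α hα ψ = φ 0 := by
  have iφ := Kint_int H α hα φ
  have iψ := Kint_int H α hα ψ
  rw [IntegrableOn, Dom_measure] at iφ iψ
  have hne : ∀ᵐ μ : ℝ ∂(volume : Measure ℝ), μ ≠ 0 := by simp [ae_iff]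
  have h1 : ∫ p in Dom, Kint n S l α ψ p = ∫ μ : ℝ, - ∫ w, FH n φ (hk w μ) := by
    rw [Dom_measure, integral_prod _ iψ]
    refine integral_congr_ae ?_
    filter_upwards [hne, iφ.prod_right_ae, iψ.prod_right_ae] with μ hμ h2 h3
    exact tint H α hμ hG (hcont μ hμ) φ ψ h h2 h3
  rw [KK_apply, h1, integral_neg, neg_neg]
  have h4 : φ 0 = ∫ p, FH n φ p := by
    conv_lhs => rw [← TI_TF (eH n) (rH n) φ]
    rw [TI_apply _ _ (rH_mp n)]
    simp
  have h5 := integrable_H (FH n φ).integrable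
  rw [h4, integral_H, Measure.volume_eq_prod (Pl n) ℝ, integral_prod_symm _ h5]
end
end part18

/-- (Proposition 6.1) under `Re Q_S ≥ 0`, `S_i ≠ 0`, condition (R) and
`|Re α| < ν`, the integral
`⟨K_α, f⟩ = -∫_ℝ ∫_0^∞ e^{-2παt sgn μ} ⟨Γ^μ_{t,S}, f^{-μ}⟩ dt dμ/|μ|`
converges absolutely for every Schwartz function `f` on `ℍ_n` and defines a tempered
distribution `K_α` which is a fundamental solution of `L_{S,α} = L_S + iαU`, i.e.
`L_{S,α} K_α = δ_0`.  Here `Γ^μ_{t,S}` is the (tempered) twisted-convolution kernel of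
the semigroup `exp((t/|μ|) L̃^μ_S)`, characterized by weak-* continuity in `t ≥ 0`
together with the explicit formula for its symplectic Fourier transform,
`Γ̂^μ_{t,S}(w) = det(cos 2πtS)^{-1/2} exp(-(2π/|μ|) σ(w, tan(2πtS)w))`, valid whenever
`det cos(2πtS) ≠ 0`; and `f^{-μ}(v) = ∫ f(v,u) e^{2πiμu} du` is the partial Fourier
transform of `f` in the central variable. -/
theorem statement16 (n : ℕ) (A : Matrix (Idx n) (Idx n) ℂ) (hA : Aᵀ = A)
    (S : Matrix (Idx n) (Idx n) ℂ) (hS : S = -(A * Jmat n))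
    (hpos : RePosQ n S) (hnr : HasNonrealEig n S) (hR : CondR n S)
    (α : ℂ) (hα : |α.re| < nuTotal n S)
    (lS : List ℂ) (hlS : IsPairingList n S lS)
    (Γ : ℝ → ℝ → SchwartzMap (Pl n) ℂ →L[ℂ] ℂ)
    (hcont : ∀ μ : ℝ, μ ≠ 0 → ∀ g : SchwartzMap (Pl n) ℂ,
        ContinuousOn (fun t => Γ μ t g) (Set.Ici 0))
    (hFT : ∀ μ : ℝ, μ ≠ 0 → ∀ t : ℝ, 0 ≤ t →
        (matCos (((2 * Real.pi * t : ℝ) : ℂ) • S)).det ≠ 0 →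
        ∀ g h : SchwartzMap (Pl n) ℂ,
          (∀ w : Pl n, h w = ∫ v : Pl n, g v *
              Complex.exp (-(2 * (Real.pi : ℂ) * Complex.I) *
                ((sigmaR n (plVec n w) (plVec n v) : ℝ) : ℂ))) →
          Γ μ t h = ∫ w : Pl n, GammaHat n μ (t : ℂ) S lS (realVec n (plVec n w)) * g w) :
    ∃ K : SchwartzMap (Hgrp n) ℂ →L[ℂ] ℂ,
      (∀ f : SchwartzMap (Hgrp n) ℂ, ∀ F : ℝ → SchwartzMap (Pl n) ℂ,
        (∀ μ : ℝ, ∀ v : Pl n, F μ v =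
            ∫ u : ℝ, f (v.1, v.2, u) *
              Complex.exp (2 * (Real.pi : ℂ) * Complex.I * (μ : ℂ) * (u : ℂ))) →
        IntegrableOn
          (fun p : ℝ × ℝ =>
            Complex.exp (-(2 * (Real.pi : ℂ) * α * (p.2 : ℂ) * ((Real.sign p.1 : ℝ) : ℂ))) *
              Γ p.1 p.2 (F p.1) / ((|p.1| : ℝ) : ℂ))
          {p : ℝ × ℝ | p.1 ≠ 0 ∧ 0 < p.2} volume ∧
        K f = -∫ p in {p : ℝ × ℝ | p.1 ≠ 0 ∧ 0 < p.2},
            Complex.exp (-(2 * (Real.pi : ℂ) * α * (p.2 : ℂ) * ((Real.sign p.1 : ℝ) : ℂ))) *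
              Γ p.1 p.2 (F p.1) / ((|p.1| : ℝ) : ℂ)) ∧
      ∀ φ ψ : SchwartzMap (Hgrp n) ℂ, ⇑ψ = Lop n A (-α) ⇑φ → K ψ = φ 0 := by
  have H : Hyp n A S lS := ⟨hA, hS, hpos, hnr, hlS⟩
  refine ⟨KK H α hα, fun f F hF => ?_, fun φ ψ h => part2 H α hα hFT hcont φ ψ h⟩
  have h1 := part1 H α hα hFT f F hF
  refine ⟨(Kint_int H α hα f).congr h1.symm, ?_⟩
  rw [KK_apply]
  exact congrArg Neg.neg (integral_congr_ae h1.symm)
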